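/- If κ is locally measurable, then every A ⊆ κ is an element of a weak κ-model M containing a set U that M thinks is a normal ultrafilter on κ such that the ultrapower of M by U is well-founded and its transitive collapse is contained in M; in particular, this holds whenever the largest cardinal of the weak κ-model M is (2^κ)^M. -/

import Mathlib

/-
Common framework for formalizing "Baby measurable cardinals" (Gitman–Schlicht).

Everything is developed internally to the type `ZFSet` of ZF sets from Mathlib.
A first-order language of set theory with one additional unary predicate symbol
(for an ultrafilter) is introduced, together with its Lévy hierarchy
(Δ₀-, Σₙ- and Πₙ-formulas), and satisfaction in structures whose domain is a
subclass `D` of an ambient type `T` equipped with a membership relation `E`,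
an equality interpretation `eqR` and a unary predicate `P`.

Cardinals, ordinals, inaccessibility, the `Vₐ`-hierarchy, the classes `H_θ`,
weak κ-models, κ-models, basic weak κ-models, `M`-ultrafilters, goodness
(well-foundedness of the ultrapower), weak amenability, and the various
large-cardinal notions of the paper are then defined from this.
-/

set_option maxHeartbeats 1000000
set_option linter.unusedVariables false
set_option linter.dupNamespace false

namespace BabyMeasurable

/-- Formulas of set theory, with variables indexed by `ℕ`, equality, membership,
an extra unary predicate symbol (`pred`, to be interpreted by an ultrafilter),
propositional connectives, bounded quantifiers (`ball i j φ` is `∀ xᵢ ∈ xⱼ, φ`)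
and unbounded quantifiers. -/
inductive SetFormula : Type where
  | mem : ℕ → ℕ → SetFormula
  | eq : ℕ → ℕ → SetFormula
  | pred : ℕ → SetFormula
  | not : SetFormula → SetFormula
  | and : SetFormula → SetFormula → SetFormula
  | or : SetFormula → SetFormula → SetFormula
  | ball : ℕ → ℕ → SetFormula → SetFormula
  | bex : ℕ → ℕ → SetFormula → SetFormula
  | all : ℕ → SetFormula → SetFormula
  | ex : ℕ → SetFormula → SetFormula

namespace SetFormula

/-- The formula does not mention the extra predicate symbol, i.e. it is a formula
of the pure language of set theory. -/
def PredFree : SetFormula → Prop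
  | mem _ _ => True
  | eq _ _ => True
  | pred _ => False
  | not φ => φ.PredFree
  | and φ ψ => φ.PredFree ∧ ψ.PredFree
  | or φ ψ => φ.PredFree ∧ ψ.PredFree
  | ball _ _ φ => φ.PredFree
  | bex _ _ φ => φ.PredFree
  | all _ φ => φ.PredFree
  | ex _ φ => φ.PredFree

/-- Δ₀-formulas: all quantifiers are bounded. -/
def IsDelta0 : SetFormula → Prop
  | mem _ _ => True
  | eq _ _ => True
  | pred _ => True
  | not φ => φ.IsDelta0
  | and φ ψ => φ.IsDelta0 ∧ ψ.IsDelta0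
  | or φ ψ => φ.IsDelta0 ∧ ψ.IsDelta0
  | ball _ _ φ => φ.IsDelta0
  | bex _ _ φ => φ.IsDelta0
  | all _ _ => False
  | ex _ _ => False

mutual
  /-- Σₙ-formulas of the Lévy hierarchy (with a Δ₀ matrix). -/
  inductive IsSigma : ℕ → SetFormula → Prop where
    | of_delta0 {n : ℕ} {φ : SetFormula} : φ.IsDelta0 → IsSigma n φ
    | of_pi {n : ℕ} {φ : SetFormula} : IsPi n φ → IsSigma (n + 1) φ
    | exI {n : ℕ} (k : ℕ) {φ : SetFormula} :
        IsSigma (n + 1) φ → IsSigma (n + 1) (SetFormula.ex k φ)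
  /-- Πₙ-formulas of the Lévy hierarchy (with a Δ₀ matrix). -/
  inductive IsPi : ℕ → SetFormula → Prop where
    | of_delta0 {n : ℕ} {φ : SetFormula} : φ.IsDelta0 → IsPi n φ
    | of_sigma {n : ℕ} {φ : SetFormula} : IsSigma n φ → IsPi (n + 1) φ
    | allI {n : ℕ} (k : ℕ) {φ : SetFormula} :
        IsPi (n + 1) φ → IsPi (n + 1) (SetFormula.all k φ)
end

end SetFormula

variable {T : Type*}

/-- Satisfaction of a formula in the structure with domain `D ⊆ T`, membership
relation `E`, equality interpreted by `eqR` and the unary predicate interpreted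
by `P`, under the variable assignment `v`. -/
def Interp (E eqR : T → T → Prop) (P D : Set T) : SetFormula → (ℕ → T) → Prop
  | .mem i j => fun v => E (v i) (v j)
  | .eq i j => fun v => eqR (v i) (v j)
  | .pred i => fun v => v i ∈ P
  | .not φ => fun v => ¬ Interp E eqR P D φ v
  | .and φ ψ => fun v => Interp E eqR P D φ v ∧ Interp E eqR P D ψ v
  | .or φ ψ => fun v => Interp E eqR P D φ v ∨ Interp E eqR P D ψ v
  | .ball i j φ => fun v => ∀ x ∈ D, E x (v j) → Interp E eqR P D φ (Function.update v i x)
  | .bex i j φ => fun v => ∃ x ∈ D, E x (v j) ∧ Interp E eqR P D φ (Function.update v i x)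
  | .all i φ => fun v => ∀ x ∈ D, Interp E eqR P D φ (Function.update v i x)
  | .ex i φ => fun v => ∃ x ∈ D, Interp E eqR P D φ (Function.update v i x)

/-! ### Internal set-theoretic notions relative to a structure `(D, E, eqR)` -/

/-- `a` is a subset of `b`, from the point of view of the structure. -/
def SubG (E eqR : T → T → Prop) (D : Set T) (a b : T) : Prop :=
  ∀ x ∈ D, E x a → E x b

/-- `t` is a transitive set, from the point of view of the structure. -/
def TransG (E eqR : T → T → Prop) (D : Set T) (t : T) : Prop :=
  ∀ x ∈ D, E x t → ∀ y ∈ D, E y x → E y t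

/-- `p` is the unordered pair `{x, y}`, from the point of view of the structure. -/
def UPairG (E eqR : T → T → Prop) (D : Set T) (p x y : T) : Prop :=
  ∀ z ∈ D, (E z p ↔ (eqR z x ∨ eqR z y))

/-- `p` is the (Kuratowski) ordered pair `⟨x, y⟩`, from the point of view of the
structure. -/
def OPairG (E eqR : T → T → Prop) (D : Set T) (p x y : T) : Prop :=
  ∃ s ∈ D, ∃ d ∈ D, E s p ∧ E d p ∧ UPairG E eqR D s x x ∧ UPairG E eqR D d x y ∧
    ∀ z ∈ D, E z p → (eqR z s ∨ eqR z d)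

/-- `f(x) = y`, i.e. the ordered pair `⟨x, y⟩` is a member of `f`. -/
def AppG (E eqR : T → T → Prop) (D : Set T) (f x y : T) : Prop :=
  ∃ p ∈ D, E p f ∧ OPairG E eqR D p x y

/-- `f` is a function with domain `dom`, from the point of view of the structure. -/
def IsFuncOnG (E eqR : T → T → Prop) (D : Set T) (dom f : T) : Prop :=
  (∀ p ∈ D, E p f → ∃ x ∈ D, E x dom ∧ ∃ y ∈ D, OPairG E eqR D p x y) ∧
  (∀ x ∈ D, E x dom → ∃ y ∈ D, AppG E eqR D f x y) ∧
  (∀ x ∈ D, E x dom → ∀ y ∈ D, ∀ y' ∈ D, AppG E eqR D f x y → AppG E eqR D f x y' → eqR y y')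

/-- `f` is an injective function from `dom` into `ran`. -/
def IsInjFunG (E eqR : T → T → Prop) (D : Set T) (dom ran f : T) : Prop :=
  IsFuncOnG E eqR D dom f ∧
  (∀ x ∈ D, ∀ y ∈ D, AppG E eqR D f x y → E y ran) ∧
  (∀ x ∈ D, ∀ x' ∈ D, ∀ y ∈ D, ∀ y' ∈ D,
    AppG E eqR D f x y → AppG E eqR D f x' y' → eqR y y' → eqR x x')

/-- `f` is a bijection between `dom` and `ran`. -/
def IsBijFunG (E eqR : T → T → Prop) (D : Set T) (dom ran f : T) : Prop :=
  IsInjFunG E eqR D dom ran f ∧ ∀ y ∈ D, E y ran → ∃ x ∈ D, E x dom ∧ AppG E eqR D f x y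

/-- `o` is a (von Neumann) ordinal: a transitive set of transitive sets, linearly
ordered by membership. -/
def IsOrdG (E eqR : T → T → Prop) (D : Set T) (o : T) : Prop :=
  TransG E eqR D o ∧ (∀ x ∈ D, E x o → TransG E eqR D x) ∧
  (∀ x ∈ D, E x o → ∀ y ∈ D, E y o → (E x y ∨ eqR x y ∨ E y x))

/-- `c` is a cardinal: an ordinal not bijective with any smaller ordinal. -/
def IsCardG (E eqR : T → T → Prop) (D : Set T) (c : T) : Prop :=
  IsOrdG E eqR D c ∧ ∀ o ∈ D, E o c → ∀ f ∈ D, ¬ IsBijFunG E eqR D o c f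

/-- `s = x ∪ {x}` is the ordinal successor of `x`. -/
def SuccOfG (E eqR : T → T → Prop) (D : Set T) (x s : T) : Prop :=
  ∀ z ∈ D, (E z s ↔ (E z x ∨ eqR z x))

/-- `e` is the empty set. -/
def IsEmptyG (E eqR : T → T → Prop) (D : Set T) (e : T) : Prop := ∀ z ∈ D, ¬ E z e

/-- `w` is the set `ω` of natural numbers: a nonzero ordinal closed under
successors all of whose elements are zero or successors. -/
def IsNatNumbersG (E eqR : T → T → Prop) (D : Set T) (w : T) : Prop :=
  IsOrdG E eqR D w ∧ (∃ e ∈ D, E e w ∧ IsEmptyG E eqR D e) ∧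
  (∀ x ∈ D, E x w → ∃ s ∈ D, E s w ∧ SuccOfG E eqR D x s) ∧
  (∀ x ∈ D, E x w → (IsEmptyG E eqR D x ∨ ∃ p ∈ D, E p w ∧ SuccOfG E eqR D p x))

/-- The cardinal `k` is regular: the range of any function from a smaller ordinal
into `k` is bounded in `k`. -/
def IsRegularG (E eqR : T → T → Prop) (D : Set T) (k : T) : Prop :=
  ∀ o ∈ D, E o k → ∀ f ∈ D, IsFuncOnG E eqR D o f →
    (∀ x ∈ D, ∀ y ∈ D, AppG E eqR D f x y → E y k) →
    ∃ b ∈ D, E b k ∧ ∀ x ∈ D, ∀ y ∈ D, AppG E eqR D f x y → E y b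

/-- `p` is the power set of `a`, from the point of view of the structure. -/
def IsPowG (E eqR : T → T → Prop) (D : Set T) (a p : T) : Prop :=
  ∀ z ∈ D, (E z p ↔ SubG E eqR D z a)

/-- `k` is a strong limit: for every `o ∈ k` the power set of `o` injects into
some element of `k`. -/
def IsStrongLimitG (E eqR : T → T → Prop) (D : Set T) (k : T) : Prop :=
  ∀ o ∈ D, E o k → ∃ p ∈ D, IsPowG E eqR D o p ∧
    ∃ c ∈ D, E c k ∧ ∃ f ∈ D, IsInjFunG E eqR D p c f

/-- `k` is an inaccessible cardinal: an uncountable regular strong limit cardinal. -/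
def IsInaccG (E eqR : T → T → Prop) (D : Set T) (k : T) : Prop :=
  IsCardG E eqR D k ∧ (∃ w ∈ D, IsNatNumbersG E eqR D w ∧ E w k) ∧
  IsRegularG E eqR D k ∧ IsStrongLimitG E eqR D k

/-- `x` belongs to `H_θ`: it is a member of a transitive set of size `< θ`. -/
def InHG (E eqR : T → T → Prop) (D : Set T) (θ x : T) : Prop :=
  ∃ t ∈ D, TransG E eqR D t ∧ E x t ∧ ∃ o ∈ D, E o θ ∧ ∃ f ∈ D, IsBijFunG E eqR D o t f

/-- `v` is the rank-initial segment `V_k` of the universe: there is a function `h`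
with domain `k` satisfying the defining recursion `h(ξ) = ⋃_{η<ξ} P(h(η))` of the
von Neumann hierarchy, and `v` is the union of the range of `h`. -/
def IsVStageG (E eqR : T → T → Prop) (D : Set T) (k v : T) : Prop :=
  ∃ h ∈ D, IsFuncOnG E eqR D k h ∧
    (∀ ξ ∈ D, E ξ k → ∀ y ∈ D, AppG E eqR D h ξ y →
      ∀ z ∈ D, (E z y ↔ ∃ η ∈ D, E η ξ ∧ ∃ w ∈ D, AppG E eqR D h η w ∧ SubG E eqR D z w)) ∧
    (∀ z ∈ D, (E z v ↔ ∃ ξ ∈ D, E ξ k ∧ ∃ w ∈ D, AppG E eqR D h ξ w ∧ E z w))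

/-! ### Schemes and theories -/

/-- The collection axiom for the formula `φ(x, y, parameters)` (with `x, y` the
variables `0, 1`) in the structure `(D, E, eqR, P)`. -/
def CollectionAxG (E eqR : T → T → Prop) (P D : Set T) (φ : SetFormula) : Prop :=
  ∀ v : ℕ → T, (∀ k, v k ∈ D) → ∀ a ∈ D,
    (∀ x ∈ D, E x a → ∃ y ∈ D,
      Interp E eqR P D φ (Function.update (Function.update v 0 x) 1 y)) →
    ∃ b ∈ D, ∀ x ∈ D, E x a → ∃ y ∈ D, E y b ∧
      Interp E eqR P D φ (Function.update (Function.update v 0 x) 1 y)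

/-- The separation axiom for the formula `φ(x, parameters)` (with `x` the
variable `0`) in the structure `(D, E, eqR, P)`. -/
def SeparationAxG (E eqR : T → T → Prop) (P D : Set T) (φ : SetFormula) : Prop :=
  ∀ v : ℕ → T, (∀ k, v k ∈ D) → ∀ a ∈ D, ∃ b ∈ D, ∀ x ∈ D,
    (E x b ↔ (E x a ∧ Interp E eqR P D φ (Function.update v 0 x)))

/-- The axioms of `ZFC⁻` other than the collection and separation schemes:
extensionality, pairing, union, infinity, foundation, and the well-ordering
version of choice (every set is bijective with an ordinal). Note that the power
set axiom is *not* included. -/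
def ModelsBaseG (E eqR : T → T → Prop) (D : Set T) : Prop :=
  (∀ a ∈ D, ∀ b ∈ D, (∀ x ∈ D, (E x a ↔ E x b)) → eqR a b) ∧
  (∀ a ∈ D, ∀ b ∈ D, ∃ p ∈ D, UPairG E eqR D p a b) ∧
  (∀ a ∈ D, ∃ u ∈ D, ∀ z ∈ D, (E z u ↔ ∃ y ∈ D, E y a ∧ E z y)) ∧
  (∃ i ∈ D, (∃ e ∈ D, E e i ∧ IsEmptyG E eqR D e) ∧
    ∀ x ∈ D, E x i → ∃ s ∈ D, E s i ∧ SuccOfG E eqR D x s) ∧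
  (∀ a ∈ D, (∃ x ∈ D, E x a) → ∃ m ∈ D, E m a ∧ ∀ z ∈ D, E z a → ¬ E z m) ∧
  (∀ a ∈ D, ∃ o ∈ D, IsOrdG E eqR D o ∧ ∃ f ∈ D, IsBijFunG E eqR D o a f)

/-- The structure `(D, E, eqR)` with predicate `P` satisfies the base axioms of
`ZFC⁻` together with the collection scheme for formulas in the class `C` and the
separation scheme for formulas in the class `S` (formulas in the language with
the extra predicate). -/
def ModelsG (E eqR : T → T → Prop) (D P : Set T) (C S : SetFormula → Prop) : Prop :=
  ModelsBaseG E eqR D ∧ (∀ φ, C φ → CollectionAxG E eqR P D φ) ∧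
    (∀ φ, S φ → SeparationAxG E eqR P D φ)

/-- The substructure with domain `D₁` (and predicate `P₁`) is an elementary
substructure of the structure with domain `D₂` (and predicate `P₂`) with respect
to all formulas in the class `C`. -/
def ElemG (E eqR : T → T → Prop) (C : SetFormula → Prop) (P₁ P₂ D₁ D₂ : Set T) : Prop :=
  D₁ ⊆ D₂ ∧ ∀ φ, C φ → ∀ v : ℕ → T, (∀ k, v k ∈ D₁) →
    (Interp E eqR P₁ D₁ φ v ↔ Interp E eqR P₂ D₂ φ v)

/-- The class `P` is a uniform normal ultrafilter on (the subsets of) `k`, from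
the point of view of the structure with domain `D`: its members are subsets of
`k` in `D`, it contains `k`, it is closed upwards and under intersections, it is
proper, it decides every subset of `k` in `D`, it contains all tails, and it is
closed under diagonal intersections of sequences in `D`. -/
def IsUFG (E eqR : T → T → Prop) (D : Set T) (k : T) (P : Set T) : Prop :=
  (∀ A ∈ P, A ∈ D ∧ SubG E eqR D A k) ∧
  (∃ a ∈ P, ∀ z ∈ D, (E z a ↔ E z k)) ∧
  (∀ A ∈ P, ∀ B ∈ D, SubG E eqR D A B → SubG E eqR D B k → B ∈ P) ∧
  (∀ A ∈ P, ∀ B ∈ P, ∃ c ∈ P, ∀ z ∈ D, (E z c ↔ (E z A ∧ E z B))) ∧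
  (∀ A ∈ P, ∃ z ∈ D, E z A) ∧
  (∀ A ∈ D, SubG E eqR D A k → (A ∈ P ∨ ∃ c ∈ P, ∀ z ∈ D, (E z c ↔ (E z k ∧ ¬ E z A)))) ∧
  (∀ ξ ∈ D, E ξ k → ∃ t ∈ P, ∀ z ∈ D, (E z t ↔ (E z k ∧ E ξ z))) ∧
  (∀ F ∈ D, IsFuncOnG E eqR D k F →
    (∀ ξ ∈ D, E ξ k → ∀ y ∈ D, AppG E eqR D F ξ y → y ∈ P) →
    ∃ d ∈ P, ∀ β ∈ D,
      (E β d ↔ (E β k ∧ ∀ ξ ∈ D, E ξ β → ∀ y ∈ D, AppG E eqR D F ξ y → E β y)))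

/-- Weak amenability of the predicate `P` over the model with domain `Dm`:
for every `A ∈ Dm` of size `k` in the model, `A ∩ P` is a member of the model. -/
def WeakAmenG (E eqR : T → T → Prop) (D : Set T) (Dm : Set T) (k : T) (P : Set T) : Prop :=
  ∀ A ∈ Dm, (∃ f ∈ Dm, IsBijFunG E eqR D k A f) →
    ∃ c ∈ Dm, ∀ z ∈ D, (E z c ↔ (E z A ∧ z ∈ P))

/-! ### Specialization to `ZFSet` -/

/-- The membership relation on `ZFSet`. -/
abbrev zmem : ZFSet → ZFSet → Prop := (· ∈ ·)

/-- Equality on `ZFSet`. -/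
abbrev zeq : ZFSet → ZFSet → Prop := (· = ·)

/-- The set of members of a `ZFSet`. -/
def memsOf (M : ZFSet) : Set ZFSet := {x | x ∈ M}

def ZApp (f x y : ZFSet) : Prop := AppG zmem zeq Set.univ f x y
def ZIsFuncOn (d f : ZFSet) : Prop := IsFuncOnG zmem zeq Set.univ d f
def ZIsBijFun (d r f : ZFSet) : Prop := IsBijFunG zmem zeq Set.univ d r f
def ZIsOrd (o : ZFSet) : Prop := IsOrdG zmem zeq Set.univ o
def ZIsCard (c : ZFSet) : Prop := IsCardG zmem zeq Set.univ c
def ZIsRegularCard (c : ZFSet) : Prop := ZIsCard c ∧ IsRegularG zmem zeq Set.univ c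
def ZIsInacc (k : ZFSet) : Prop := IsInaccG zmem zeq Set.univ k
def ZInH (θ x : ZFSet) : Prop := InHG zmem zeq Set.univ θ x
def ZIsVStage (k v : ZFSet) : Prop := IsVStageG zmem zeq Set.univ k v
def ZIsTransitive (t : ZFSet) : Prop := TransG zmem zeq Set.univ t

/-- `t` is the cardinal successor `k⁺` of the cardinal `k`. -/
def ZIsSuccCardOf (k t : ZFSet) : Prop :=
  ZIsCard t ∧ k ∈ t ∧ ∀ c : ZFSet, ZIsCard c → k ∈ c → (t = c ∨ t ∈ c)

/-- `f` is the constant function on `d` with value `c`. -/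
def IsConstFunOn (d c f : ZFSet) : Prop :=
  ZIsFuncOn d f ∧ ∀ ξ y : ZFSet, ZApp f ξ y → y = c

/-- `⟨D, ∈⟩ ⊨ ZFC⁻` (in the pure language of set theory, with full collection
and separation). -/
def ModelsZFCminusPure (D : Set ZFSet) : Prop :=
  ModelsG zmem zeq D (∅ : Set ZFSet) SetFormula.PredFree SetFormula.PredFree

/-- `⟨D, ∈, U⟩ ⊨ ZFC⁻`, with full collection and separation in the language with
a predicate for `U`. -/
def ModelsZFCminusU (D U : Set ZFSet) : Prop :=
  ModelsG zmem zeq D U (fun _ => True) (fun _ => True)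

/-- `⟨D, ∈, U⟩ ⊨ ZFC⁻ₙ`: collection and separation are restricted to
Σₙ-formulas (in the language with a predicate for `U`). -/
def ModelsZFCminusN (n : ℕ) (D U : Set ZFSet) : Prop :=
  ModelsG zmem zeq D U (SetFormula.IsSigma n) (SetFormula.IsSigma n)

/-- `⟨D, ∈, U⟩ ⊨ KPₙ`: collection is restricted to Σₙ-formulas and separation to
Δ₀-formulas (in the language with a predicate for `U`). -/
def ModelsKP (n : ℕ) (D U : Set ZFSet) : Prop :=
  ModelsG zmem zeq D U (SetFormula.IsSigma n) SetFormula.IsDelta0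

/-- `M` is a weak κ-model: κ is inaccessible and `M` is a transitive model of
`ZFC⁻` of size κ with `V_κ ∈ M`. -/
def IsWeakKappaModel (k M : ZFSet) : Prop :=
  ZIsInacc k ∧ ZIsTransitive M ∧ (∃ f : ZFSet, ZIsBijFun k M f) ∧
  (∃ v : ZFSet, v ∈ M ∧ ZIsVStage k v) ∧ ModelsZFCminusPure (memsOf M)

/-- `M` is closed under sequences of length `< α`: every function with domain an
ordinal `β ∈ α` and values in `M` is a member of `M`. -/
def SeqClosed (α M : ZFSet) : Prop :=
  ∀ β f : ZFSet, β ∈ α → ZIsFuncOn β f →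
    (∀ ξ y : ZFSet, ZApp f ξ y → y ∈ M) → f ∈ M

/-- `M` is a κ-model: a weak κ-model closed under `< κ`-sequences. -/
def IsKappaModel (k M : ZFSet) : Prop := IsWeakKappaModel k M ∧ SeqClosed k M

/-- `M` is a Σ₀-elementary substructure of the universe `V` of all sets. -/
def Sigma0ElemInV (M : ZFSet) : Prop :=
  ElemG zmem zeq (fun φ => φ.IsDelta0 ∧ φ.PredFree) ∅ ∅ (memsOf M) Set.univ

/-- `M` is a basic weak κ-model: κ is inaccessible and `M` is a (not necessarily
transitive) model of `ZFC⁻` of size κ with `M ≺_{Σ₀} V` and `V_κ ∪ {V_κ} ⊆ M`. -/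
def IsBasicWeakKappaModel (k M : ZFSet) : Prop :=
  ZIsInacc k ∧ (∃ f : ZFSet, ZIsBijFun k M f) ∧ Sigma0ElemInV M ∧
  (∃ v : ZFSet, v ∈ M ∧ ZIsVStage k v ∧ v ⊆ M) ∧ ModelsZFCminusPure (memsOf M)

/-- `M` is a basic κ-model: a basic weak κ-model closed under `< κ`-sequences. -/
def IsBasicKappaModel (k M : ZFSet) : Prop := IsBasicWeakKappaModel k M ∧ SeqClosed k M

/-- `U` is an ultrafilter on (the subsets of `k` belonging to) the class `Dm`:
the structure `⟨Dm, ∈, U⟩` satisfies that `U` is a uniform normal ultrafilter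
on `k`. -/
def IsMUltrafilterD (k : ZFSet) (Dm : Set ZFSet) (U : Set ZFSet) : Prop :=
  IsUFG zmem zeq Dm k U

/-- `U` is an `M`-ultrafilter: the structure `⟨M, ∈, U⟩` satisfies that `U` is a
uniform normal ultrafilter on `k`. -/
def IsMUltrafilter (k M : ZFSet) (U : Set ZFSet) : Prop :=
  IsMUltrafilterD k (memsOf M) U

/-- `U` is weakly amenable for `M`: for every `A ∈ M` of size `k` in `M`,
`A ∩ U ∈ M`. -/
def WeaklyAmenable (k M : ZFSet) (U : Set ZFSet) : Prop :=
  WeakAmenG zmem zeq Set.univ (memsOf M) k U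

/-- `f` is a point of the ultrapower of the model `Dm` by an ultrafilter on `k`:
a function in `Dm` with domain `k`. -/
def UltPt (Dm : Set ZFSet) (k f : ZFSet) : Prop := f ∈ Dm ∧ ZIsFuncOn k f

/-- The membership relation of the ultrapower of `Dm` by `U`:
`[f] ∈ [g]` iff `{ξ ∈ k ∣ f(ξ) ∈ g(ξ)} ∈ U`. -/
def UltMem (Dm : Set ZFSet) (k : ZFSet) (U : Set ZFSet) (f g : ZFSet) : Prop :=
  UltPt Dm k f ∧ UltPt Dm k g ∧
  ∃ s ∈ U, ∀ ξ : ZFSet,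
    (ξ ∈ s ↔ (ξ ∈ k ∧ ∃ a b : ZFSet, ZApp f ξ a ∧ ZApp g ξ b ∧ a ∈ b))

/-- The equality relation of the ultrapower of `Dm` by `U`:
`[f] = [g]` iff `{ξ ∈ k ∣ f(ξ) = g(ξ)} ∈ U`. -/
def UltEq (Dm : Set ZFSet) (k : ZFSet) (U : Set ZFSet) (f g : ZFSet) : Prop :=
  UltPt Dm k f ∧ UltPt Dm k g ∧
  ∃ s ∈ U, ∀ ξ : ZFSet,
    (ξ ∈ s ↔ (ξ ∈ k ∧ ∃ a b : ZFSet, ZApp f ξ a ∧ ZApp g ξ b ∧ a = b))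

/-- The ultrafilter `U` on the model `Dm` is good: the ultrapower of `Dm` by `U`
is well-founded. -/
def GoodUltrafilterD (Dm : Set ZFSet) (k : ZFSet) (U : Set ZFSet) : Prop :=
  WellFounded (UltMem Dm k U)

/-- The `M`-ultrafilter `U` is good: the ultrapower of `M` by `U` is
well-founded. -/
def GoodUltrafilter (k M : ZFSet) (U : Set ZFSet) : Prop :=
  GoodUltrafilterD (memsOf M) k U

/-- The class `H_θ` of sets hereditarily of size `< θ`. -/
def HClass (θ : ZFSet) : Set ZFSet := {x | ZInH θ x}

/-- `H_{k⁺}^{Dm}`: the members of the class `Dm` which are hereditarily of size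
`≤ k`. -/
def HkP (k : ZFSet) (Dm : Set ZFSet) : Set ZFSet :=
  {x | x ∈ Dm ∧ ∃ t : ZFSet, ZIsSuccCardOf k t ∧ ZInH t x}

/-- `M ≺ H_θ`: `M` is fully elementary in `H_θ` (in the pure language). -/
def FullElemInH (M θ : ZFSet) : Prop :=
  ElemG zmem zeq SetFormula.PredFree ∅ ∅ (memsOf M) (HClass θ)

/-- `⟨D₁, ∈, U ∩ D₁⟩ ≺_{Σₙ} ⟨D₂, ∈, U⟩`. -/
def SigmaNElem (n : ℕ) (U : Set ZFSet) (D₁ D₂ : Set ZFSet) : Prop :=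
  ElemG zmem zeq (SetFormula.IsSigma n) U U D₁ D₂

/-- `⟨D₁, ∈, U ∩ D₁⟩ ≺ ⟨D₂, ∈, U⟩` (full elementarity in the language with the
predicate). -/
def FullElemWithU (U : Set ZFSet) (D₁ D₂ : Set ZFSet) : Prop :=
  ElemG zmem zeq (fun _ => True) U U D₁ D₂

/-! ### Large cardinal notions -/

/-- κ is faintly `n`-baby measurable: every `A ⊆ κ` is an element of a weak
κ-model `M` for which there is an `M`-ultrafilter `U` (not necessarily good)
such that `⟨M, ∈, U⟩ ⊨ ZFC⁻ₙ`. -/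
def FaintlyNBabyMeasurable (n : ℕ) (k : ZFSet) : Prop :=
  ZIsInacc k ∧ ∀ A : ZFSet, A ⊆ k → ∃ (M : ZFSet) (U : Set ZFSet),
    IsWeakKappaModel k M ∧ A ∈ M ∧ IsMUltrafilter k M U ∧
    ModelsZFCminusN n (memsOf M) U

/-- κ is weakly `n`-baby measurable: as above with `U` additionally good. -/
def WeaklyNBabyMeasurable (n : ℕ) (k : ZFSet) : Prop :=
  ZIsInacc k ∧ ∀ A : ZFSet, A ⊆ k → ∃ (M : ZFSet) (U : Set ZFSet),
    IsWeakKappaModel k M ∧ A ∈ M ∧ IsMUltrafilter k M U ∧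
    GoodUltrafilter k M U ∧ ModelsZFCminusN n (memsOf M) U

/-- κ is `n`-baby measurable: as above with `M` additionally a κ-model. -/
def NBabyMeasurable (n : ℕ) (k : ZFSet) : Prop :=
  ZIsInacc k ∧ ∀ A : ZFSet, A ⊆ k → ∃ (M : ZFSet) (U : Set ZFSet),
    IsKappaModel k M ∧ A ∈ M ∧ IsMUltrafilter k M U ∧
    GoodUltrafilter k M U ∧ ModelsZFCminusN n (memsOf M) U

/-- κ is `[n]`-baby measurable: every `A ⊆ κ` is an element of a κ-model `M` for
which there is a good `M`-ultrafilter `U` such that `⟨M, ∈, U⟩ ⊨ KPₙ`. -/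
def BracketNBabyMeasurable (n : ℕ) (k : ZFSet) : Prop :=
  ZIsInacc k ∧ ∀ A : ZFSet, A ⊆ k → ∃ (M : ZFSet) (U : Set ZFSet),
    IsKappaModel k M ∧ A ∈ M ∧ IsMUltrafilter k M U ∧
    GoodUltrafilter k M U ∧ ModelsKP n (memsOf M) U

/-- κ is faintly `[n]`-baby measurable: goodness is dropped and `M` is only
required to be a weak κ-model. -/
def FaintlyBracketNBabyMeasurable (n : ℕ) (k : ZFSet) : Prop :=
  ZIsInacc k ∧ ∀ A : ZFSet, A ⊆ k → ∃ (M : ZFSet) (U : Set ZFSet),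
    IsWeakKappaModel k M ∧ A ∈ M ∧ IsMUltrafilter k M U ∧ ModelsKP n (memsOf M) U

/-- κ is weakly `[n]`-baby measurable: `M` is only required to be a weak
κ-model, but `U` is good. -/
def WeaklyBracketNBabyMeasurable (n : ℕ) (k : ZFSet) : Prop :=
  ZIsInacc k ∧ ∀ A : ZFSet, A ⊆ k → ∃ (M : ZFSet) (U : Set ZFSet),
    IsWeakKappaModel k M ∧ A ∈ M ∧ IsMUltrafilter k M U ∧
    GoodUltrafilter k M U ∧ ModelsKP n (memsOf M) U

/-- κ is faintly baby measurable: every `A ⊆ κ` is an element of a weak κ-model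
`M` for which there is an `M`-ultrafilter `U` such that `⟨M, ∈, U⟩ ⊨ ZFC⁻`. -/
def FaintlyBabyMeasurable (k : ZFSet) : Prop :=
  ZIsInacc k ∧ ∀ A : ZFSet, A ⊆ k → ∃ (M : ZFSet) (U : Set ZFSet),
    IsWeakKappaModel k M ∧ A ∈ M ∧ IsMUltrafilter k M U ∧
    ModelsZFCminusU (memsOf M) U

/-- κ is weakly baby measurable: as above with `U` additionally good. -/
def WeaklyBabyMeasurable (k : ZFSet) : Prop :=
  ZIsInacc k ∧ ∀ A : ZFSet, A ⊆ k → ∃ (M : ZFSet) (U : Set ZFSet),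
    IsWeakKappaModel k M ∧ A ∈ M ∧ IsMUltrafilter k M U ∧
    GoodUltrafilter k M U ∧ ModelsZFCminusU (memsOf M) U

/-- κ is baby measurable: as above with `M` additionally a κ-model. -/
def BabyMeasurable (k : ZFSet) : Prop :=
  ZIsInacc k ∧ ∀ A : ZFSet, A ⊆ k → ∃ (M : ZFSet) (U : Set ZFSet),
    IsKappaModel k M ∧ A ∈ M ∧ IsMUltrafilter k M U ∧
    GoodUltrafilter k M U ∧ ModelsZFCminusU (memsOf M) U

/-- κ is locally measurable: every `A ⊆ κ` is an element of a weak κ-model `M`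
containing a set `u` which `M` thinks is a (uniform) normal ultrafilter on κ. -/
def LocallyMeasurable (k : ZFSet) : Prop :=
  ZIsInacc k ∧ ∀ A : ZFSet, A ⊆ k → ∃ M u : ZFSet,
    IsWeakKappaModel k M ∧ A ∈ M ∧ u ∈ M ∧ IsMUltrafilter k M (memsOf u)

/-- κ is `(α, n)`-baby measurable: for every `A ⊆ κ` and arbitrarily large
cardinals θ there is a `< α`-closed basic weak κ-model `M ≺ H_θ` with `A ∈ M`
and a good `M`-ultrafilter `U` such that `⟨H_{κ⁺}^M, ∈, U⟩ ⊨ ZFC⁻ₙ`. -/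
def AlphaNBabyMeasurable (α : ZFSet) (n : ℕ) (k : ZFSet) : Prop :=
  ZIsInacc k ∧ ∀ A : ZFSet, A ⊆ k → ∀ θ₀ : ZFSet, ∃ θ : ZFSet, ZIsCard θ ∧ θ₀ ∈ θ ∧
    ∃ (M : ZFSet) (U : Set ZFSet),
      IsBasicWeakKappaModel k M ∧ SeqClosed α M ∧ FullElemInH M θ ∧ A ∈ M ∧
      IsMUltrafilter k M U ∧ GoodUltrafilterD (memsOf M) k U ∧
      ModelsZFCminusN n (HkP k (memsOf M)) U

/-- κ is faintly `(ω, n)`-baby measurable: as for `(ω, n)`-baby measurable, but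
the `M`-ultrafilter is not required to be good. -/
def FaintlyOmegaNBabyMeasurable (n : ℕ) (k : ZFSet) : Prop :=
  ZIsInacc k ∧ ∀ A : ZFSet, A ⊆ k → ∀ θ₀ : ZFSet, ∃ θ : ZFSet, ZIsCard θ ∧ θ₀ ∈ θ ∧
    ∃ (M : ZFSet) (U : Set ZFSet),
      IsBasicWeakKappaModel k M ∧ FullElemInH M θ ∧ A ∈ M ∧
      IsMUltrafilter k M U ∧ ModelsZFCminusN n (HkP k (memsOf M)) U

/-- κ is reflective `(α, n)`-baby measurable: for every `A ⊆ κ` and arbitrarily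
large cardinals θ there is a `< α`-closed basic weak κ-model `M ≺ H_θ` with
`A ∈ M` and a good `M`-ultrafilter `U` such that for every `B ⊆ κ` in `M` there
is a κ-model `M̄ ∈ M` with `B ∈ M̄`, `⟨M̄, ∈, U ∩ M̄⟩ ≺_{Σₙ} ⟨H_{κ⁺}^M, ∈, U⟩`
and `⟨M̄, ∈, U ∩ M̄⟩ ⊨ ZFC⁻ₙ`. -/
def ReflAlphaNBabyMeasurable (α : ZFSet) (n : ℕ) (k : ZFSet) : Prop :=
  ZIsInacc k ∧ ∀ A : ZFSet, A ⊆ k → ∀ θ₀ : ZFSet, ∃ θ : ZFSet, ZIsCard θ ∧ θ₀ ∈ θ ∧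
    ∃ (M : ZFSet) (U : Set ZFSet),
      IsBasicWeakKappaModel k M ∧ SeqClosed α M ∧ FullElemInH M θ ∧ A ∈ M ∧
      IsMUltrafilter k M U ∧ GoodUltrafilterD (memsOf M) k U ∧
      ∀ B : ZFSet, B ∈ M → B ⊆ k → ∃ Mb : ZFSet, Mb ∈ M ∧ IsKappaModel k Mb ∧ B ∈ Mb ∧
        SigmaNElem n U (memsOf Mb) (HkP k (memsOf M)) ∧
        ModelsZFCminusN n (memsOf Mb) U

/-- κ is faintly reflective `(ω, n)`-baby measurable: as for reflective
`(ω, n)`-baby measurable, but the `M`-ultrafilter is not required to be good. -/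
def FaintlyReflOmegaNBabyMeasurable (n : ℕ) (k : ZFSet) : Prop :=
  ZIsInacc k ∧ ∀ A : ZFSet, A ⊆ k → ∀ θ₀ : ZFSet, ∃ θ : ZFSet, ZIsCard θ ∧ θ₀ ∈ θ ∧
    ∃ (M : ZFSet) (U : Set ZFSet),
      IsBasicWeakKappaModel k M ∧ FullElemInH M θ ∧ A ∈ M ∧
      IsMUltrafilter k M U ∧
      ∀ B : ZFSet, B ∈ M → B ⊆ k → ∃ Mb : ZFSet, Mb ∈ M ∧ IsKappaModel k Mb ∧ B ∈ Mb ∧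
        SigmaNElem n U (memsOf Mb) (HkP k (memsOf M)) ∧
        ModelsZFCminusN n (memsOf Mb) U

/-- κ is `α`-baby measurable: the `ZFC⁻` version of `(α, n)`-baby measurable. -/
def AlphaBabyMeasurable (α k : ZFSet) : Prop :=
  ZIsInacc k ∧ ∀ A : ZFSet, A ⊆ k → ∀ θ₀ : ZFSet, ∃ θ : ZFSet, ZIsCard θ ∧ θ₀ ∈ θ ∧
    ∃ (M : ZFSet) (U : Set ZFSet),
      IsBasicWeakKappaModel k M ∧ SeqClosed α M ∧ FullElemInH M θ ∧ A ∈ M ∧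
      IsMUltrafilter k M U ∧ GoodUltrafilterD (memsOf M) k U ∧
      ModelsZFCminusU (HkP k (memsOf M)) U

/-- κ is reflective `α`-baby measurable: the `ZFC⁻`/fully elementary version of
reflective `(α, n)`-baby measurable. -/
def ReflAlphaBabyMeasurable (α k : ZFSet) : Prop :=
  ZIsInacc k ∧ ∀ A : ZFSet, A ⊆ k → ∀ θ₀ : ZFSet, ∃ θ : ZFSet, ZIsCard θ ∧ θ₀ ∈ θ ∧
    ∃ (M : ZFSet) (U : Set ZFSet),
      IsBasicWeakKappaModel k M ∧ SeqClosed α M ∧ FullElemInH M θ ∧ A ∈ M ∧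
      IsMUltrafilter k M U ∧ GoodUltrafilterD (memsOf M) k U ∧
      ∀ B : ZFSet, B ∈ M → B ⊆ k → ∃ Mb : ZFSet, Mb ∈ M ∧ IsKappaModel k Mb ∧ B ∈ Mb ∧
        FullElemWithU U (memsOf Mb) (HkP k (memsOf M)) ∧
        ModelsZFCminusU (memsOf Mb) U

/-! ### Ramsey-like notions -/

/-- κ is strongly Ramsey: every `A ⊆ κ` is an element of a κ-model `M` for which
there is a weakly amenable `M`-ultrafilter. -/
def StronglyRamsey (k : ZFSet) : Prop :=
  ZIsInacc k ∧ ∀ A : ZFSet, A ⊆ k → ∃ (M : ZFSet) (U : Set ZFSet),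
    IsKappaModel k M ∧ A ∈ M ∧ IsMUltrafilter k M U ∧ WeaklyAmenable k M U

/-- κ is `β`-Ramsey (for a regular cardinal `ω ≤ β ≤ κ`): for every `A ⊆ κ` and
arbitrarily large cardinals θ there is a `< β`-closed basic weak κ-model
`M ≺ H_θ` with `A ∈ M` for which there is a good weakly amenable
`M`-ultrafilter. -/
def BetaRamsey (β k : ZFSet) : Prop :=
  ZIsInacc k ∧ ∀ A : ZFSet, A ⊆ k → ∀ θ₀ : ZFSet, ∃ θ : ZFSet, ZIsCard θ ∧ θ₀ ∈ θ ∧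
    ∃ (M : ZFSet) (U : Set ZFSet),
      IsBasicWeakKappaModel k M ∧ SeqClosed β M ∧ FullElemInH M θ ∧ A ∈ M ∧
      IsMUltrafilter k M U ∧ WeaklyAmenable k M U ∧ GoodUltrafilterD (memsOf M) k U

/-- κ is ω-Ramsey: for every `A ⊆ κ` and arbitrarily large cardinals θ there is
a basic weak κ-model `M ≺ H_θ` with `A ∈ M` for which there is a good weakly
amenable `M`-ultrafilter. -/
def OmegaRamsey (k : ZFSet) : Prop :=
  ZIsInacc k ∧ ∀ A : ZFSet, A ⊆ k → ∀ θ₀ : ZFSet, ∃ θ : ZFSet, ZIsCard θ ∧ θ₀ ∈ θ ∧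
    ∃ (M : ZFSet) (U : Set ZFSet),
      IsBasicWeakKappaModel k M ∧ FullElemInH M θ ∧ A ∈ M ∧
      IsMUltrafilter k M U ∧ WeaklyAmenable k M U ∧ GoodUltrafilterD (memsOf M) k U

/-- κ is 0-iterable: every `A ⊆ κ` is an element of a weak κ-model `M` for which
there is a weakly amenable (not necessarily good) `M`-ultrafilter. -/
def ZeroIterable (k : ZFSet) : Prop :=
  ZIsInacc k ∧ ∀ A : ZFSet, A ⊆ k → ∃ (M : ZFSet) (U : Set ZFSet),
    IsWeakKappaModel k M ∧ A ∈ M ∧ IsMUltrafilter k M U ∧ WeaklyAmenable k M U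

/-- `f(x, y) = z` for a function `f` defined on ordered pairs. -/
def ZApp2 (f x y z : ZFSet) : Prop :=
  ∃ q : ZFSet, OPairG zmem zeq Set.univ q x y ∧ ZApp f q z

/-- `f` is a function with domain `k × k`. -/
def ZIsFuncOnPairs (k f : ZFSet) : Prop :=
  (∀ p : ZFSet, p ∈ f → ∃ x y q z : ZFSet, x ∈ k ∧ y ∈ k ∧
    OPairG zmem zeq Set.univ q x y ∧ OPairG zmem zeq Set.univ p q z) ∧
  (∀ x y : ZFSet, x ∈ k → y ∈ k → ∃ z : ZFSet, ZApp2 f x y z) ∧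
  (∀ x y z z' : ZFSet, ZApp2 f x y z → ZApp2 f x y z' → z = z')

/-- The membership relation of the second iterated ultrapower of `Dm` by `U`,
realized as the ultrapower by the 2-fold product of `U` on functions
`f : k × k → Dm` in `Dm`: `[f] ∈ [g]` iff
`{α ∈ k ∣ {β ∈ k ∣ f(α,β) ∈ g(α,β)} ∈ U} ∈ U`. -/
def UltMem2 (Dm : Set ZFSet) (k : ZFSet) (U : Set ZFSet) (f g : ZFSet) : Prop :=
  (f ∈ Dm ∧ ZIsFuncOnPairs k f) ∧ (g ∈ Dm ∧ ZIsFuncOnPairs k g) ∧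
  ∃ s ∈ U, ∀ α : ZFSet,
    (α ∈ s ↔ (α ∈ k ∧ ∃ t ∈ U, ∀ β : ZFSet,
      (β ∈ t ↔ (β ∈ k ∧ ∃ a b : ZFSet, ZApp2 f α β a ∧ ZApp2 g α β b ∧ a ∈ b))))

/-- κ is 2-iterable: every `A ⊆ κ` is an element of a weak κ-model `M` for which
there is a weakly amenable `M`-ultrafilter with 2-many well-founded iterated
ultrapowers. -/
def TwoIterable (k : ZFSet) : Prop :=
  ZIsInacc k ∧ ∀ A : ZFSet, A ⊆ k → ∃ (M : ZFSet) (U : Set ZFSet),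
    IsWeakKappaModel k M ∧ A ∈ M ∧ IsMUltrafilter k M U ∧ WeaklyAmenable k M U ∧
    WellFounded (UltMem (memsOf M) k U) ∧ WellFounded (UltMem2 (memsOf M) k U)

/-! ### Ineffability -/

/-- The thread `A` agrees with the sequence coded by `f` at `α`:
`A ∩ α = f(α)`. -/
def ThreadsAt (f A α : ZFSet) : Prop :=
  ∀ y : ZFSet, ZApp f α y → ∀ z : ZFSet, (z ∈ y ↔ (z ∈ A ∧ z ∈ α))

/-- κ is weakly ineffable: for every sequence `⟨A_α ∣ α < κ⟩` with `A_α ⊆ α`,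
there is `A ⊆ κ` with `A ∩ α = A_α` for unboundedly many `α < κ`. -/
def WeaklyIneffableZ (k : ZFSet) : Prop :=
  ∀ f : ZFSet, ZIsFuncOn k f → (∀ ξ y : ZFSet, ZApp f ξ y → y ⊆ ξ) →
    ∃ A : ZFSet, A ⊆ k ∧ ∀ γ : ZFSet, γ ∈ k →
      ∃ α : ZFSet, α ∈ k ∧ γ ∈ α ∧ ThreadsAt f A α

/-- `C` is a club (closed unbounded) subset of the ordinal `k`. -/
def ClubIn (C k : ZFSet) : Prop :=
  C ⊆ k ∧ (∀ γ : ZFSet, γ ∈ k → ∃ δ : ZFSet, δ ∈ C ∧ γ ∈ δ) ∧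
  (∀ δ : ZFSet, δ ∈ k → (∃ γ : ZFSet, γ ∈ δ) →
    (∀ γ : ZFSet, γ ∈ δ → ∃ ε : ZFSet, ε ∈ C ∧ ε ∈ δ ∧ γ ∈ ε) → δ ∈ C)

/-- The class `S` is stationary in `k`: it meets every club subset of `k`. -/
def StationaryIn (S : Set ZFSet) (k : ZFSet) : Prop :=
  ∀ C : ZFSet, ClubIn C k → ∃ α : ZFSet, α ∈ C ∧ α ∈ S

/-- κ is ineffable: for every sequence `⟨A_α ∣ α < κ⟩` with `A_α ⊆ α`, there is
`A ⊆ κ` such that `{α < κ ∣ A ∩ α = A_α}` is stationary in κ. -/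
def IneffableZ (k : ZFSet) : Prop :=
  ∀ f : ZFSet, ZIsFuncOn k f → (∀ ξ y : ZFSet, ZApp f ξ y → y ⊆ ξ) →
    ∃ A : ZFSet, A ⊆ k ∧ StationaryIn {α | ThreadsAt f A α} k

end BabyMeasurable

namespace BabyMeasurable

/-! ### The games `G^{θ,n}_α(κ)` and `RG^{θ,n}_α(κ)` -/

open scoped Classical in
/-- The restriction of the sequence `J` of judge's moves to stages `ξ ∈ γ`. -/
noncomputable def restrictJ (J : ZFSet → ZFSet × ZFSet) (γ : ZFSet) : ZFSet → ZFSet × ZFSet :=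
  fun ξ => if ξ ∈ γ then J ξ else ((∅ : ZFSet), (∅ : ZFSet))

open scoped Classical in
/-- The restriction of the sequence `Ms` of challenger's moves to stages `ξ ≤ γ`
(the challenger moves first at each stage). -/
noncomputable def restrictC (Ms : ZFSet → ZFSet) (γ : ZFSet) : ZFSet → ZFSet :=
  fun ξ => if (ξ ∈ γ ∨ ξ = γ) then Ms ξ else (∅ : ZFSet)

/-- The challenger's move `M` at stage `γ` is legal (for the game with
parameters `k`, `θ`, judge history `Js`): `M` is a basic κ-model elementary in
`H_θ` containing the sequence `⟨⟨N_ξ, U_ξ⟩ ∣ ξ < γ⟩` of the judge's previous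
moves as an element. -/
def ChMoveOK (k θ : ZFSet) (Js : ZFSet → ZFSet × ZFSet) (γ M : ZFSet) : Prop :=
  IsBasicKappaModel k M ∧ FullElemInH M θ ∧
  ∃ s : ZFSet, s ∈ M ∧ ZIsFuncOn γ s ∧
    ∀ ξ : ZFSet, ξ ∈ γ →
      ∃ p : ZFSet, OPairG zmem zeq Set.univ p (Js ξ).1 (Js ξ).2 ∧ ZApp s ξ p

/-- The judge's move `⟨N_γ, U_γ⟩ = Js γ` at stage `γ` is legal: `N_γ` is a
κ-model with `P(κ) ∩ M_γ ⊆ N_γ`, and `U_γ` is an `N_γ`-ultrafilter extending the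
union of her earlier ultrafilters. If `refl = true` (the game `RG`), she must
additionally ensure that `⟨N_γ, ∈, U_γ⟩ ⊨ ZFC⁻ₙ` and that
`⟨N_ξ, ∈, U_ξ⟩ ≺_{Σₙ} ⟨N_γ, ∈, U_γ⟩` for all `ξ < γ`. -/
def JMoveOK (refl : Bool) (n : ℕ) (k : ZFSet) (Ms : ZFSet → ZFSet)
    (Js : ZFSet → ZFSet × ZFSet) (γ : ZFSet) : Prop :=
  IsKappaModel k (Js γ).1 ∧
  (∀ x : ZFSet, x ∈ Ms γ → x ⊆ k → x ∈ (Js γ).1) ∧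
  IsMUltrafilter k (Js γ).1 (memsOf (Js γ).2) ∧
  (∀ ξ : ZFSet, ξ ∈ γ → (Js ξ).2 ⊆ (Js γ).2) ∧
  (refl = true →
    (ModelsZFCminusN n (memsOf (Js γ).1) (memsOf (Js γ).2) ∧
     ∀ ξ : ZFSet, ξ ∈ γ →
       ElemG zmem zeq (SetFormula.IsSigma n) (memsOf (Js ξ).2) (memsOf (Js γ).2)
         (memsOf (Js ξ).1) (memsOf (Js γ).1)))

/-- The union of the challenger's moves at stages `ξ < α`. -/
def unionModel (α : ZFSet) (Ms : ZFSet → ZFSet) : Set ZFSet :=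
  {x | ∃ ξ : ZFSet, ξ ∈ α ∧ x ∈ Ms ξ}

/-- The union of the judge's ultrafilters at stages `ξ < α`. -/
def unionUF (α : ZFSet) (Js : ZFSet → ZFSet × ZFSet) : Set ZFSet :=
  {x | ∃ ξ : ZFSet, ξ ∈ α ∧ x ∈ (Js ξ).2}

/-- The judge wins the run `(Ms, Js)` of length `α`: with `M = ⋃_{ξ<α} M_ξ` and
`U = ⋃_{ξ<α} U_ξ`, `U` is an `M`-ultrafilter (good, if `good = true`), and
`⟨H_{κ⁺}^M, ∈, U⟩ ⊨ ZFC⁻ₙ`. -/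
def RunFinalOK (good : Bool) (n : ℕ) (k α : ZFSet) (Ms : ZFSet → ZFSet)
    (Js : ZFSet → ZFSet × ZFSet) : Prop :=
  IsMUltrafilterD k (unionModel α Ms) (unionUF α Js) ∧
  (good = true → GoodUltrafilterD (unionModel α Ms) k (unionUF α Js)) ∧
  ModelsZFCminusN n (HkP k (unionModel α Ms)) (unionUF α Js)

/-- The challenger's moves induced by the strategy `σ` against the judge's
moves `Js`. -/
noncomputable def chMoves (σ : ZFSet → (ZFSet → ZFSet × ZFSet) → ZFSet)
    (Js : ZFSet → ZFSet × ZFSet) : ZFSet → ZFSet :=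
  fun γ => σ γ (restrictJ Js γ)

/-- The challenger has a winning strategy in the game (of length `α`, with
parameters `θ`, `n`; `refl = true` for the game `RG`, `good = true` unless the
game is a faint one): there is a strategy `σ` producing legal moves whenever all
the judge's previous moves were legal, such that in no run in which the judge
always moves legally against `σ` does the judge win. -/
def ChallengerWins (refl good : Bool) (n : ℕ) (k α θ : ZFSet) : Prop :=
  ∃ σ : ZFSet → (ZFSet → ZFSet × ZFSet) → ZFSet,
    (∀ (Js : ZFSet → ZFSet × ZFSet) (γ : ZFSet), γ ∈ α →
      (∀ ξ : ZFSet, ξ ∈ γ → JMoveOK refl n k (chMoves σ Js) Js ξ) →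
      ChMoveOK k θ Js γ (chMoves σ Js γ)) ∧
    (∀ Js : ZFSet → ZFSet × ZFSet,
      (∀ γ : ZFSet, γ ∈ α → JMoveOK refl n k (chMoves σ Js) Js γ) →
      ¬ RunFinalOK good n k α (chMoves σ Js) Js)

/-- The judge's moves induced by the strategy `τ` against the challenger's
moves `Ms`. -/
noncomputable def jMoves (τ : ZFSet → (ZFSet → ZFSet) → ZFSet × ZFSet)
    (Ms : ZFSet → ZFSet) : ZFSet → ZFSet × ZFSet :=
  fun γ => τ γ (restrictC Ms γ)

/-- The judge has a winning strategy in the game: there is a strategy `τ`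
producing legal moves whenever all the challenger's moves so far were legal,
such that the judge wins every run in which the challenger always moves legally
against `τ`. -/
def JudgeWins (refl good : Bool) (n : ℕ) (k α θ : ZFSet) : Prop :=
  ∃ τ : ZFSet → (ZFSet → ZFSet) → ZFSet × ZFSet,
    (∀ (Ms : ZFSet → ZFSet) (γ : ZFSet), γ ∈ α →
      (∀ ξ : ZFSet, (ξ ∈ γ ∨ ξ = γ) → ChMoveOK k θ (jMoves τ Ms) ξ (Ms ξ)) →
      JMoveOK refl n k Ms (jMoves τ Ms) γ) ∧
    (∀ Ms : ZFSet → ZFSet,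
      (∀ γ : ZFSet, γ ∈ α → ChMoveOK k θ (jMoves τ Ms) γ (Ms γ)) →
      RunFinalOK good n k α Ms (jMoves τ Ms))

/-! ### Internal large-cardinal notions in abstract models of set theory

These are used to express satisfaction of large-cardinal properties inside
(possibly ill-founded) models `(T, E)` of set theory, e.g. in ultrapowers. -/

variable {T : Type*}

/-- `m` is a weak `k`-model, from the point of view of the structure
`(D, E, eqR)`: a transitive model of `ZFC⁻` of size `k` with `V_k ∈ m`. -/
def WeakKappaModelG (E eqR : T → T → Prop) (D : Set T) (k m : T) : Prop :=
  TransG E eqR D m ∧ (∃ f ∈ D, IsBijFunG E eqR D k m f) ∧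
  (∃ v ∈ D, IsVStageG E eqR D k v ∧ E v m) ∧
  ModelsG E eqR {x | x ∈ D ∧ E x m} (∅ : Set T) SetFormula.PredFree SetFormula.PredFree

/-- `m` is closed under sequences of length `< α`, from the point of view of the
structure. -/
def SeqClosedG (E eqR : T → T → Prop) (D : Set T) (α m : T) : Prop :=
  ∀ β ∈ D, E β α → ∀ f ∈ D, IsFuncOnG E eqR D β f →
    (∀ ξ ∈ D, ∀ y ∈ D, AppG E eqR D f ξ y → E y m) → E f m

/-- `m` is a `k`-model, from the point of view of the structure. -/
def KappaModelG (E eqR : T → T → Prop) (D : Set T) (k m : T) : Prop :=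
  WeakKappaModelG E eqR D k m ∧ SeqClosedG E eqR D k m

/-- `m` is a basic weak `k`-model, from the point of view of the structure: a
model of `ZFC⁻` of size `k` which is Σ₀-elementary in the structure and contains
`V_k ∪ {V_k}`. -/
def BasicWeakKappaModelG (E eqR : T → T → Prop) (D : Set T) (k m : T) : Prop :=
  (∃ f ∈ D, IsBijFunG E eqR D k m f) ∧
  ElemG E eqR (fun φ => φ.IsDelta0 ∧ φ.PredFree) ∅ ∅ {x | x ∈ D ∧ E x m} D ∧
  (∃ v ∈ D, IsVStageG E eqR D k v ∧ E v m ∧ SubG E eqR D v m) ∧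
  ModelsG E eqR {x | x ∈ D ∧ E x m} (∅ : Set T) SetFormula.PredFree SetFormula.PredFree

/-- The membership relation of the ultrapower by the ultrafilter (class) `P` on
`k`, from the point of view of the structure: `[f] ∈ [g]` iff the set
`{ξ ∈ k ∣ f(ξ) ∈ g(ξ)}` belongs to `P`. -/
def UltMemIntG (E eqR : T → T → Prop) (D : Set T) (k : T) (P : Set T) (f g : T) : Prop :=
  ∃ s ∈ P, ∀ ξ ∈ D,
    (E ξ s ↔ (E ξ k ∧ ∃ a ∈ D, ∃ b ∈ D, AppG E eqR D f ξ a ∧ AppG E eqR D g ξ b ∧ E a b))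

/-- The ultrapower of the model `m` by the ultrafilter (class) `P` on `k` is
well-founded, from the point of view of the structure: every nonempty set of
functions `k → m` in `m` has an element which is minimal with respect to the
ultrapower membership relation. -/
def GoodIntG (E eqR : T → T → Prop) (D : Set T) (m k : T) (P : Set T) : Prop :=
  ∀ s ∈ D, (∃ f ∈ D, E f s) →
    (∀ f ∈ D, E f s → (E f m ∧ IsFuncOnG E eqR D k f)) →
    ∃ f ∈ D, E f s ∧ ∀ g ∈ D, E g s → ¬ UltMemIntG E eqR D k P g f

/-- `k` is a κ-Ramsey cardinal (with `κ = k`), from the point of view of the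
structure `(D, E, eqR)`: `k` is inaccessible and for every `A ⊆ k` in `D` and
arbitrarily large cardinals `θ` in `D` there are a `< k`-closed basic weak
`k`-model `m` elementary in `H_θ` with `A ∈ m`, and an ultrafilter `u` which is
a good weakly amenable `m`-ultrafilter in the sense of the structure. -/
def InternalKappaRamsey (E eqR : T → T → Prop) (D : Set T) (k : T) : Prop :=
  IsInaccG E eqR D k ∧
  ∀ A ∈ D, SubG E eqR D A k → ∀ θ₀ ∈ D, ∃ θ ∈ D, IsCardG E eqR D θ ∧ E θ₀ θ ∧
    ∃ m ∈ D, ∃ u ∈ D,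
      BasicWeakKappaModelG E eqR D k m ∧ SeqClosedG E eqR D k m ∧
      ElemG E eqR SetFormula.PredFree ∅ ∅
        {x | x ∈ D ∧ E x m} {x | x ∈ D ∧ InHG E eqR D θ x} ∧
      E A m ∧
      IsUFG E eqR {x | x ∈ D ∧ E x m} k {x | x ∈ D ∧ E x u} ∧
      WeakAmenG E eqR D {x | x ∈ D ∧ E x m} k {x | x ∈ D ∧ E x u} ∧
      GoodIntG E eqR D m k {x | x ∈ D ∧ E x u}

/-- `(T, E)` is a model of `ZFC`: it satisfies the base axioms, full collection
and separation (in the pure language), and the power set axiom. -/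
def IsZFCModel (E : T → T → Prop) : Prop :=
  ModelsG E (· = ·) (Set.univ : Set T) (∅ : Set T)
    SetFormula.PredFree SetFormula.PredFree ∧
  ∀ a : T, ∃ p : T, IsPowG E (· = ·) Set.univ a p

/-- `k` is the largest cardinal of the model `(T, E)`. -/
def LargestCardG (E : T → T → Prop) (k : T) : Prop :=
  IsCardG E (· = ·) Set.univ k ∧
  ∀ c : T, IsCardG E (· = ·) Set.univ c → (c = k ∨ E c k)

/-- For every `a ∈ k` the power set of `a` exists and has size `< k`
(the inaccessibility requirement `P(α)` exists and `2^α < κ` of `ZFC⁻_I`). -/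
def InaccPowG (E : T → T → Prop) (k : T) : Prop :=
  ∀ a : T, E a k → ∃ p : T, IsPowG E (· = ·) Set.univ a p ∧
    ∃ c : T, E c k ∧ ∃ f : T, IsInjFunG E (· = ·) Set.univ p c f

/-- `(T, E, P)` is a model of `ZFC⁻_U`: `ZFC⁻` with full collection and
separation in the language with the predicate `U` (interpreted by `P`), a
largest cardinal `k` which is inaccessible, and `U` a uniform normal ultrafilter
on `k`. -/
def IsZFCminusUModel (E : T → T → Prop) (P : Set T) : Prop :=
  ModelsG E (· = ·) (Set.univ : Set T) P (fun _ => True) (fun _ => True) ∧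
  ∃ k : T, LargestCardG E k ∧ InaccPowG E k ∧ IsUFG E (· = ·) Set.univ k P

/-- `k` is an `n`-baby measurable cardinal, from the point of view of the model
`(T, E)`: every `A ⊆ k` is an element of a `k`-model `m` for which there is a
good `m`-ultrafilter `u` such that `⟨m, ∈, u⟩ ⊨ ZFC⁻ₙ`, all in the sense of the
model. -/
def NBabyMeasurableG (E : T → T → Prop) (n : ℕ) (k : T) : Prop :=
  IsInaccG E (· = ·) Set.univ k ∧
  ∀ A : T, SubG E (· = ·) Set.univ A k → ∃ m u : T,
    KappaModelG E (· = ·) Set.univ k m ∧ E A m ∧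
    IsUFG E (· = ·) {x | E x m} k {x | E x u} ∧
    GoodIntG E (· = ·) Set.univ m k {x | E x u} ∧
    ModelsG E (· = ·) {x | E x m} {x | E x u}
      (SetFormula.IsSigma n) (SetFormula.IsSigma n)

/-- The model `(T, E)` satisfies the scheme asserting, for every (standard)
`n ∈ ω`, that there is an `n`-baby measurable cardinal `k` with
`V_k ≺_{Σₙ} V`. -/
def Scheme2 (E : T → T → Prop) : Prop :=
  ∀ n : ℕ, ∃ k : T, NBabyMeasurableG E n k ∧
    ∃ v : T, IsVStageG E (· = ·) Set.univ k v ∧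
      ElemG E (· = ·) (SetFormula.IsSigma n) ∅ ∅ {x | E x v} Set.univ

/-- The model `(T, E)` satisfies the scheme asserting, for every (standard)
`n ∈ ω`, that there is an `n`-baby measurable cardinal. -/
def Scheme3 (E : T → T → Prop) : Prop :=
  ∀ n : ℕ, ∃ k : T, NBabyMeasurableG E n k

end BabyMeasurable

namespace BabyMeasurable

/-- The (not collapsed) ultrapower of `M` by `U` has a transitive collapse which
is contained in `M`: there is a map `coll` on the points of the ultrapower which
respects its equality and membership, whose images are transitive(ly generated)
in the sense that the elements of `coll f` are exactly the collapses of the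
ultrapower-members of `f`, and whose values all lie in `M`. In particular the
ultrapower is well-founded and extensionally collapses into `M`. -/
def CollapsesIntoM (κ M : ZFSet) (U : Set ZFSet) : Prop :=
  ∃ coll : ZFSet → ZFSet,
    (∀ f g : ZFSet, UltPt (memsOf M) κ f → UltPt (memsOf M) κ g →
      ((coll f = coll g ↔ UltEq (memsOf M) κ U f g) ∧
       (coll f ∈ coll g ↔ UltMem (memsOf M) κ U f g))) ∧
    (∀ f : ZFSet, UltPt (memsOf M) κ f → ∀ x : ZFSet, x ∈ coll f →
      ∃ g : ZFSet, UltPt (memsOf M) κ g ∧ UltMem (memsOf M) κ U g f ∧ x = coll g) ∧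
    (∀ f : ZFSet, UltPt (memsOf M) κ f → coll f ∈ M)

/-- `δ` is a cardinal from the point of view of the transitive model `M`. -/
def InternalCardOf (M δ : ZFSet) : Prop := IsCardG zmem zeq (memsOf M) δ

/-- The largest cardinal of `M` is `(2^κ)^M`: there are `δ, p, f ∈ M` such that
`p = P(κ) ∩ M`, `δ` is a cardinal of `M` bijective with `p`, and every cardinal
of `M` is `≤ δ`. -/
def LargestCardIsContinuum (κ M : ZFSet) : Prop :=
  ∃ δ p f : ZFSet, δ ∈ M ∧ p ∈ M ∧ f ∈ M ∧
    (∀ x : ZFSet, x ∈ p ↔ (x ∈ M ∧ x ⊆ κ)) ∧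
    InternalCardOf M δ ∧ ZIsBijFun δ p f ∧
    (∀ c : ZFSet, c ∈ M → InternalCardOf M c → (c = δ ∨ c ∈ δ))

section

set_option linter.unusedSectionVars false

universe u

namespace SetFormula

/-- Renaming of all (free and bound) variables. -/
def rename (σ : ℕ → ℕ) : SetFormula → SetFormula
  | mem i j => mem (σ i) (σ j)
  | eq i j => eq (σ i) (σ j)
  | pred i => pred (σ i)
  | not φ => not (φ.rename σ)
  | and φ ψ => and (φ.rename σ) (ψ.rename σ)
  | or φ ψ => or (φ.rename σ) (ψ.rename σ)
  | ball i j φ => ball (σ i) (σ j) (φ.rename σ)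
  | bex i j φ => bex (σ i) (σ j) (φ.rename σ)
  | all i φ => all (σ i) (φ.rename σ)
  | ex i φ => ex (σ i) (φ.rename σ)

/-- A strict upper bound for the variables occurring in a formula. -/
def bound : SetFormula → ℕ
  | mem i j => max i j + 1
  | eq i j => max i j + 1
  | pred i => i + 1
  | not φ => φ.bound
  | and φ ψ => max φ.bound ψ.bound
  | or φ ψ => max φ.bound ψ.bound
  | ball i j φ => max (max i j + 1) φ.bound
  | bex i j φ => max (max i j + 1) φ.bound
  | all i φ => max (i + 1) φ.bound
  | ex i φ => max (i + 1) φ.bound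

theorem PredFree.rename {φ : SetFormula} (h : φ.PredFree) (σ : ℕ → ℕ) :
    (φ.rename σ).PredFree := by
  induction φ with
  | mem | eq => trivial
  | pred => exact h
  | not φ ih | ball _ _ φ ih | bex _ _ φ ih | all _ φ ih | ex _ φ ih => exact ih h
  | and φ ψ ih₁ ih₂ | or φ ψ ih₁ ih₂ => exact ⟨ih₁ h.1, ih₂ h.2⟩

end SetFormula

section

variable {T : Type*} {E eqR : T → T → Prop} {P D : Set T}

theorem interp_rename {σ : ℕ → ℕ} (hσ : σ.Injective) (φ : SetFormula) (v : ℕ → T) :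
    Interp E eqR P D (φ.rename σ) v ↔ Interp E eqR P D φ (v ∘ σ) := by
  induction φ generalizing v with
  | mem | eq | pred => rfl
  | not φ ih => simp only [SetFormula.rename, Interp, ih]
  | and φ ψ ih₁ ih₂ | or φ ψ ih₁ ih₂ => simp only [SetFormula.rename, Interp, ih₁, ih₂]
  | ball _ _ φ ih | bex _ _ φ ih | all _ φ ih | ex _ φ ih =>
    simp only [SetFormula.rename, Interp, ih, Function.update_comp_eq_of_injective v hσ,
      Function.comp_apply]

theorem interp_congr (φ : SetFormula) {v w : ℕ → T} (h : ∀ k < φ.bound, v k = w k) :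
    Interp E eqR P D φ v ↔ Interp E eqR P D φ w := by
  induction φ generalizing v w with
  | mem i j | eq i j =>
    simp only [SetFormula.bound] at h
    simp only [Interp, h i (by omega), h j (by omega)]
  | pred i =>
    simp only [SetFormula.bound] at h
    simp only [Interp, h i (by omega)]
  | not φ ih => simp only [Interp, ih h]
  | and φ ψ ih₁ ih₂ | or φ ψ ih₁ ih₂ =>
    simp only [SetFormula.bound] at h
    simp only [Interp, ih₁ fun k hk => h k (by omega), ih₂ fun k hk => h k (by omega)]
  | ball i j φ ih | bex i j φ ih =>
    simp only [SetFormula.bound] at h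
    have key : ∀ x, Interp E eqR P D φ (Function.update v i x) ↔
        Interp E eqR P D φ (Function.update w i x) := fun x => ih fun k hk => by
      by_cases hki : k = i
      · subst hki; simp
      · simp [hki, h k (by omega)]
    simp only [Interp, key, h j (by omega)]
  | all i φ ih | ex i φ ih =>
    simp only [SetFormula.bound] at h
    have key : ∀ x, Interp E eqR P D φ (Function.update v i x) ↔
        Interp E eqR P D φ (Function.update w i x) := fun x => ih fun k hk => by
      by_cases hki : k = i
      · subst hki; simp
      · simp [hki, h k (by omega)]
    simp only [Interp, key]

end

/-- `M` is a transitive model of `ZFC⁻`. -/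
class TransModel (M : ZFSet.{u}) : Prop where
  trans : ∀ {x y : ZFSet}, x ∈ M → y ∈ x → y ∈ M
  models : ModelsZFCminusPure (memsOf M)

/-- Interleave an assignment `v` (even variables) with parameters `p` (odd variables). -/
def mix (v p : ℕ → ZFSet.{u}) (n : ℕ) : ZFSet.{u} := if n % 2 = 0 then v (n / 2) else p (n / 2)

/-- Prepend an element to a sequence. -/
def scons (x : ZFSet.{u}) (v : ℕ → ZFSet.{u}) : ℕ → ZFSet.{u}
  | 0 => x
  | n + 1 => v n

/-- A relation on assignments is definable with parameters over `⟨M, ∈⟩`. -/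
class Dfn (M : ZFSet.{u}) (R : (ℕ → ZFSet.{u}) → Prop) : Prop where
  out : ∃ φ : SetFormula, φ.PredFree ∧ ∃ p : ℕ → ZFSet, (∀ k, p k ∈ M) ∧ ∀ v, (∀ k, v k ∈ M) →
    (Interp zmem zeq ∅ (memsOf M) φ (mix v p) ↔ R v)

/-- A total operation on assignments is definable with parameters over `⟨M, ∈⟩`. -/
class DfnT (M : ZFSet.{u}) (t : (ℕ → ZFSet.{u}) → ZFSet.{u}) : Prop where
  val : ∀ v, (∀ k, v k ∈ M) → t v ∈ M
  graph : Dfn M fun w => w 0 = t fun i => w (i + 1)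

theorem mix_mem {M : ZFSet.{u}} {v p : ℕ → ZFSet} (hv : ∀ k, v k ∈ M) (hp : ∀ k, p k ∈ M) (n : ℕ) :
    mix v p n ∈ M := by
  unfold mix; split_ifs <;> simp [hv, hp]

theorem scons_mem {M x : ZFSet.{u}} {v : ℕ → ZFSet} (hx : x ∈ M) (hv : ∀ k, v k ∈ M) (n : ℕ) :
    scons x v n ∈ M := by
  cases n
  · exact hx
  · exact hv _

section

variable {M : ZFSet.{u}}

theorem Dfn.congr {R S : (ℕ → ZFSet) → Prop} (hR : Dfn M R)
    (h : ∀ v, (∀ k, v k ∈ M) → (R v ↔ S v)) : Dfn M S := by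
  obtain ⟨φ, h1, p, h2, h3⟩ := hR.out
  exact ⟨φ, h1, p, h2, fun v hv => (h3 v hv).trans (h v hv)⟩

theorem TransModel.empty_mem [hM : TransModel M] : ∅ ∈ M := by
  obtain ⟨i, hi, ⟨e, he, hei, h⟩, -⟩ := hM.models.1.2.2.2.1
  have : e = ∅ := (ZFSet.eq_empty e).2 fun y hy => h y (hM.trans he hy) hy
  exact this ▸ he

/-- Renaming of the assignment along an injection. -/
theorem Dfn.rename {R : (ℕ → ZFSet) → Prop} (hR : Dfn M R) {σ : ℕ → ℕ} (hσ : σ.Injective) :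
    Dfn M fun v => R fun i => v (σ i) := by
  obtain ⟨φ, h1, p, h2, h3⟩ := hR.out
  set τ : ℕ → ℕ := fun n => if n % 2 = 0 then 2 * σ (n / 2) else n with hτ
  have hinj : τ.Injective := by
    intro a b hab
    simp only [hτ] at hab
    split_ifs at hab with ha hb hb
    · have := @hσ (a / 2) (b / 2) (by omega)
      omega
    · omega
    · omega
    · exact hab
  refine ⟨φ.rename τ, h1.rename τ, p, h2, fun v hv => ?_⟩
  rw [interp_rename hinj, ← h3 _ fun k => hv _]
  have : mix v p ∘ τ = mix (fun i => v (σ i)) p := by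
    funext n
    simp only [Function.comp, mix, hτ]
    by_cases hn : n % 2 = 0 <;> simp [hn]
  rw [this]

/-- Two definable relations can be written with a common sequence of parameters. -/
theorem Dfn.common {R S : (ℕ → ZFSet) → Prop} (hR : Dfn M R) (hS : Dfn M S) :
    ∃ φ ψ : SetFormula, φ.PredFree ∧ ψ.PredFree ∧ ∃ p : ℕ → ZFSet, (∀ k, p k ∈ M) ∧
      ∀ v, (∀ k, v k ∈ M) → (Interp zmem zeq ∅ (memsOf M) φ (mix v p) ↔ R v) ∧
        (Interp zmem zeq ∅ (memsOf M) ψ (mix v p) ↔ S v) := by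
  obtain ⟨φ, h1, p, h2, h3⟩ := hR.out
  obtain ⟨ψ, g1, q, g2, g3⟩ := hS.out
  set τ₁ : ℕ → ℕ := fun n => if n % 2 = 0 then n else 4 * (n / 2) + 1 with hτ₁
  set τ₂ : ℕ → ℕ := fun n => if n % 2 = 0 then n else 4 * (n / 2) + 3 with hτ₂
  have i₁ : τ₁.Injective := by
    intro a b hab
    simp only [hτ₁] at hab
    split_ifs at hab <;> omega
  have i₂ : τ₂.Injective := by
    intro a b hab
    simp only [hτ₂] at hab
    split_ifs at hab <;> omega
  refine ⟨φ.rename τ₁, ψ.rename τ₂, h1.rename _, g1.rename _, mix p q, mix_mem h2 g2,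
    fun v hv => ?_⟩
  rw [interp_rename i₁, interp_rename i₂, ← h3 v hv, ← g3 v hv]
  have e₁ : mix v (mix p q) ∘ τ₁ = mix v p := by
    funext n
    by_cases hn : n % 2 = 0
    · simp [mix, hτ₁, hn]
    · have hn1 : τ₁ n = 4 * (n / 2) + 1 := by simp [hτ₁, hn]
      have a1 : (4 * (n / 2) + 1) % 2 ≠ 0 := by omega
      have a2 : (4 * (n / 2) + 1) / 2 % 2 = 0 := by omega
      have a3 : (4 * (n / 2) + 1) / 2 / 2 = n / 2 := by omega
      rw [Function.comp_apply, hn1]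
      unfold mix
      rw [if_neg a1, if_pos a2, a3, if_neg hn]
  have e₂ : mix v (mix p q) ∘ τ₂ = mix v q := by
    funext n
    by_cases hn : n % 2 = 0
    · simp [mix, hτ₂, hn]
    · have hn1 : τ₂ n = 4 * (n / 2) + 3 := by simp [hτ₂, hn]
      have a1 : (4 * (n / 2) + 3) % 2 ≠ 0 := by omega
      have a2 : (4 * (n / 2) + 3) / 2 % 2 ≠ 0 := by omega
      have a3 : (4 * (n / 2) + 3) / 2 / 2 = n / 2 := by omega
      rw [Function.comp_apply, hn1]
      unfold mix
      rw [if_neg a1, if_neg a2, a3, if_neg hn]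
  rw [e₁, e₂]
  exact ⟨Iff.rfl, Iff.rfl⟩

instance Dfn.not {R : (ℕ → ZFSet) → Prop} [hR : Dfn M R] : Dfn M fun v => ¬ R v := by
  obtain ⟨φ, h1, p, h2, h3⟩ := hR.out
  exact ⟨.not φ, h1, p, h2, fun v hv => not_congr (h3 v hv)⟩

instance Dfn.and {R S : (ℕ → ZFSet) → Prop} [hR : Dfn M R] [hS : Dfn M S] :
    Dfn M fun v => R v ∧ S v := by
  obtain ⟨φ, ψ, h1, g1, p, h2, h3⟩ := hR.common hS
  exact ⟨.and φ ψ, ⟨h1, g1⟩, p, h2, fun v hv => and_congr (h3 v hv).1 (h3 v hv).2⟩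

instance Dfn.or {R S : (ℕ → ZFSet) → Prop} [hR : Dfn M R] [hS : Dfn M S] :
    Dfn M fun v => R v ∨ S v :=
  Dfn.congr (R := fun v => ¬ (¬ R v ∧ ¬ S v)) inferInstance fun v hv => by tauto

instance Dfn.imp {R S : (ℕ → ZFSet) → Prop} [hR : Dfn M R] [hS : Dfn M S] :
    Dfn M fun v => R v → S v :=
  Dfn.congr (R := fun v => ¬ (R v ∧ ¬ S v)) inferInstance fun v hv => by tauto

instance Dfn.iff {R S : (ℕ → ZFSet) → Prop} [hR : Dfn M R] [hS : Dfn M S] :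
    Dfn M fun v => R v ↔ S v :=
  Dfn.congr (R := fun v => (R v → S v) ∧ (S v → R v)) inferInstance fun v hv => by tauto

instance Dfn.const [TransModel M] {q : Prop} : Dfn M fun _ => q := by
  by_cases hq : q
  · exact ⟨.eq 0 0, trivial, fun _ => ∅, fun _ => TransModel.empty_mem,
      fun v hv => ⟨fun _ => hq, fun _ => rfl⟩⟩
  · exact ⟨.not (.eq 0 0), trivial, fun _ => ∅, fun _ => TransModel.empty_mem,
      fun v hv => ⟨fun h => (h rfl).elim, fun h => (hq h).elim⟩⟩

theorem Dfn.exists_mem_model {R : (ℕ → ZFSet) → ZFSet → Prop}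
    (hR : Dfn M fun w => R (fun i => w (i + 1)) (w 0)) : Dfn M fun v => ∃ x, x ∈ M ∧ R v x := by
  obtain ⟨φ, h1, p, h2, h3⟩ := hR.out
  obtain ⟨N, hN⟩ : ∃ N, φ.bound ≤ 2 * N + 1 := ⟨φ.bound, by omega⟩
  set σ : ℕ → ℕ := fun n => if n % 2 = 1 then n else if n = 0 then 2 * N
    else if n ≤ 2 * N then n - 2 else n with hσ
  have hinj : σ.Injective := by
    intro a b hab
    simp only [hσ] at hab
    split_ifs at hab <;> omega
  refine ⟨.ex (2 * N) (φ.rename σ), h1.rename σ, p, h2, fun v hv => ?_⟩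
  simp only [Interp, interp_rename hinj]
  refine exists_congr fun x => and_congr_right fun hx => ?_
  refine Iff.trans ?_ (h3 (scons x v) (scons_mem hx hv))
  refine interp_congr φ fun k hk => ?_
  simp only [Function.comp, mix, hσ, Function.update_apply]
  by_cases hk1 : k % 2 = 1
  · have : k ≠ 2 * N := by omega
    simp [hk1, this]
  · obtain ⟨m, rfl⟩ : ∃ m, k = 2 * m := ⟨k / 2, by omega⟩
    rcases m with _ | m
    · simp [scons]
    · have c1 : 2 * (m + 1) ≤ 2 * N := by omega
      have c2 : 2 * (m + 1) - 2 ≠ 2 * N := by omega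
      have c3 : (2 * (m + 1) - 2) % 2 = 0 := by omega
      have c4 : (2 * (m + 1) - 2) / 2 = m := by omega
      have c5 : 2 * (m + 1) / 2 = m + 1 := by omega
      have c6 : 2 * (m + 1) ≠ 0 := by omega
      rw [if_neg hk1, if_neg c6, if_pos c1, if_neg c2, if_pos c3, c4, if_pos (by omega), c5]
      rfl

/-- Substitution of a definable operation. -/
theorem Dfn.subst {R : ZFSet → (ℕ → ZFSet) → Prop} {t : (ℕ → ZFSet) → ZFSet} (ht : DfnT M t)
    (hR : Dfn M fun w => R (w 0) fun i => w (i + 1)) : Dfn M fun v => R (t v) v := by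
  have := ht.graph
  refine (Dfn.exists_mem_model (R := fun v x => x = t v ∧ R x v) inferInstance).congr
    fun v hv => ⟨?_, fun h => ⟨t v, ht.val v hv, rfl, h⟩⟩
  rintro ⟨x, -, rfl, h⟩
  exact h

theorem Dfn.mem_var [TransModel M] (i j : ℕ) : Dfn M fun v => v i ∈ v j :=
  ⟨.mem (2 * i) (2 * j), trivial, fun _ => ∅, fun _ => TransModel.empty_mem, fun v hv => by
    simp [Interp, mix]⟩

theorem Dfn.eq_var [TransModel M] (i j : ℕ) : Dfn M fun v => v i = v j :=
  ⟨.eq (2 * i) (2 * j), trivial, fun _ => ∅, fun _ => TransModel.empty_mem, fun v hv => by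
    simp [Interp, mix]⟩

instance DfnT.var [TransModel M] (i : ℕ) : DfnT M fun v => v i :=
  ⟨fun v hv => hv i, Dfn.eq_var 0 (i + 1)⟩

instance DfnT.const {c : ZFSet} [hc : Fact (c ∈ M)] : DfnT M fun _ => c :=
  ⟨fun _ _ => hc.out, ⟨.eq 0 1, trivial, fun _ => c, fun _ => hc.out, fun v hv => by
    simp [Interp, mix]⟩⟩

theorem DfnT.weaken {t : (ℕ → ZFSet) → ZFSet} (ht : DfnT M t) :
    DfnT M fun w => t fun i => w (i + 1) := by
  refine ⟨fun v hv => ht.val _ fun k => hv _, ?_⟩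
  refine (ht.graph.rename (σ := fun i => if i = 0 then 0 else i + 1) ?_).congr fun v hv => Iff.rfl
  intro a b hab
  simp only at hab
  split_ifs at hab <;> omega

/-- Substitution of two definable operations in a definable binary relation. -/
theorem Dfn.comp₂ {Q : ZFSet → ZFSet → Prop} {s t : (ℕ → ZFSet) → ZFSet} (hs : DfnT M s)
    (ht : DfnT M t) (hQ : Dfn M fun w => Q (w 0) (w 1)) : Dfn M fun v => Q (s v) (t v) := by
  refine Dfn.subst (R := fun x v => Q x (t v)) hs ?_
  refine Dfn.subst (R := fun y w => Q (w 0) y) ht.weaken ?_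
  refine (hQ.rename (σ := Equiv.swap 0 1) (Equiv.injective _)).congr fun v hv => ?_
  simp

theorem Dfn.comp₁ {Q : ZFSet → Prop} {s : (ℕ → ZFSet) → ZFSet} (hs : DfnT M s)
    (hQ : Dfn M fun w => Q (w 0)) : Dfn M fun v => Q (s v) :=
  Dfn.subst (R := fun x v => Q x) hs hQ

theorem Dfn.comp₃ {Q : ZFSet → ZFSet → ZFSet → Prop} {r s t : (ℕ → ZFSet) → ZFSet}
    (hr : DfnT M r) (hs : DfnT M s) (ht : DfnT M t) (hQ : Dfn M fun w => Q (w 0) (w 1) (w 2)) :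
    Dfn M fun v => Q (r v) (s v) (t v) := by
  refine Dfn.subst (R := fun x v => Q x (s v) (t v)) hr ?_
  refine Dfn.subst (R := fun y w => Q (w 0) y (t fun i => w (i + 1))) hs.weaken ?_
  refine Dfn.subst (R := fun z w => Q (w 1) (w 0) z) ht.weaken.weaken ?_
  refine (hQ.rename (σ := Equiv.swap 0 2) (Equiv.injective _)).congr fun v hv => ?_
  simp [Equiv.swap_apply_def]

instance Dfn.mem [TransModel M] {s t : (ℕ → ZFSet) → ZFSet} [hs : DfnT M s] [ht : DfnT M t] :
    Dfn M fun v => s v ∈ t v := Dfn.comp₂ (Q := fun x y => x ∈ y) hs ht (Dfn.mem_var 0 1)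

instance Dfn.eq [TransModel M] {s t : (ℕ → ZFSet) → ZFSet} [hs : DfnT M s] [ht : DfnT M t] :
    Dfn M fun v => s v = t v := Dfn.comp₂ hs ht (Dfn.eq_var 0 1)

instance Dfn.ex_model {R : (ℕ → ZFSet) → ZFSet → Prop}
    [hR : Dfn M fun w => R (fun i => w (i + 1)) (w 0)] : Dfn M fun v => ∃ x, x ∈ M ∧ R v x :=
  Dfn.exists_mem_model hR

instance Dfn.all_model {R : (ℕ → ZFSet) → ZFSet → Prop}
    [hR : Dfn M fun w => R (fun i => w (i + 1)) (w 0)] : Dfn M fun v => ∀ x, x ∈ M → R v x :=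
  Dfn.congr (R := fun v => ¬ ∃ x, x ∈ M ∧ ¬ R v x) inferInstance fun v hv => by
    simp only [not_exists, not_and, not_not]

instance Dfn.bex [hM : TransModel M] {R : (ℕ → ZFSet) → ZFSet → Prop} {t : (ℕ → ZFSet) → ZFSet}
    [ht : DfnT M t] [hR : Dfn M fun w => R (fun i => w (i + 1)) (w 0)] :
    Dfn M fun v => ∃ x, x ∈ t v ∧ R v x := by
  have := ht.weaken
  refine Dfn.congr (R := fun v => ∃ x, x ∈ M ∧ (x ∈ t v ∧ R v x)) inferInstance fun v hv => ?_
  exact ⟨fun ⟨x, _, h⟩ => ⟨x, h⟩, fun ⟨x, h⟩ => ⟨x, hM.trans (ht.val v hv) h.1, h⟩⟩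

instance Dfn.ball [hM : TransModel M] {R : (ℕ → ZFSet) → ZFSet → Prop} {t : (ℕ → ZFSet) → ZFSet}
    [ht : DfnT M t] [hR : Dfn M fun w => R (fun i => w (i + 1)) (w 0)] :
    Dfn M fun v => ∀ x, x ∈ t v → R v x :=
  Dfn.congr (R := fun v => ¬ ∃ x, x ∈ t v ∧ ¬ R v x) inferInstance fun v hv => by
    simp only [not_exists, not_and, not_not]

theorem Dfn.subset_var [hM : TransModel M] : Dfn M fun v => v 0 ⊆ v 1 :=
  Dfn.congr (R := fun w => ∀ z, z ∈ w 0 → z ∈ w 1) inferInstance fun v hv =>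
    ⟨fun h z => h z, fun h z => @h z⟩

instance Dfn.subset [hM : TransModel M] {s t : (ℕ → ZFSet) → ZFSet} [hs : DfnT M s]
    [ht : DfnT M t] :
    Dfn M fun v => s v ⊆ t v := Dfn.comp₂ (Q := fun x y => x ⊆ y) hs ht Dfn.subset_var

end

section

/-- The image of the set `a` under the operation `F`. -/
noncomputable def repl (F : ZFSet.{u} → ZFSet.{u}) (a : ZFSet.{u}) : ZFSet.{u} :=
  ZFSet.range fun x : a => F x

theorem mem_repl {F : ZFSet.{u} → ZFSet.{u}} {a y : ZFSet.{u}} : y ∈ repl F a ↔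
    ∃ x, x ∈ a ∧ y = F x := by
  simp only [repl, ZFSet.mem_range, Subtype.exists]
  exact ⟨fun ⟨x, hx, h⟩ => ⟨x, hx, h.symm⟩, fun ⟨x, hx, h⟩ => ⟨x, hx, h.symm⟩⟩

/-- The value of the set function `f` at `x`, with the value `∅` outside the domain. -/
noncomputable def app (f x : ZFSet.{u}) : ZFSet.{u} :=
  ZFSet.sUnion (ZFSet.sep (fun y => ZFSet.pair x y ∈ f) (ZFSet.sUnion (ZFSet.sUnion f)))

/-- The set function with domain `a` given by the operation `F`. -/
noncomputable def lam (F : ZFSet.{u} → ZFSet.{u}) (a : ZFSet.{u}) : ZFSet.{u} :=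
  repl (fun x => ZFSet.pair x (F x)) a

theorem left_mem_sUnion_of_pair {x y f : ZFSet.{u}} (h : ZFSet.pair x y ∈ f) :
    x ∈ ZFSet.sUnion (ZFSet.sUnion f) :=
  ZFSet.mem_sUnion.2 ⟨{x}, ZFSet.mem_sUnion.2 ⟨_, h, by simp [ZFSet.pair]⟩, by simp⟩

theorem right_mem_sUnion_of_pair {x y f : ZFSet.{u}} (h : ZFSet.pair x y ∈ f) :
    y ∈ ZFSet.sUnion (ZFSet.sUnion f) :=
  ZFSet.mem_sUnion.2 ⟨{x, y}, ZFSet.mem_sUnion.2 ⟨_, h, by simp [ZFSet.pair]⟩, by simp⟩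

theorem app_eq {f x y : ZFSet.{u}} (h : ZFSet.pair x y ∈ f)
    (h' : ∀ z, ZFSet.pair x z ∈ f → z = y) : app f x = y := by
  have : ZFSet.sep (fun y => ZFSet.pair x y ∈ f) (ZFSet.sUnion (ZFSet.sUnion f)) = {y} := by
    ext z
    simp only [ZFSet.mem_sep, ZFSet.mem_singleton]
    exact ⟨fun hz => h' z hz.2, fun hz => hz ▸ ⟨right_mem_sUnion_of_pair h, h⟩⟩
  rw [app, this, ZFSet.sUnion_singleton]

theorem app_eq_empty {f x : ZFSet.{u}} (h : ∀ z, ZFSet.pair x z ∉ f) : app f x = ∅ := by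
  rw [ZFSet.eq_empty]
  intro y hy
  obtain ⟨z, hz, -⟩ := ZFSet.mem_sUnion.1 hy
  exact h z (ZFSet.mem_sep.1 hz).2

theorem mem_lam {F : ZFSet.{u} → ZFSet.{u}} {a p : ZFSet.{u}} :
    p ∈ lam F a ↔ ∃ x, x ∈ a ∧ p = ZFSet.pair x (F x) := mem_repl

theorem pair_mem_lam {F : ZFSet.{u} → ZFSet.{u}} {a x y : ZFSet.{u}} :
    ZFSet.pair x y ∈ lam F a ↔ x ∈ a ∧ y = F x := by
  rw [mem_lam]
  constructor
  · rintro ⟨z, hz, h⟩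
    obtain ⟨rfl, rfl⟩ := ZFSet.pair_inj.1 h
    exact ⟨hz, rfl⟩
  · rintro ⟨h, rfl⟩
    exact ⟨x, h, rfl⟩

theorem app_lam {F : ZFSet.{u} → ZFSet.{u}} {a x : ZFSet.{u}} (hx : x ∈ a) :
    app (lam F a) x = F x :=
  app_eq (pair_mem_lam.2 ⟨hx, rfl⟩) fun _ hz => (pair_mem_lam.1 hz).2

theorem app_lam_of_notMem {F : ZFSet.{u} → ZFSet.{u}} {a x : ZFSet.{u}} (hx : x ∉ a) :
    app (lam F a) x = ∅ :=
  app_eq_empty fun _ h => hx (pair_mem_lam.1 h).1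

variable {M : ZFSet.{u}}

theorem Dfn.weaken₁ {R : (ℕ → ZFSet) → ZFSet → Prop}
    (hR : Dfn M fun w => R (fun i => w (i + 1)) (w 0)) :
    Dfn M fun w => R (fun i => w (i + 2)) (w 0) := by
  refine hR.rename (σ := fun i => if i = 0 then 0 else i + 1) ?_
  intro a b hab
  simp only at hab
  split_ifs at hab <;> omega

theorem DfnT.weaken₁ {F : (ℕ → ZFSet) → ZFSet → ZFSet}
    (hF : DfnT M fun w => F (fun i => w (i + 1)) (w 0)) :
    DfnT M fun w => F (fun i => w (i + 2)) (w 0) := by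
  refine ⟨fun v hv => hF.val (fun i => if i = 0 then v 0 else v (i + 1)) fun k => ?_, ?_⟩
  · split_ifs <;> exact hv _
  · refine (hF.graph.rename (σ := fun i => if i = 0 then 0 else if i = 1 then 1 else i + 1) ?_)
    intro a b hab
    simp only at hab
    split_ifs at hab <;> omega

section

variable [hM : TransModel M]

theorem ext_model {a b : ZFSet} (ha : a ∈ M) (hb : b ∈ M) (h : ∀ z, z ∈ M → (z ∈ a ↔ z ∈ b)) :
    a = b :=
  ZFSet.ext fun z => ⟨fun hz => (h z (hM.trans ha hz)).1 hz, fun hz => (h z (hM.trans hb hz)).2 hz⟩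

theorem DfnT.of_mem_iff {t : (ℕ → ZFSet) → ZFSet} {R : (ℕ → ZFSet) → ZFSet → Prop}
    (hval : ∀ v, (∀ k, v k ∈ M) → t v ∈ M) (hR : Dfn M fun w => R (fun i => w (i + 1)) (w 0))
    (h : ∀ v, (∀ k, v k ∈ M) → ∀ z, z ∈ M → (z ∈ t v ↔ R v z)) : DfnT M t := by
  refine ⟨hval, ?_⟩
  have := hR.weaken₁
  refine Dfn.congr (R := fun w => ∀ z, z ∈ M → (z ∈ w 0 ↔ R (fun i => w (i + 1)) z)) ?_
    fun v hv => ?_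
  · have h1 : Dfn M fun w => (w 0 ∈ w 1 ↔ R (fun i => w (i + 2)) (w 0)) := inferInstance
    exact Dfn.all_model (hR := h1)
  · constructor
    · intro hz
      refine ext_model (hv 0) (hval _ fun k => hv _) fun z hzM => ?_
      rw [hz z hzM, h _ (fun k => hv _) z hzM]
    · intro he z hzM
      rw [he, h _ (fun k => hv _) z hzM]

theorem sep_mem_model {R : (ℕ → ZFSet) → ZFSet → Prop}
    (hR : Dfn M fun w => R (fun i => w (i + 1)) (w 0)) {v : ℕ → ZFSet} (hv : ∀ k, v k ∈ M)
    {a : ZFSet} (ha : a ∈ M) : ZFSet.sep (R v) a ∈ M := by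
  obtain ⟨φ, h1, p, h2, h3⟩ := hR.out
  obtain ⟨b, hb, h⟩ := hM.models.2.2 φ h1 (mix (scons ∅ v) p)
    (mix_mem (scons_mem TransModel.empty_mem hv) h2) a ha
  have : b = ZFSet.sep (R v) a := by
    ext z
    rw [ZFSet.mem_sep]
    have key : ∀ z ∈ M, (z ∈ b ↔ z ∈ a ∧ R v z) := by
      intro z hz
      refine (h z hz).trans (and_congr_right fun _ => ?_)
      have : Function.update (mix (scons ∅ v) p) 0 z = mix (scons z v) p := by
        funext n
        by_cases hn : n = 0
        · subst hn; simp [mix, scons]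
        · rw [Function.update_of_ne hn]
          unfold mix
          split_ifs with hn2
          · obtain ⟨m, hm⟩ : ∃ m, n / 2 = m + 1 := ⟨n / 2 - 1, by omega⟩
            rw [hm]; rfl
          · rfl
      rw [this]
      exact h3 (scons z v) (scons_mem hz hv)
    exact ⟨fun hz => (key z (hM.trans hb hz)).1 hz, fun hz => (key z (hM.trans ha hz.1)).2 hz⟩
  exact this ▸ hb

theorem sep_mem {R : ZFSet → Prop} (hR : Dfn M fun w => R (w 0)) {a : ZFSet} (ha : a ∈ M) :
    ZFSet.sep R a ∈ M :=
  sep_mem_model (R := fun _ => R) hR (v := fun _ => ∅) (fun _ => TransModel.empty_mem) ha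

theorem collection_model {R : (ℕ → ZFSet) → ZFSet → ZFSet → Prop}
    (hR : Dfn M fun w => R (fun i => w (i + 2)) (w 0) (w 1)) {v : ℕ → ZFSet} (hv : ∀ k, v k ∈ M)
    {a : ZFSet} (ha : a ∈ M) (h : ∀ x, x ∈ a → ∃ y, y ∈ M ∧ R v x y) :
    ∃ b, b ∈ M ∧ ∀ x, x ∈ a → ∃ y, y ∈ b ∧ R v x y := by
  obtain ⟨φ, h1, p, h2, h3⟩ := hR.out
  have hinj : Function.Injective (Equiv.swap 1 2 : ℕ ≃ ℕ) := Equiv.injective _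
  have hw : ∀ k, mix (scons ∅ (scons ∅ v)) p k ∈ M :=
    mix_mem (scons_mem TransModel.empty_mem (scons_mem TransModel.empty_mem hv)) h2
  have key : ∀ x ∈ M, ∀ y ∈ M, (Interp zmem zeq ∅ (memsOf M) (φ.rename (Equiv.swap 1 2))
      (Function.update (Function.update (mix (scons ∅ (scons ∅ v)) p ∘ Equiv.swap 1 2) 0 x) 1 y) ↔
      R v x y) := by
    intro x hx y hy
    rw [interp_rename hinj]
    refine Iff.trans (Eq.to_iff (congrArg _ ?_)) (h3 (scons x (scons y v))
      (scons_mem hx (scons_mem hy hv)))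
    funext n
    simp only [Function.comp_apply, Function.update_apply, Equiv.swap_apply_self]
    rcases Nat.lt_or_ge n 3 with hn | hn
    · interval_cases n <;> simp [Equiv.swap_apply_def, mix, scons]
    · have e1 : Equiv.swap 1 2 n = n := Equiv.swap_apply_of_ne_of_ne (by omega) (by omega)
      rw [e1, if_neg (by omega), if_neg (by omega)]
      have e2 : (mix (scons ∅ (scons ∅ v)) p ∘ (Equiv.swap 1 2 : ℕ ≃ ℕ)) n =
          mix (scons ∅ (scons ∅ v)) p n := by rw [Function.comp_apply, e1]
      try rw [e1]
      unfold mix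
      split_ifs with hn2
      · obtain ⟨m, hm⟩ : ∃ m, n / 2 = m + 2 := ⟨n / 2 - 2, by omega⟩
        rw [hm]; rfl
      · rfl
  obtain ⟨b, hb, hb'⟩ := hM.models.2.1 _ (h1.rename (Equiv.swap 1 2)) _ (fun k => hw _) a ha
    fun x hx hxa => by
      obtain ⟨y, hy, hxy⟩ := h x hxa
      exact ⟨y, hy, (key x hx y hy).2 hxy⟩
  refine ⟨b, hb, fun x hx => ?_⟩
  obtain ⟨y, hyM, hy, hxy⟩ := hb' x (hM.trans ha hx) hx
  exact ⟨y, hy, (key x (hM.trans ha hx) y hyM).1 hxy⟩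

theorem collection {R : ZFSet → ZFSet → Prop} (hR : Dfn M fun w => R (w 0) (w 1))
    {a : ZFSet} (ha : a ∈ M) (h : ∀ x, x ∈ a → ∃ y, y ∈ M ∧ R x y) :
    ∃ b, b ∈ M ∧ ∀ x, x ∈ a → ∃ y, y ∈ b ∧ R x y :=
  collection_model (R := fun _ => R) hR (v := fun _ => ∅) (fun _ => TransModel.empty_mem) ha h

instance DfnT.sep {R : (ℕ → ZFSet) → ZFSet → Prop} {a : (ℕ → ZFSet) → ZFSet}
    [hR : Dfn M fun w => R (fun i => w (i + 1)) (w 0)] [ha : DfnT M a] :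
    DfnT M fun v => ZFSet.sep (R v) (a v) := by
  have := ha.weaken
  exact DfnT.of_mem_iff (R := fun v z => z ∈ a v ∧ R v z)
    (fun v hv => sep_mem_model hR hv (ha.val v hv)) inferInstance fun v hv z hz => ZFSet.mem_sep

instance DfnT.empty : DfnT M fun _ => ∅ :=
  have : Fact (∅ ∈ M) := ⟨TransModel.empty_mem⟩
  DfnT.const

theorem pair_set_mem {a b : ZFSet} (ha : a ∈ M) (hb : b ∈ M) : ({a, b} : ZFSet) ∈ M := by
  obtain ⟨p, hp, h⟩ := hM.models.1.2.1 a ha b hb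
  have : p = {a, b} := by
    ext z
    rw [ZFSet.mem_pair]
    refine ⟨fun hz => (h z (hM.trans hp hz)).1 hz, fun hz => (h z ?_).2 hz⟩
    rcases hz with rfl | rfl <;> assumption
  exact this ▸ hp

theorem singleton_mem {a : ZFSet} (ha : a ∈ M) : ({a} : ZFSet) ∈ M := by
  have := pair_set_mem ha ha
  rwa [ZFSet.pair_eq_singleton] at this

theorem sUnion_mem {a : ZFSet} (ha : a ∈ M) : ZFSet.sUnion a ∈ M := by
  obtain ⟨p, hp, h⟩ := hM.models.1.2.2.1 a ha
  have : p = ZFSet.sUnion a := by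
    ext z
    rw [ZFSet.mem_sUnion]
    constructor
    · intro hz
      obtain ⟨y, -, h1, h2⟩ := (h z (hM.trans hp hz)).1 hz
      exact ⟨y, h1, h2⟩
    · rintro ⟨y, h1, h2⟩
      have hy := hM.trans ha h1
      exact (h z (hM.trans hy h2)).2 ⟨y, hy, h1, h2⟩
  exact this ▸ hp

theorem union_mem {a b : ZFSet} (ha : a ∈ M) (hb : b ∈ M) : a ∪ b ∈ M := by
  have := sUnion_mem (pair_set_mem ha hb)
  rwa [show ZFSet.sUnion {a, b} = a ∪ b by ext z; simp] at this

theorem insert_mem {a b : ZFSet} (ha : a ∈ M) (hb : b ∈ M) : insert a b ∈ M := by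
  have := union_mem (singleton_mem ha) hb
  rwa [show ({a} ∪ b : ZFSet) = insert a b by ext z; simp] at this

theorem pair_mem {a b : ZFSet} (ha : a ∈ M) (hb : b ∈ M) : ZFSet.pair a b ∈ M :=
  pair_set_mem (singleton_mem ha) (pair_set_mem ha hb)

instance DfnT.sUnion {a : (ℕ → ZFSet) → ZFSet} [ha : DfnT M a] :
    DfnT M fun v => ZFSet.sUnion (a v) := by
  have := ha.weaken
  exact DfnT.of_mem_iff (R := fun v z => ∃ y, y ∈ a v ∧ z ∈ y)
    (fun v hv => sUnion_mem (ha.val v hv)) inferInstance fun v hv z hz => ZFSet.mem_sUnion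

instance DfnT.insert {a b : (ℕ → ZFSet) → ZFSet} [ha : DfnT M a] [hb : DfnT M b] :
    DfnT M fun v => insert (a v) (b v) := by
  have := ha.weaken
  have := hb.weaken
  exact DfnT.of_mem_iff (R := fun v z => z = a v ∨ z ∈ b v)
    (fun v hv => insert_mem (ha.val v hv) (hb.val v hv)) inferInstance
    fun v hv z hz => ZFSet.mem_insert_iff

instance DfnT.singleton {a : (ℕ → ZFSet) → ZFSet} [ha : DfnT M a] :
    DfnT M fun v => ({a v} : ZFSet) := by
  have := ha.weaken
  exact DfnT.of_mem_iff (R := fun v z => z = a v)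
    (fun v hv => singleton_mem (ha.val v hv)) inferInstance
    fun v hv z hz => ZFSet.mem_singleton

instance DfnT.union {a b : (ℕ → ZFSet) → ZFSet} [ha : DfnT M a] [hb : DfnT M b] :
    DfnT M fun v => a v ∪ b v := by
  have := ha.weaken
  have := hb.weaken
  exact DfnT.of_mem_iff (R := fun v z => z ∈ a v ∨ z ∈ b v)
    (fun v hv => union_mem (ha.val v hv) (hb.val v hv)) inferInstance
    fun v hv z hz => ZFSet.mem_union

instance DfnT.pair {a b : (ℕ → ZFSet) → ZFSet} [ha : DfnT M a] [hb : DfnT M b] :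
    DfnT M fun v => ZFSet.pair (a v) (b v) :=
  inferInstanceAs (DfnT M fun v => ({{a v}, {a v, b v}} : ZFSet))


theorem DfnT.congr {s t : (ℕ → ZFSet) → ZFSet} (hs : DfnT M s)
    (h : ∀ v, (∀ k, v k ∈ M) → s v = t v) : DfnT M t :=
  ⟨fun v hv => h v hv ▸ hs.val v hv, hs.graph.congr fun v hv => by
    simp only [h _ fun k => hv (k + 1)]⟩

instance DfnT.diff {a b : (ℕ → ZFSet) → ZFSet} [ha : DfnT M a] [hb : DfnT M b] :
    DfnT M fun v => a v \ b v := by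
  have := ha.weaken
  have := hb.weaken
  exact DfnT.congr (s := fun v => ZFSet.sep (fun z => z ∉ b v) (a v)) inferInstance fun v hv => by
    ext z; simp

instance DfnT.repl {F : (ℕ → ZFSet) → ZFSet → ZFSet} {a : (ℕ → ZFSet) → ZFSet}
    [hF : DfnT M fun w => F (fun i => w (i + 1)) (w 0)] [ha : DfnT M a] :
    DfnT M fun v => repl (F v) (a v) := by
  have := ha.weaken
  have hr := hF.weaken₁
  have hF' : Dfn M fun w => w 1 = F (fun i => w (i + 2)) (w 0) := Dfn.eq
  refine DfnT.of_mem_iff (R := fun v z => ∃ x, x ∈ a v ∧ z = F v x) ?_ ?_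
    fun v hv z hz => mem_repl
  · intro v hv
    obtain ⟨b, hb, h⟩ := collection_model (R := fun v x y => y = F v x) hF' hv (ha.val v hv)
      fun x hx => ⟨F v x, hF.val (scons x v) (scons_mem (hM.trans (ha.val v hv) hx) hv), rfl⟩
    have := sep_mem_model (R := fun v z => ∃ x, x ∈ a v ∧ z = F v x) inferInstance hv hb
    convert this using 1
    ext z
    rw [mem_repl, ZFSet.mem_sep]
    refine ⟨fun hz => ⟨?_, hz⟩, fun hz => hz.2⟩
    obtain ⟨x, hx, rfl⟩ := hz
    obtain ⟨y, hy, rfl⟩ := h x hx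
    exact hy
  · exact Dfn.bex (hR := hF')

instance DfnT.app {f x : (ℕ → ZFSet) → ZFSet} [hf : DfnT M f] [hx : DfnT M x] :
    DfnT M fun v => app (f v) (x v) := by
  have := hf.weaken
  have := hx.weaken
  exact inferInstanceAs (DfnT M fun v => ZFSet.sUnion (ZFSet.sep (fun y => ZFSet.pair (x v) y ∈ f v)
    (ZFSet.sUnion (ZFSet.sUnion (f v)))))

instance DfnT.lam {F : (ℕ → ZFSet) → ZFSet → ZFSet} {a : (ℕ → ZFSet) → ZFSet}
    [hF : DfnT M fun w => F (fun i => w (i + 1)) (w 0)] [ha : DfnT M a] :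
    DfnT M fun v => lam (F v) (a v) :=
  have : DfnT M fun w => ZFSet.pair (w 0) (F (fun i => w (i + 1)) (w 0)) := inferInstance
  DfnT.repl (F := fun v x => ZFSet.pair x (F v x))

instance DfnT.prod {a b : (ℕ → ZFSet) → ZFSet} [ha : DfnT M a] [hb : DfnT M b] :
    DfnT M fun v => ZFSet.prod (a v) (b v) := by
  have := ha.weaken
  have := hb.weaken
  refine DfnT.congr (s := fun v => ZFSet.sUnion (BabyMeasurable.repl
    (fun x => BabyMeasurable.repl (fun y => ZFSet.pair x y) (b v)) (a v))) inferInstance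
    fun v hv => ?_
  ext z
  simp only [ZFSet.mem_sUnion, mem_repl, ZFSet.mem_prod]
  constructor
  · rintro ⟨_, ⟨x, hx, rfl⟩, hz⟩
    obtain ⟨y, hy, rfl⟩ := mem_repl.1 hz
    exact ⟨x, hx, y, hy, rfl⟩
  · rintro ⟨x, hx, y, hy, rfl⟩
    exact ⟨_, ⟨x, hx, rfl⟩, mem_repl.2 ⟨y, hy, rfl⟩⟩

/-- Values of definable closed terms lie in the model. -/
theorem DfnT.mem {c : ZFSet} (h : DfnT M fun _ => c) : c ∈ M :=
  h.val (fun _ => ∅) fun _ => TransModel.empty_mem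


/-- A unary definable operation preserves the model. -/
theorem DfnT.mem₁ {F : ZFSet → ZFSet} (h : DfnT M fun v => F (v 0)) {x : ZFSet} (hx : x ∈ M) :
    F x ∈ M := h.val (fun _ => x) fun _ => hx

theorem DfnT.comp₁ {F : ZFSet → ZFSet} {s : (ℕ → ZFSet) → ZFSet} (hs : DfnT M s)
    (hF : DfnT M fun w => F (w 0)) : DfnT M fun v => F (s v) :=
  have := hs.weaken
  ⟨fun v hv => hF.mem₁ (hs.val v hv),
    Dfn.comp₂ (Q := fun x y => x = F y) (DfnT.var 0) this hF.graph⟩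

theorem DfnT.comp₂ {F : ZFSet → ZFSet → ZFSet} {s t : (ℕ → ZFSet) → ZFSet} (hs : DfnT M s)
    (ht : DfnT M t) (hF : DfnT M fun w => F (w 0) (w 1)) : DfnT M fun v => F (s v) (t v) :=
  have h1 := hs.weaken
  have h2 := ht.weaken
  ⟨fun v hv => hF.val (scons (s v) (fun _ => t v)) (scons_mem (hs.val v hv) fun _ => ht.val v hv),
    Dfn.comp₃ (Q := fun x y z => x = F y z) (DfnT.var 0) h1 h2 hF.graph⟩

end

end

section

/-- `f` is a function with domain `d`. -/
def FunOn (d f : ZFSet.{u}) : Prop := f = lam (app f) d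

/-- `f` is a bijection from `d` to `r`. -/
def BijFun (d r f : ZFSet.{u}) : Prop :=
  FunOn d f ∧ (∀ x ∈ d, app f x ∈ r) ∧ (∀ x ∈ d, ∀ x' ∈ d, app f x = app f x' → x = x') ∧
    ∀ y ∈ r, ∃ x ∈ d, app f x = y

section absoluteness

variable {D : Set ZFSet.{u}}

theorem FunOn.pair_mem {d f x y : ZFSet.{u}} (h : FunOn d f) :
    ZFSet.pair x y ∈ f ↔ x ∈ d ∧ y = app f x := by
  conv_lhs => rw [show f = lam (app f) d from h]
  exact pair_mem_lam

theorem funOn_lam (F : ZFSet.{u} → ZFSet.{u}) (a : ZFSet.{u}) : FunOn a (lam F a) := by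
  ext p
  rw [mem_lam, mem_lam]
  refine exists_congr fun x => and_congr_right fun hx => ?_
  rw [app_lam hx]

theorem FunOn.ext {d f g : ZFSet.{u}} (hf : FunOn d f) (hg : FunOn d g)
    (h : ∀ x ∈ d, app f x = app g x) : f = g := by
  rw [show f = lam (app f) d from hf, show g = lam (app g) d from hg]
  ext p
  rw [mem_lam, mem_lam]
  refine exists_congr fun x => and_congr_right fun hx => ?_
  rw [h x hx]

theorem uPairG_iff (hD : ∀ x ∈ D, ∀ y ∈ x, y ∈ D) {p x y : ZFSet.{u}} (hp : p ∈ D) (hx : x ∈ D)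
    (hy : y ∈ D) : UPairG zmem zeq D p x y ↔ p = {x, y} := by
  constructor
  · intro h
    ext z
    rw [ZFSet.mem_pair]
    refine ⟨fun hz => (h z (hD _ hp _ hz)).1 hz, fun hz => (h z ?_).2 hz⟩
    rcases hz with rfl | rfl <;> assumption
  · rintro rfl z hz
    exact ZFSet.mem_pair

theorem oPairG_iff (hD : ∀ x ∈ D, ∀ y ∈ x, y ∈ D) {p x y : ZFSet.{u}} (hp : p ∈ D) (hx : x ∈ D)
    (hy : y ∈ D) : OPairG zmem zeq D p x y ↔ p = ZFSet.pair x y := by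
  constructor
  · rintro ⟨s, hs, d, hd, hsp, hdp, h1, h2, h3⟩
    rw [uPairG_iff hD hs hx hx] at h1
    rw [uPairG_iff hD hd hx hy] at h2
    subst h1 h2
    ext z
    rw [ZFSet.pair, ZFSet.mem_pair, ← ZFSet.pair_eq_singleton]
    refine ⟨fun hz => h3 z (hD _ hp _ hz) hz, ?_⟩
    rintro (rfl | rfl) <;> assumption
  · rintro rfl
    have h1 : ({x} : ZFSet) ∈ ZFSet.pair x y := by simp [ZFSet.pair]
    have h2 : ({x, y} : ZFSet) ∈ ZFSet.pair x y := by simp [ZFSet.pair]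
    refine ⟨{x}, hD _ hp _ h1, {x, y}, hD _ hp _ h2, h1, h2, ?_, ?_, ?_⟩
    · rw [uPairG_iff hD (hD _ hp _ h1) hx hx, ZFSet.pair_eq_singleton]
    · rw [uPairG_iff hD (hD _ hp _ h2) hx hy]
    · intro z _ hz
      simpa [ZFSet.pair] using hz

theorem appG_iff (hD : ∀ x ∈ D, ∀ y ∈ x, y ∈ D) {f x y : ZFSet.{u}} (hf : f ∈ D) (hx : x ∈ D)
    (hy : y ∈ D) : AppG zmem zeq D f x y ↔ ZFSet.pair x y ∈ f := by
  constructor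
  · rintro ⟨p, hp, hpf, h⟩
    rw [oPairG_iff hD hp hx hy] at h
    exact h ▸ hpf
  · intro h
    exact ⟨_, hD _ hf _ h, h, (oPairG_iff hD (hD _ hf _ h) hx hy).2 rfl⟩

theorem mem_of_pair_mem (hD : ∀ x ∈ D, ∀ y ∈ x, y ∈ D) {x y : ZFSet.{u}} (h : ZFSet.pair x y ∈ D) :
    x ∈ D ∧ y ∈ D := by
  have : ({x, y} : ZFSet) ∈ D := hD _ h _ (by simp [ZFSet.pair])
  exact ⟨hD _ this _ (by simp), hD _ this _ (by simp)⟩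

theorem isFuncOnG_iff (hD : ∀ x ∈ D, ∀ y ∈ x, y ∈ D) {d f : ZFSet.{u}} (hd : d ∈ D) (hf : f ∈ D) :
    IsFuncOnG zmem zeq D d f ↔ FunOn d f := by
  constructor
  · rintro ⟨h1, h2, h3⟩
    have key : ∀ x ∈ d, ∃ y, ZFSet.pair x y ∈ f ∧ app f x = y := by
      intro x hx
      have hxD := hD _ hd _ hx
      obtain ⟨y, hy, h⟩ := h2 x hxD hx
      have h' := (appG_iff hD hf hxD hy).1 h
      refine ⟨y, h', app_eq h' fun z hz => ?_⟩
      have hzD := (mem_of_pair_mem hD (hD _ hf _ hz)).2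
      exact h3 x hxD hx z hzD y hy ((appG_iff hD hf hxD hzD).2 hz) h
    ext p
    rw [mem_lam]
    constructor
    · intro hp
      obtain ⟨x, hx, hxd, y, hy, h⟩ := h1 p (hD _ hf _ hp) hp
      rw [oPairG_iff hD (hD _ hf _ hp) hx hy] at h
      subst h
      obtain ⟨z, hz, hz'⟩ := key x hxd
      have hzD := (mem_of_pair_mem hD (hD _ hf _ hz)).2
      have := h3 x hx hxd y hy z hzD ((appG_iff hD hf hx hy).2 hp) ((appG_iff hD hf hx hzD).2 hz)
      exact ⟨x, hxd, by rw [hz', this]⟩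
    · rintro ⟨x, hx, rfl⟩
      obtain ⟨y, hy, rfl⟩ := key x hx
      exact hy
  · intro h
    refine ⟨?_, ?_, ?_⟩
    · intro p hp hpf
      have hpf' : p ∈ f := hpf
      rw [show f = lam (app f) d from h, mem_lam] at hpf'
      obtain ⟨x, hx, rfl⟩ := hpf'
      obtain ⟨h1, h2⟩ := mem_of_pair_mem hD hp
      exact ⟨x, h1, hx, _, h2, (oPairG_iff hD hp h1 h2).2 rfl⟩
    · intro x hx hxd
      have h' := h.pair_mem.2 ⟨hxd, rfl⟩
      have := (mem_of_pair_mem hD (hD _ hf _ h')).2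
      exact ⟨_, this, (appG_iff hD hf hx this).2 h'⟩
    · intro x hx hxd y hy y' hy' h1 h2
      rw [appG_iff hD hf hx hy, h.pair_mem] at h1
      rw [appG_iff hD hf hx hy', h.pair_mem] at h2
      exact h1.2.trans h2.2.symm

theorem FunOn.app_mem (hD : ∀ x ∈ D, ∀ y ∈ x, y ∈ D) {d f x : ZFSet.{u}} (hf : f ∈ D)
    (h : FunOn d f)
    (hx : x ∈ d) : x ∈ D ∧ app f x ∈ D :=
  mem_of_pair_mem hD (hD _ hf _ (h.pair_mem.2 ⟨hx, rfl⟩))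

theorem appG_iff_app (hD : ∀ x ∈ D, ∀ y ∈ x, y ∈ D) {d f x y : ZFSet.{u}} (hf : f ∈ D)
    (h : FunOn d f) (hx : x ∈ D) (hy : y ∈ D) : AppG zmem zeq D f x y ↔ x ∈ d ∧ y = app f x := by
  rw [appG_iff hD hf hx hy, h.pair_mem]

theorem isInjFunG_iff (hD : ∀ x ∈ D, ∀ y ∈ x, y ∈ D) {d r f : ZFSet.{u}} (hd : d ∈ D) (hf : f ∈ D) :
    IsInjFunG zmem zeq D d r f ↔ FunOn d f ∧ (∀ x ∈ d, app f x ∈ r) ∧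
      (∀ x ∈ d, ∀ x' ∈ d, app f x = app f x' → x = x') := by
  unfold IsInjFunG
  rw [isFuncOnG_iff hD hd hf]
  refine and_congr_right fun h => and_congr ?_ ?_
  · constructor
    · intro h1 x hx
      obtain ⟨a1, a2⟩ := h.app_mem hD hf hx
      exact h1 x a1 _ a2 ((appG_iff_app hD hf h a1 a2).2 ⟨hx, rfl⟩)
    · intro h1 x hx y hy hxy
      rw [appG_iff_app hD hf h hx hy] at hxy
      exact hxy.2 ▸ h1 x hxy.1
  · constructor
    · intro h1 x hx x' hx' he
      obtain ⟨a1, a2⟩ := h.app_mem hD hf hx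
      obtain ⟨b1, b2⟩ := h.app_mem hD hf hx'
      exact h1 x a1 x' b1 _ a2 _ b2 ((appG_iff_app hD hf h a1 a2).2 ⟨hx, rfl⟩)
        ((appG_iff_app hD hf h b1 b2).2 ⟨hx', rfl⟩) he
    · intro h1 x hx x' hx' y hy y' hy' hxy hxy' he
      rw [appG_iff_app hD hf h hx hy] at hxy
      rw [appG_iff_app hD hf h hx' hy'] at hxy'
      exact h1 x hxy.1 x' hxy'.1 (hxy.2 ▸ hxy'.2 ▸ he)

theorem isBijFunG_iff (hD : ∀ x ∈ D, ∀ y ∈ x, y ∈ D) {d r f : ZFSet.{u}} (hd : d ∈ D)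
    (hr : ∀ y ∈ r, y ∈ D) (hf : f ∈ D) : IsBijFunG zmem zeq D d r f ↔ BijFun d r f := by
  unfold IsBijFunG BijFun
  rw [isInjFunG_iff hD hd hf, and_assoc, and_assoc]
  refine and_congr_right fun h => and_congr_right fun _ => and_congr_right fun _ => ?_
  constructor
  · intro h1 y hy
    obtain ⟨x, hx, hxd, hxy⟩ := h1 y (hr y hy) hy
    rw [appG_iff_app hD hf h hx (hr y hy)] at hxy
    exact ⟨x, hxd, hxy.2.symm⟩
  · intro h1 y hy hyr
    obtain ⟨x, hx, rfl⟩ := h1 y hyr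
    obtain ⟨a1, a2⟩ := h.app_mem hD hf hx
    exact ⟨x, a1, hx, (appG_iff_app hD hf h a1 a2).2 ⟨hx, rfl⟩⟩

theorem transG_iff (hD : ∀ x ∈ D, ∀ y ∈ x, y ∈ D) {t : ZFSet.{u}} (ht : t ∈ D) :
    TransG zmem zeq D t ↔ t.IsTransitive :=
  ⟨fun h x hx y hy => h x (hD _ ht _ hx) hx y (hD _ (hD _ ht _ hx) _ hy) hy,
    fun h x _ hx y _ hy => h x hx hy⟩

theorem isOrdG_iff (hD : ∀ x ∈ D, ∀ y ∈ x, y ∈ D) {o : ZFSet.{u}} (ho : o ∈ D) :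
    IsOrdG zmem zeq D o ↔ o.IsOrdinal := by
  unfold IsOrdG
  rw [transG_iff hD ho, ZFSet.isOrdinal_iff_forall_mem_isTransitive]
  refine and_congr_right fun h1 => ⟨fun h x hx => ?_, fun h => ⟨fun x hxD hx => ?_, ?_⟩⟩
  · exact (transG_iff hD (hD _ ho _ hx)).1 (h.1 x (hD _ ho _ hx) hx)
  · exact (transG_iff hD hxD).2 (h x hx)
  · have : o.IsOrdinal := (ZFSet.isOrdinal_iff_forall_mem_isTransitive).2 ⟨h1, h⟩
    intro x _ hx y _ hy
    exact ZFSet.IsOrdinal.mem_trichotomous (this.mem hx) (this.mem hy)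

theorem memsOf_trans {M : ZFSet.{u}} [hM : TransModel M] : ∀ x ∈ memsOf M, ∀ y ∈ x, y ∈ memsOf M :=
  fun _ hx _ hy => hM.trans hx hy

theorem univ_trans : ∀ x ∈ (Set.univ : Set ZFSet.{u}), ∀ y ∈ x, y ∈ (Set.univ : Set ZFSet.{u}) :=
  fun _ _ _ _ => trivial

end absoluteness

variable {M : ZFSet.{u}} [hM : TransModel M]

instance Dfn.isTransitive {t : (ℕ → ZFSet) → ZFSet} [ht : DfnT M t] :
    Dfn M fun v => (t v).IsTransitive :=
  Dfn.comp₁ ht (Dfn.congr (R := fun v => ∀ x, x ∈ v 0 → x ⊆ v 0) inferInstance fun v hv => Iff.rfl)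

instance Dfn.funOn {d f : (ℕ → ZFSet) → ZFSet} [hd : DfnT M d] [hf : DfnT M f] :
    Dfn M fun v => FunOn (d v) (f v) :=
  Dfn.comp₂ (Q := fun x y => FunOn x y) hd hf
    (inferInstanceAs (Dfn M fun v => v 1 = lam (fun x => app (v 1) x) (v 0)))

theorem exists_bijFun_ordinal {a : ZFSet} (ha : a ∈ M) :
    ∃ o ∈ M, o.IsOrdinal ∧ ∃ f ∈ M, BijFun o a f := by
  obtain ⟨o, ho, h1, f, hf, h2⟩ := hM.models.1.2.2.2.2.2 a ha
  exact ⟨o, ho, (isOrdG_iff memsOf_trans ho).1 h1, f, hf,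
    (isBijFunG_iff memsOf_trans ho (fun y hy => hM.trans ha hy) hf).1 h2⟩

/-- Every nonempty set has an `∈`-minimal element satisfying a given predicate. -/
theorem exists_mem_min (P : ZFSet.{u} → Prop) {x : ZFSet.{u}} (hx : P x) :
    ∃ y, P y ∧ ∀ z, z ∈ y → ¬ P z := by
  obtain ⟨y, hy, h⟩ := ZFSet.mem_wf.has_min {y | P y} ⟨x, hx⟩
  exact ⟨y, hy, fun z hz hPz => h z hPz hz⟩

/-- Choice functions for definable relations. -/
theorem choice_model {R : ZFSet → ZFSet → Prop} (hR : Dfn M fun w => R (w 0) (w 1))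
    {a : ZFSet} (ha : a ∈ M) (h : ∀ x, x ∈ a → ∃ y, y ∈ M ∧ R x y) :
    ∃ f, f ∈ M ∧ FunOn a f ∧ ∀ x, x ∈ a → R x (app f x) := by
  obtain ⟨b, hb, hab⟩ := collection hR ha h
  obtain ⟨o, ho, hord, g, hg, hbij⟩ := exists_bijFun_ordinal hb
  have : ∀ (s t : (ℕ → ZFSet) → ZFSet) [hs : DfnT M s] [ht : DfnT M t],
      Dfn M fun v => R (s v) (t v) :=
    fun s t hs ht => Dfn.comp₂ hs ht hR
  have : Fact (a ∈ M) := ⟨ha⟩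
  have : Fact (b ∈ M) := ⟨hb⟩
  have : Fact (o ∈ M) := ⟨ho⟩
  have : Fact (g ∈ M) := ⟨hg⟩
  set T : ZFSet → ZFSet := fun x => ZFSet.sUnion (ZFSet.sep (fun y => R x y ∧
    ∃ i, i ∈ o ∧ app g i = y ∧ ∀ j, j ∈ i → ¬ R x (app g j)) b) with hT
  have hmem : lam (fun x => ZFSet.sUnion (ZFSet.sep (fun y => R x y ∧
    ∃ i, i ∈ o ∧ app g i = y ∧ ∀ j, j ∈ i → ¬ R x (app g j)) b)) a ∈ M := DfnT.mem inferInstance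
  refine ⟨_, hmem, funOn_lam _ _, fun x hx => ?_⟩
  rw [app_lam hx]
  obtain ⟨y, hy, hxy⟩ := hab x hx
  obtain ⟨i, hi, rfl⟩ := hbij.2.2.2 y hy
  obtain ⟨m, ⟨hm, hRm⟩, hmin⟩ := exists_mem_min (fun i => i ∈ o ∧ R x (app g i)) ⟨hi, hxy⟩
  have key : ZFSet.sep (fun y => R x y ∧
      ∃ i, i ∈ o ∧ app g i = y ∧ ∀ j, j ∈ i → ¬ R x (app g j)) b = {app g m} := by
    ext z
    rw [ZFSet.mem_sep, ZFSet.mem_singleton]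
    constructor
    · rintro ⟨hz, h1, k, hk, rfl, h2⟩
      rcases ZFSet.IsOrdinal.mem_trichotomous (hord.mem hk) (hord.mem hm) with h3 | h3 | h3
      · exact (hmin k h3 ⟨hk, h1⟩).elim
      · rw [h3]
      · exact (h2 m h3 hRm).elim
    · rintro rfl
      exact ⟨hbij.2.1 m hm, hRm, m, hm, rfl, fun j hj h' =>
        hmin j hj ⟨hord.isTransitive.mem_trans hj hm, h'⟩⟩
  rw [key, ZFSet.sUnion_singleton]
  exact hRm

theorem exists_transitive_superset {x : ZFSet} (hx : x ∈ M) :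
    ∃ t ∈ M, t.IsTransitive ∧ x ⊆ t := by
  induction x using ZFSet.inductionOn with
  | _ x ih =>
    obtain ⟨b, hb, h⟩ := collection (R := fun y t => t.IsTransitive ∧ y ⊆ t) inferInstance hx
      fun y hy => ih y hy (hM.trans hx hy)
    have : Fact (b ∈ M) := ⟨hb⟩
    refine ⟨ZFSet.sUnion (ZFSet.sep (fun t => t.IsTransitive) b) ∪ x,
      union_mem (DfnT.mem inferInstance) hx, ?_, fun y hy => ZFSet.mem_union.2 (Or.inr hy)⟩
    intro y hy z hz
    rw [ZFSet.mem_union, ZFSet.mem_sUnion] at hy ⊢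
    left
    rcases hy with ⟨t, ht, hyt⟩ | hy
    · exact ⟨t, ht, (ZFSet.mem_sep.1 ht).2 _ hyt hz⟩
    · obtain ⟨t, ht, h1, h2⟩ := h y hy
      exact ⟨t, ZFSet.mem_sep.2 ⟨ht, h1⟩, h2 hz⟩

end

section recursion

variable (a : ZFSet.{u}) (r : ZFSet.{u} → ZFSet.{u} → Prop) (T : ZFSet.{u} → ZFSet.{u} → ZFSet.{u})

/-- The domain of the function `c`, as a subset of `a`. -/
noncomputable def dom (c : ZFSet.{u}) : ZFSet.{u} :=
  ZFSet.sep (fun x => ZFSet.pair x (app c x) ∈ c) a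

/-- The restriction of `c` to the `r`-predecessors of `x` in `a`. -/
noncomputable def resPred (c x : ZFSet.{u}) : ZFSet.{u} :=
  lam (app c) (ZFSet.sep (fun y => r y x) a)

/-- `c` is a partial solution of the recursion given by `r` and `T` on `a`. -/
def IsAttempt (c : ZFSet.{u}) : Prop :=
  FunOn (dom a c) c ∧ (∀ x ∈ dom a c, ∀ y ∈ a, r y x → y ∈ dom a c) ∧
    ∀ x ∈ dom a c, app c x = T x (resPred a r c x)

variable {a r T}

theorem resPred_congr {c c' x : ZFSet.{u}} (h : ∀ y ∈ a, r y x → app c y = app c' y) :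
    resPred a r c x = resPred a r c' x := by
  ext p
  rw [resPred, resPred, mem_lam, mem_lam]
  refine exists_congr fun y => and_congr_right fun hy => ?_
  rw [h y (ZFSet.mem_sep.1 hy).1 (ZFSet.mem_sep.1 hy).2]

variable {M : ZFSet.{u}} [hM : TransModel M] [hr : Dfn M fun w => r (w 0) (w 1)]
  [hT : DfnT M fun w => T (w 0) (w 1)] [ha : Fact (a ∈ M)]

instance DfnT.dom {s t : (ℕ → ZFSet) → ZFSet} [hs : DfnT M s] [ht : DfnT M t] :
    DfnT M fun v => dom (s v) (t v) :=
  DfnT.comp₂ (F := BabyMeasurable.dom) hs ht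
    (inferInstanceAs (DfnT M fun v => ZFSet.sep (fun x =>
      ZFSet.pair x (BabyMeasurable.app (v 1) x) ∈ v 1) (v 0)))

theorem DfnT.resPred {s t a : (ℕ → ZFSet) → ZFSet} [ha : DfnT M a] [hs : DfnT M s] [ht : DfnT M t] :
    DfnT M fun v => resPred (a v) r (s v) (t v) := by
  have h1 := ha.weaken
  have h2 := hs.weaken
  have h3 := ht.weaken
  have : ∀ (s t : (ℕ → ZFSet) → ZFSet) [hs : DfnT M s] [ht : DfnT M t],
      Dfn M fun v => r (s v) (t v) :=
    fun s t hs ht => Dfn.comp₂ hs ht hr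
  exact inferInstanceAs (DfnT M fun v => BabyMeasurable.lam (fun x => BabyMeasurable.app (s v) x)
    (ZFSet.sep (fun y => r y (t v)) (a v)))

theorem Dfn.isAttempt {t : (ℕ → ZFSet) → ZFSet} [ht : DfnT M t] :
    Dfn M fun v => IsAttempt a r T (t v) := by
  refine Dfn.comp₁ (Q := IsAttempt a r T) ht ?_
  have : ∀ (s t : (ℕ → ZFSet) → ZFSet) [hs : DfnT M s] [ht : DfnT M t],
      Dfn M fun v => r (s v) (t v) :=
    fun s t hs ht => Dfn.comp₂ hs ht hr
  have : ∀ (s t : (ℕ → ZFSet) → ZFSet) [hs : DfnT M s] [ht : DfnT M t],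
      DfnT M fun v => T (s v) (t v) :=
    fun s t hs ht => DfnT.comp₂ hs ht hT
  have : ∀ (s t : (ℕ → ZFSet) → ZFSet) [hs : DfnT M s] [ht : DfnT M t],
      DfnT M fun v => BabyMeasurable.resPred a r (s v) (t v) :=
    fun s t hs ht => DfnT.resPred
  exact inferInstanceAs (Dfn M fun v => FunOn (BabyMeasurable.dom a (v 0)) (v 0) ∧
    (∀ x ∈ BabyMeasurable.dom a (v 0), ∀ y ∈ a, r y x → y ∈ BabyMeasurable.dom a (v 0)) ∧
    ∀ x ∈ BabyMeasurable.dom a (v 0), app (v 0) x = T x (BabyMeasurable.resPred a r (v 0) x))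

theorem IsAttempt.unique
    (hwf : ∀ s ∈ M, s ⊆ a → s ≠ ∅ → ∃ m ∈ s, ∀ y ∈ s, ¬ r y m) {c c' : ZFSet} (hc : c ∈ M)
    (hc' : c' ∈ M)
    (h : IsAttempt a r T c) (h' : IsAttempt a r T c') {x : ZFSet} (hx : x ∈ dom a c)
    (hx' : x ∈ dom a c') : app c x = app c' x := by
  by_contra hne
  have : Fact (c ∈ M) := ⟨hc⟩
  have : Fact (c' ∈ M) := ⟨hc'⟩
  have hs : ZFSet.sep (fun x => x ∈ dom a c ∧ x ∈ dom a c' ∧ app c x ≠ app c' x) a ∈ M :=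
    DfnT.mem inferInstance
  obtain ⟨m, hm, hmin⟩ := hwf _ hs (ZFSet.sep_subset) fun he => by
    have : x ∈ ZFSet.sep (fun x => x ∈ dom a c ∧ x ∈ dom a c' ∧ app c x ≠ app c' x) a :=
      ZFSet.mem_sep.2 ⟨(ZFSet.mem_sep.1 hx).1, hx, hx', hne⟩
    rw [he] at this
    exact ZFSet.notMem_empty _ this
  obtain ⟨hma, h1, h2, h3⟩ := ZFSet.mem_sep.1 hm
  refine h3 ?_
  rw [h.2.2 m h1, h'.2.2 m h2]
  congr 1
  refine resPred_congr fun y hy hym => ?_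
  by_contra hne'
  exact hmin y (ZFSet.mem_sep.2 ⟨hy, h.2.1 m h1 y hy hym, h'.2.1 m h2 y hy hym, hne'⟩) hym

theorem mem_dom_iff {c x : ZFSet.{u}} : x ∈ dom a c ↔ x ∈ a ∧ ZFSet.pair x (app c x) ∈ c :=
  ZFSet.mem_sep

theorem IsAttempt.sUnion
    (hwf : ∀ s ∈ M, s ⊆ a → s ≠ ∅ → ∃ m ∈ s, ∀ y ∈ s, ¬ r y m) {b : ZFSet} (hb : b ∈ M)
    (h : ∀ c ∈ b, IsAttempt a r T c) : IsAttempt a r T (ZFSet.sUnion b) ∧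
      (∀ c ∈ b, ∀ x ∈ dom a c, x ∈ dom a (ZFSet.sUnion b) ∧ app (ZFSet.sUnion b) x = app c x) := by
  have key : ∀ x y, ZFSet.pair x y ∈ ZFSet.sUnion b ↔ ∃ c ∈ b, x ∈ dom a c ∧ y = app c x := by
    intro x y
    rw [ZFSet.mem_sUnion]
    refine exists_congr fun c => and_congr_right fun hc => (h c hc).1.pair_mem
  have happ : ∀ c ∈ b, ∀ x ∈ dom a c, app (ZFSet.sUnion b) x = app c x := by
    intro c hc x hx
    refine app_eq ((key _ _).2 ⟨c, hc, hx, rfl⟩) fun z hz => ?_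
    obtain ⟨c', hc', hx', rfl⟩ := (key _ _).1 hz
    exact IsAttempt.unique hwf (hM.trans hb hc') (hM.trans hb hc) (h c' hc') (h c hc) hx' hx
  have hdom : ∀ x, x ∈ dom a (ZFSet.sUnion b) ↔ ∃ c ∈ b, x ∈ dom a c := by
    intro x
    rw [mem_dom_iff]
    constructor
    · rintro ⟨_, hx⟩
      obtain ⟨c, hc, hx, -⟩ := (key _ _).1 hx
      exact ⟨c, hc, hx⟩
    · rintro ⟨c, hc, hx⟩
      exact ⟨(mem_dom_iff.1 hx).1, (key _ _).2 ⟨c, hc, hx, happ c hc x hx⟩⟩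
  refine ⟨⟨?_, ?_, ?_⟩, fun c hc x hx => ⟨(hdom x).2 ⟨c, hc, hx⟩, happ c hc x hx⟩⟩
  · ext p
    rw [mem_lam]
    constructor
    · intro hp
      obtain ⟨c, hc, hpc⟩ := ZFSet.mem_sUnion.1 hp
      have hf := (h c hc).1
      rw [show c = lam (app c) (dom a c) from hf, mem_lam] at hpc
      obtain ⟨x, hx, rfl⟩ := hpc
      exact ⟨x, (hdom x).2 ⟨c, hc, hx⟩, by rw [happ c hc x hx]⟩
    · rintro ⟨x, hx, rfl⟩
      exact (mem_dom_iff.1 hx).2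
  · intro x hx y hy hyx
    obtain ⟨c, hc, hx⟩ := (hdom x).1 hx
    exact (hdom y).2 ⟨c, hc, (h c hc).2.1 x hx y hy hyx⟩
  · intro x hx
    obtain ⟨c, hc, hx⟩ := (hdom x).1 hx
    rw [happ c hc x hx, (h c hc).2.2 x hx]
    congr 1
    exact resPred_congr fun y hy hyx => (happ c hc y ((h c hc).2.1 x hx y hy hyx)).symm

theorem IsAttempt.extend {c x : ZFSet} (hc : IsAttempt a r T c) (hx : x ∈ a)
    (hxc : x ∉ dom a c) (hxx : ¬ r x x) (h : ∀ y ∈ a, r y x → y ∈ dom a c) :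
    IsAttempt a r T (insert (ZFSet.pair x (T x (resPred a r c x))) c) ∧
      x ∈ dom a (insert (ZFSet.pair x (T x (resPred a r c x))) c) := by
  set w := T x (resPred a r c x)
  set c' := insert (ZFSet.pair x w) c
  have hno : ∀ z, ZFSet.pair x z ∉ c := fun z hz => hxc (hc.1.pair_mem.1 hz).1
  have hpair : ∀ y z, ZFSet.pair y z ∈ c' ↔ (y = x ∧ z = w) ∨ (y ∈ dom a c ∧ z = app c y) := by
    intro y z
    rw [ZFSet.mem_insert_iff, ZFSet.pair_inj, hc.1.pair_mem]
  have h1 : app c' x = w := app_eq ((hpair _ _).2 (Or.inl ⟨rfl, rfl⟩)) fun z hz => by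
    rcases (hpair _ _).1 hz with h | h
    · exact h.2
    · exact (hxc h.1).elim
  have h2 : ∀ y ∈ dom a c, app c' y = app c y := fun y hy =>
    app_eq ((hpair _ _).2 (Or.inr ⟨hy, rfl⟩)) fun z hz => by
      rcases (hpair _ _).1 hz with h | h
      · exact (hxc (h.1 ▸ hy)).elim
      · exact h.2
  have hdom : ∀ y, y ∈ dom a c' ↔ y = x ∨ y ∈ dom a c := by
    intro y
    rw [mem_dom_iff, hpair]
    constructor
    · rintro ⟨_, h | h⟩
      · exact Or.inl h.1
      · exact Or.inr h.1
    · rintro (rfl | hy)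
      · exact ⟨hx, Or.inl ⟨rfl, h1⟩⟩
      · exact ⟨(mem_dom_iff.1 hy).1, Or.inr ⟨hy, h2 y hy⟩⟩
  refine ⟨⟨?_, ?_, ?_⟩, (hdom x).2 (Or.inl rfl)⟩
  · ext p
    rw [mem_lam]
    constructor
    · intro hp
      rcases ZFSet.mem_insert_iff.1 hp with rfl | hp
      · exact ⟨x, (hdom x).2 (Or.inl rfl), by rw [h1]⟩
      · rw [show c = lam (app c) (dom a c) from hc.1, mem_lam] at hp
        obtain ⟨y, hy, rfl⟩ := hp
        exact ⟨y, (hdom y).2 (Or.inr hy), by rw [h2 y hy]⟩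
    · rintro ⟨y, hy, rfl⟩
      exact (mem_dom_iff.1 hy).2
  · intro y hy z hz hzy
    rcases (hdom y).1 hy with rfl | hy
    · exact (hdom z).2 (Or.inr (h z hz hzy))
    · exact (hdom z).2 (Or.inr (hc.2.1 y hy z hz hzy))
  · intro y hy
    have hres : ∀ y, (∀ z ∈ a, r z y → z ∈ dom a c) → resPred a r c' y = resPred a r c y :=
      fun y hy => resPred_congr fun z hz hzy => h2 z (hy z hz hzy)
    rcases (hdom y).1 hy with rfl | hy
    · rw [h1, hres _ h]
    · rw [h2 y hy, hres y (hc.2.1 y hy), hc.2.2 y hy]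

/-- Definition by recursion along an internally well-founded relation. -/
theorem recursion_model (hwf : ∀ s ∈ M, s ⊆ a → s ≠ ∅ → ∃ m ∈ s, ∀ y ∈ s, ¬ r y m) :
    ∃ c ∈ M, FunOn a c ∧ ∀ x ∈ a, app c x = T x (lam (app c) (ZFSet.sep (fun y => r y x) a)) := by
  have hdfn : ∀ (t : (ℕ → ZFSet) → ZFSet) [ht : DfnT M t], Dfn M fun v => IsAttempt a r T (t v) :=
    fun t ht => Dfn.isAttempt
  have hcoll : ∀ d ∈ M, d ⊆ a → (∀ y ∈ d, ∃ c ∈ M, IsAttempt a r T c ∧ y ∈ dom a c) →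
      ∃ c ∈ M, IsAttempt a r T c ∧ ∀ y ∈ d, y ∈ dom a c := by
    intro d hd hda h
    obtain ⟨b, hb, h⟩ := collection (R := fun y c => IsAttempt a r T c ∧ y ∈ dom a c)
      inferInstance hd h
    have : Fact (b ∈ M) := ⟨hb⟩
    have hb' : ZFSet.sep (fun c => IsAttempt a r T c) b ∈ M := DfnT.mem inferInstance
    obtain ⟨h1, h2⟩ := IsAttempt.sUnion hwf hb' fun c hc => (ZFSet.mem_sep.1 hc).2
    refine ⟨_, sUnion_mem hb', h1, fun y hy => ?_⟩
    obtain ⟨c, hc, hc', hy'⟩ := h y hy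
    exact (h2 c (ZFSet.mem_sep.2 ⟨hc, hc'⟩) y hy').1
  have hall : ∀ x ∈ a, ∃ c ∈ M, IsAttempt a r T c ∧ x ∈ dom a c := by
    by_contra hne
    push Not at hne
    obtain ⟨x, hx, hne⟩ := hne
    have hs : ZFSet.sep (fun x => ¬ ∃ c ∈ M, IsAttempt a r T c ∧ x ∈ dom a c) a ∈ M :=
      DfnT.mem inferInstance
    obtain ⟨m, hm, hmin⟩ := hwf _ hs ZFSet.sep_subset fun he => by
      have : x ∈ ZFSet.sep (fun x => ¬ ∃ c ∈ M, IsAttempt a r T c ∧ x ∈ dom a c) a :=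
        ZFSet.mem_sep.2 ⟨hx, fun ⟨c, hc, h1, h2⟩ => hne c hc h1 h2⟩
      rw [he] at this
      exact ZFSet.notMem_empty _ this
    obtain ⟨hma, hm'⟩ := ZFSet.mem_sep.1 hm
    have : Fact (m ∈ M) := ⟨hM.trans ha.out hma⟩
    have : ∀ (s t : (ℕ → ZFSet) → ZFSet) [hs : DfnT M s] [ht : DfnT M t],
        Dfn M fun v => r (s v) (t v) :=
      fun s t hs ht => Dfn.comp₂ hs ht hr
    have hd : ZFSet.sep (fun y => r y m) a ∈ M := DfnT.mem inferInstance
    obtain ⟨c, hc, h1, h2⟩ := hcoll _ hd ZFSet.sep_subset fun y hy => by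
      by_contra h
      exact hmin y (ZFSet.mem_sep.2 ⟨(ZFSet.mem_sep.1 hy).1, h⟩) (ZFSet.mem_sep.1 hy).2
    by_cases hmc : m ∈ dom a c
    · exact hm' ⟨c, hc, h1, hmc⟩
    · obtain ⟨h3, h4⟩ := h1.extend hma hmc (hmin m hm)
        fun y hy hym => h2 y (ZFSet.mem_sep.2 ⟨hy, hym⟩)
      have : Fact (c ∈ M) := ⟨hc⟩
      have hw : T m (resPred a r c m) ∈ M :=
        DfnT.mem (DfnT.comp₂ (s := fun _ => m) DfnT.const DfnT.resPred hT)
      exact hm' ⟨_, insert_mem (pair_mem (hM.trans ha.out hma) hw) hc, h3, h4⟩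
  obtain ⟨c, hc, h1, h2⟩ := hcoll a ha.out (fun _ h => h) hall
  have : dom a c = a := ZFSet.ext fun x => ⟨fun h => (mem_dom_iff.1 h).1, fun h => h2 x h⟩
  refine ⟨c, hc, this ▸ h1.1, fun x hx => ?_⟩
  exact h1.2.2 x (h2 x hx)

end recursion

theorem exists_mem_of_ne {s : ZFSet.{u}} (h : s ≠ ∅) : ∃ x, x ∈ s :=
  (ZFSet.eq_empty_or_nonempty s).resolve_left h

/-- The set of second coordinates of the pairs in `s`. -/
noncomputable def rng (s : ZFSet.{u}) : ZFSet.{u} :=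
  ZFSet.sep (fun y => ∃ x ∈ ZFSet.sUnion (ZFSet.sUnion s),
    ZFSet.pair x y ∈ s) (ZFSet.sUnion (ZFSet.sUnion s))

theorem mem_rng {s y : ZFSet.{u}} : y ∈ rng s ↔ ∃ x, ZFSet.pair x y ∈ s := by
  rw [rng, ZFSet.mem_sep]
  exact ⟨fun ⟨_, x, _, h⟩ => ⟨x, h⟩, fun ⟨x, h⟩ =>
    ⟨right_mem_sUnion_of_pair h, x, left_mem_sUnion_of_pair h, h⟩⟩

theorem rng_lam {F : ZFSet.{u} → ZFSet.{u}} {a : ZFSet.{u}} : rng (lam F a) = repl F a := by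
  ext y
  rw [mem_rng, mem_repl]
  exact exists_congr fun x => pair_mem_lam

instance DfnT.rng {M : ZFSet.{u}} [hM : TransModel M] {s : (ℕ → ZFSet) → ZFSet} [hs : DfnT M s] :
    DfnT M fun v => rng (s v) :=
  DfnT.comp₁ (F := BabyMeasurable.rng) hs
    (inferInstanceAs (DfnT M fun v => ZFSet.sep (fun y => ∃ x ∈ ZFSet.sUnion (ZFSet.sUnion (v 0)),
      ZFSet.pair x y ∈ v 0) (ZFSet.sUnion (ZFSet.sUnion (v 0)))))

/-- The Mostowski collapse of an internally well-founded relation on a set. -/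
theorem collapse_model {M : ZFSet.{u}} [hM : TransModel M] {a : ZFSet} {r : ZFSet → ZFSet → Prop}
    (ha : a ∈ M) (hr : Dfn M fun w => r (w 0) (w 1))
    (hwf : ∀ s ∈ M, s ⊆ a → s ≠ ∅ → ∃ m ∈ s, ∀ y ∈ s, ¬ r y m) :
    ∃ c ∈ M, FunOn a c ∧ ∀ x ∈ a, app c x = repl (app c) (ZFSet.sep (fun y => r y x) a) := by
  have : Fact (a ∈ M) := ⟨ha⟩
  obtain ⟨c, hc, h1, h2⟩ := recursion_model (M := M) (a := a) (r := r) (T := fun _ s => rng s) hwf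
  exact ⟨c, hc, h1, fun x hx => by rw [h2 x hx, rng_lam]⟩

/-- The plain form of "`u` is a normal uniform ultrafilter on `κ`" over a transitive model. -/
structure IsUF (M κ u : ZFSet.{u}) : Prop where
  sub : ∀ A ∈ u, A ⊆ κ
  top : κ ∈ u
  up : ∀ A ∈ u, ∀ B ∈ M, A ⊆ B → B ⊆ κ → B ∈ u
  inter : ∀ A ∈ u, ∀ B ∈ u, A ∩ B ∈ u
  ne : ∀ A ∈ u, ∃ z, z ∈ A
  ult : ∀ A ∈ M, A ⊆ κ → A ∈ u ∨ κ \ A ∈ u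
  tail : ∀ ξ ∈ κ, ZFSet.sep (fun z => ξ ∈ z) κ ∈ u
  diag : ∀ F ∈ M, FunOn κ F → (∀ ξ ∈ κ, app F ξ ∈ u) →
    ZFSet.sep (fun β => ∀ ξ ∈ β, ξ ∈ κ → β ∈ app F ξ) κ ∈ u

section

variable {M κ u : ZFSet.{u}} [hM : TransModel M]

theorem isUFG_iff (hκ : κ ∈ M) (hu : u ⊆ M) :
    IsUFG zmem zeq (memsOf M) κ (memsOf u) ↔ IsUF M κ u := by
  have hT : ∀ x ∈ memsOf M, ∀ y ∈ x, y ∈ memsOf M := memsOf_trans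
  have hsub : ∀ {A B : ZFSet}, A ∈ M → (SubG zmem zeq (memsOf M) A B ↔ A ⊆ B) := fun hA =>
    ⟨fun h x hx => h x (hM.trans hA hx) hx, fun h x _ hx => h hx⟩
  have hext : ∀ {R : ZFSet → Prop} {c : ZFSet}, c ∈ M → (∀ z, R z → z ∈ κ) →
      ((∀ z ∈ memsOf M, (zmem z c ↔ R z)) ↔ c = ZFSet.sep R κ) := by
    intro R c hc hR
    constructor
    · intro h
      ext z
      rw [ZFSet.mem_sep]
      exact ⟨fun hz => have := (h z (hM.trans hc hz)).1 hz; ⟨hR z this, this⟩,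
        fun hz => (h z (hM.trans hκ hz.1)).2 hz.2⟩
    · rintro rfl z hz
      exact ZFSet.mem_sep.trans ⟨fun h => h.2, fun h => ⟨hR z h, h⟩⟩
  have hex : ∀ {R : ZFSet → Prop}, (∀ z, R z → z ∈ κ) →
      ((∃ c ∈ memsOf u, ∀ z ∈ memsOf M, (zmem z c ↔ R z)) ↔ ZFSet.sep R κ ∈ u) := by
    intro R hR
    constructor
    · rintro ⟨c, hc, h⟩
      rwa [← (hext (hu hc) hR).1 h]
    · intro h
      exact ⟨_, h, (hext (hu h) hR).2 rfl⟩
  unfold IsUFG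
  have e1 : (∃ a ∈ memsOf u, ∀ z ∈ memsOf M, (zmem z a ↔ zmem z κ)) ↔ κ ∈ u := by
    rw [hex fun z h => h]
    rw [show ZFSet.sep (fun z => zmem z κ) κ = κ from ZFSet.ext fun z => by simp [ZFSet.mem_sep]]
  constructor
  · rintro ⟨h1, h2, h3, h4, h5, h6, h7, h8⟩
    have hs : ∀ A ∈ u, A ⊆ κ := fun A hA => (hsub (hu hA)).1 (h1 A hA).2
    refine ⟨hs, e1.1 h2, ?_, ?_, ?_, ?_, ?_, ?_⟩
    · intro A hA B hB hAB hBκ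
      exact h3 A hA B hB ((hsub (hu hA)).2 hAB) ((hsub hB).2 hBκ)
    · intro A hA B hB
      have := (hex fun z h => hs A hA h.1).1 (h4 A hA B hB)
      rwa [show ZFSet.sep (fun z => zmem z A ∧ zmem z B) κ = A ∩ B from ZFSet.ext fun z => by
        rw [ZFSet.mem_sep, ZFSet.mem_inter]; exact ⟨fun h => h.2, fun h =>
          ⟨hs A hA h.1, h⟩⟩] at this
    · intro A hA
      obtain ⟨z, _, hz⟩ := h5 A hA
      exact ⟨z, hz⟩
    · intro A hA hAκ
      rcases h6 A hA ((hsub hA).2 hAκ) with h | h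
      · exact Or.inl h
      · have := (hex fun z h => h.1).1 h
        rw [show ZFSet.sep (fun z => zmem z κ ∧ ¬ zmem z A) κ = κ \ A from ZFSet.ext fun z => by
          rw [ZFSet.mem_sep, ZFSet.mem_sdiff]; exact ⟨fun h => h.2, fun h => ⟨h.1, h⟩⟩] at this
        exact Or.inr this
    · intro ξ hξ
      have := (hex fun z h => h.1).1 (h7 ξ (hM.trans hκ hξ) hξ)
      rwa [show ZFSet.sep (fun z => zmem z κ ∧ zmem ξ z) κ = ZFSet.sep (fun z => ξ ∈ z) κ from
        ZFSet.ext fun z => by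
          rw [ZFSet.mem_sep, ZFSet.mem_sep]; exact ⟨fun h => h.2, fun h => ⟨h.1, h⟩⟩] at this
    · intro F hF hFun hFu
      have := (hex fun z h => h.1).1 (h8 F hF ((isFuncOnG_iff hT hκ hF).2 hFun)
        fun ξ hξ hξκ y hy hy' => by
        rw [appG_iff_app hT hF hFun hξ hy] at hy'
        rw [hy'.2]
        exact hFu ξ hξκ)
      refine Eq.mp (congrArg (· ∈ u) ?_) this
      ext β
      rw [ZFSet.mem_sep, ZFSet.mem_sep]
      refine and_congr_right fun hβ => ⟨fun h ξ hξ hξκ => ?_, fun h =>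
        ⟨hβ, fun ξ hξ hξβ y hy hy' => ?_⟩⟩
      · have hm := FunOn.app_mem hT hF hFun hξκ
        exact h.2 ξ hm.1 hξ _ hm.2 ((appG_iff_app hT hF hFun hm.1 hm.2).2 ⟨hξκ, rfl⟩)
      · rw [appG_iff_app hT hF hFun hξ hy] at hy'
        rw [hy'.2]
        exact h ξ hξβ hy'.1
  · intro h
    refine ⟨fun A hA => ⟨hu hA, (hsub (hu hA)).2 (h.sub A hA)⟩, e1.2 h.top, ?_, ?_, ?_, ?_, ?_, ?_⟩
    · intro A hA B hB hAB hBκ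
      exact h.up A hA B hB ((hsub (hu hA)).1 hAB) ((hsub hB).1 hBκ)
    · intro A hA B hB
      refine ⟨_, h.inter A hA B hB, fun z _ => ZFSet.mem_inter⟩
    · intro A hA
      obtain ⟨z, hz⟩ := h.ne A hA
      exact ⟨z, hM.trans (hu hA) hz, hz⟩
    · intro A hA hAκ
      rcases h.ult A hA ((hsub hA).1 hAκ) with h | h
      · exact Or.inl h
      · exact Or.inr ⟨_, h, fun z _ => ZFSet.mem_sdiff⟩
    · intro ξ _ hξ
      exact ⟨_, h.tail ξ hξ, fun z _ => ZFSet.mem_sep⟩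
    · intro F hF hFun hFu
      have hFun' := (isFuncOnG_iff hT hκ hF).1 hFun
      refine ⟨_, h.diag F hF hFun' fun ξ hξ => ?_, fun β hβ => ?_⟩
      · have hm := FunOn.app_mem hT hF hFun' hξ
        exact hFu ξ hm.1 hξ _ hm.2 ((appG_iff_app hT hF hFun' hm.1 hm.2).2 ⟨hξ, rfl⟩)
      · refine ZFSet.mem_sep.trans (and_congr_right fun hβκ => ⟨fun h ξ hξ hξβ y hy hy' => ?_,
          fun h ξ hξ hξκ => ?_⟩)
        · rw [appG_iff_app hT hF hFun' hξ hy] at hy'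
          rw [hy'.2]
          exact h ξ hξβ hy'.1
        · have hm := FunOn.app_mem hT hF hFun' hξκ
          exact h ξ hm.1 hξ _ hm.2 ((appG_iff_app hT hF hFun' hm.1 hm.2).2 ⟨hξκ, rfl⟩)

/-- `R ξ` holds for `u`-almost all `ξ ∈ κ`. -/
def Ae (κ u : ZFSet.{u}) (R : ZFSet.{u} → Prop) : Prop := ZFSet.sep R κ ∈ u

instance Dfn.ae [hκ : Fact (κ ∈ M)] [hu : Fact (u ∈ M)] {R : (ℕ → ZFSet) → ZFSet → Prop}
    [hR : Dfn M fun w => R (fun i => w (i + 1)) (w 0)] : Dfn M fun v => Ae κ u (R v) :=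
  inferInstanceAs (Dfn M fun v => ZFSet.sep (R v) κ ∈ u)

theorem Ae.and (hU : IsUF M κ u) {R S : ZFSet → Prop} (h : Ae κ u R) (h' : Ae κ u S) :
    Ae κ u fun ξ => R ξ ∧ S ξ := by
  have := hU.inter _ h _ h'
  rwa [show ZFSet.sep R κ ∩ ZFSet.sep S κ = ZFSet.sep (fun ξ => R ξ ∧
    S ξ) κ from ZFSet.ext fun z => by
    simp only [ZFSet.mem_inter, ZFSet.mem_sep]; tauto] at this

theorem Ae.exists (hU : IsUF M κ u) {R : ZFSet → Prop} (h : Ae κ u R) : ∃ ξ ∈ κ, R ξ := by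
  obtain ⟨z, hz⟩ := hU.ne _ h
  exact ⟨z, ZFSet.mem_sep.1 hz⟩

theorem Ae.mono (hU : IsUF M κ u) (hκ : κ ∈ M) {R S : ZFSet → Prop} (hS : Dfn M fun w => S (w 0))
    (h : Ae κ u R) (h' : ∀ ξ ∈ κ, R ξ → S ξ) : Ae κ u S :=
  hU.up _ h _ (sep_mem hS hκ) (fun z hz => ZFSet.mem_sep.2
    ⟨(ZFSet.mem_sep.1 hz).1, h' z (ZFSet.mem_sep.1 hz).1 (ZFSet.mem_sep.1 hz).2⟩) ZFSet.sep_subset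

theorem ae_of_forall (hU : IsUF M κ u) {S : ZFSet → Prop} (h' : ∀ ξ ∈ κ, S ξ) : Ae κ u S := by
  rw [Ae, show ZFSet.sep S κ = κ from ZFSet.ext fun z => ZFSet.mem_sep.trans ⟨fun h => h.1,
    fun h => ⟨h, h' z h⟩⟩]
  exact hU.top

theorem ae_not (hU : IsUF M κ u) (hκ : κ ∈ M) {R : ZFSet → Prop} (hR : Dfn M fun w => R (w 0))
    (h : ¬ Ae κ u R) : Ae κ u fun ξ => ¬ R ξ := by
  rcases hU.ult _ (sep_mem hR hκ) ZFSet.sep_subset with hmem | hmem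
  · exact (h hmem).elim
  · rwa [show κ \ ZFSet.sep R κ = ZFSet.sep (fun ξ => ¬ R ξ) κ from ZFSet.ext fun z => by
      simp only [ZFSet.mem_sdiff, ZFSet.mem_sep]; tauto] at hmem

/-- Membership in the ultrapower. -/
def UE (κ u f g : ZFSet.{u}) : Prop := Ae κ u fun ξ => app f ξ ∈ app g ξ

/-- Equality in the ultrapower. -/
def UEq (κ u f g : ZFSet.{u}) : Prop := Ae κ u fun ξ => app f ξ = app g ξ

instance Dfn.ue [hκ : Fact (κ ∈ M)] [hu : Fact (u ∈ M)] {s t : (ℕ → ZFSet) → ZFSet} [hs : DfnT M s]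
    [ht : DfnT M t] : Dfn M fun v => UE κ u (s v) (t v) :=
  have := hs.weaken
  have := ht.weaken
  inferInstanceAs (Dfn M fun v => Ae κ u fun ξ => app (s v) ξ ∈ app (t v) ξ)

/-- The ordinal `ω`. -/
structure IsOmega (w : ZFSet.{u}) : Prop where
  ord : w.IsOrdinal
  zero : ∅ ∈ w
  succ : ∀ n ∈ w, insert n n ∈ w
  cases : ∀ n ∈ w, n = ∅ ∨ ∃ p ∈ w, n = insert p p

theorem IsOmega.induction {w : ZFSet.{u}} (hw : IsOmega w) {P : ZFSet → Prop} (h0 : P ∅)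
    (hs : ∀ n ∈ w, P n → P (insert n n)) : ∀ n ∈ w, P n := by
  by_contra hne
  push Not at hne
  obtain ⟨n, hn, hPn⟩ := hne
  obtain ⟨m, ⟨hm, hPm⟩, hmin⟩ := exists_mem_min (fun n => n ∈ w ∧ ¬ P n) ⟨hn, hPn⟩
  rcases hw.cases m hm with rfl | ⟨p, hp, rfl⟩
  · exact hPm h0
  · refine hPm (hs p hp ?_)
    by_contra hPp
    exact hmin p (by simp) ⟨hp, hPp⟩

theorem sUnion_succ {n : ZFSet.{u}} (h : n.IsTransitive) : ZFSet.sUnion (insert n n) = n := by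
  ext z
  simp only [ZFSet.mem_sUnion, ZFSet.mem_insert_iff]
  constructor
  · rintro ⟨y, rfl | hy, hz⟩
    · exact hz
    · exact h.mem_trans hz hy
  · exact fun hz => ⟨n, Or.inl rfl, hz⟩

/-- Every internal set of functions has a minimal element in the ultrapower. -/
theorem internal_wf (hU : IsUF M κ u) (hκ : κ ∈ M) (hu : u ∈ M) (hκo : κ.IsOrdinal) {w : ZFSet}
    (hw : IsOmega w) (hwκ : w ∈ κ) {s : ZFSet} (hs : s ∈ M) (hne : s ≠ ∅) :
    ∃ m ∈ s, ∀ y ∈ s, ¬ UE κ u y m := by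
  have : Fact (κ ∈ M) := ⟨hκ⟩
  have : Fact (u ∈ M) := ⟨hu⟩
  have : Fact (s ∈ M) := ⟨hs⟩
  have hwM : w ∈ M := hM.trans hκ hwκ
  have : Fact (w ∈ M) := ⟨hwM⟩
  by_contra hcon
  push Not at hcon
  obtain ⟨f0, hf0⟩ := exists_mem_of_ne hne
  have : Fact (f0 ∈ M) := ⟨hM.trans hs hf0⟩
  have h0 : ∅ ∉ s := by
    intro h
    obtain ⟨y, hy, hyE⟩ := hcon _ h
    obtain ⟨ξ, _, hξ⟩ := hyE.exists hU
    rw [app_eq_empty (f := ∅) fun z => ZFSet.notMem_empty _] at hξ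
    exact ZFSet.notMem_empty _ hξ
  obtain ⟨G, hG, hGf, hGR⟩ := choice_model
    (R := fun f g => (f = ∅ ∧ g = f0) ∨ (f ∈ s ∧ g ∈ s ∧ UE κ u g f)) inferInstance
    (insert_mem TransModel.empty_mem hs : insert ∅ s ∈ M) (by
      intro x hx
      rcases ZFSet.mem_insert_iff.1 hx with rfl | hx
      · exact ⟨f0, hM.trans hs hf0, Or.inl ⟨rfl, rfl⟩⟩
      · obtain ⟨y, hy, h⟩ := hcon x hx
        exact ⟨y, hM.trans hs hy, Or.inr ⟨hx, hy, h⟩⟩)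
  have : Fact (G ∈ M) := ⟨hG⟩
  obtain ⟨F, hF, hFf, hFrec⟩ := recursion_model (M := M) (a := w) (r := fun x y => x ∈ y)
    (T := fun n t => app G (app t (ZFSet.sUnion n))) (by
      intro t _ _ hne
      obtain ⟨x, hx⟩ := exists_mem_of_ne hne
      obtain ⟨m, hm, hmin⟩ := exists_mem_min (fun x => x ∈ t) hx
      exact ⟨m, hm, fun y hy hym => hmin y hym hy⟩)
  have : Fact (F ∈ M) := ⟨hF⟩
  have hF0 : app F ∅ = f0 := by
    rw [hFrec ∅ hw.zero, app_lam_of_notMem (by simp)]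
    rcases hGR ∅ (by simp) with h | h
    · exact h.2
    · exact (h0 h.1).elim
  have hFs : ∀ n ∈ w, app F (insert n n) = app G (app F n) := by
    intro n hn
    rw [hFrec _ (hw.succ n hn), sUnion_succ (hw.ord.mem hn).isTransitive,
      app_lam (ZFSet.mem_sep.2 ⟨hn, by simp⟩)]
  have hmem : ∀ n ∈ w, app F n ∈ s := hw.induction (hF0 ▸ hf0) fun n hn ih => by
    rw [hFs n hn]
    rcases hGR _ (ZFSet.mem_insert_iff.2 (Or.inr ih)) with h | h
    · exact (h0 (h.1 ▸ ih)).elim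
    · exact h.2.1
  have hdec : ∀ n ∈ w, UE κ u (app F (insert n n)) (app F n) := fun n hn => by
    rw [hFs n hn]
    rcases hGR _ (ZFSet.mem_insert_iff.2 (Or.inr (hmem n hn))) with h | h
    · exact (h0 (h.1 ▸ (hmem n hn))).elim
    · exact h.2.2
  have hFam : lam (fun ξ => ZFSet.sep (fun ζ => ξ ∈ w →
      app (app F (insert ξ ξ)) ζ ∈ app (app F ξ) ζ) κ) κ ∈ M := DfnT.mem inferInstance
  have hd := hU.diag _ hFam (funOn_lam _ _) (by
    intro ξ hξ
    have : Fact (ξ ∈ M) := ⟨hM.trans hκ hξ⟩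
    rw [app_lam hξ]
    by_cases hξw : ξ ∈ w
    · exact (hdec ξ hξw).mono hU hκ (S := fun ζ => ξ ∈ w →
        app (app F (insert ξ ξ)) ζ ∈ app (app F ξ) ζ) inferInstance fun ζ _ h _ => h
    · exact ae_of_forall hU fun ζ _ h => (hξw h).elim)
  obtain ⟨β, hβκ, hβ, hwβ⟩ := (Ae.and hU hd (hU.tail w hwκ)).exists hU
  obtain ⟨y, ⟨n, hn, rfl⟩, hmin⟩ := exists_mem_min (fun y => ∃ n ∈ w, y = app (app F n) β)
    ⟨∅, hw.zero, rfl⟩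
  refine hmin (app (app F (insert n n)) β) ?_ ⟨_, hw.succ n hn, rfl⟩
  have hnκ : n ∈ κ := hκo.isTransitive.mem_trans hn hwκ
  have := hβ n ((hκo.mem hβκ).isTransitive.mem_trans hn hwβ) hnκ
  rw [app_lam hnκ] at this
  exact (ZFSet.mem_sep.1 this).2 hn

end

section

variable {M κ u : ZFSet.{u}} [hM : TransModel M]

/-- `d` is the set of functions from `κ` to `t` in `M`. -/
def IsFunSet (M κ t d : ZFSet.{u}) : Prop :=
  ∀ f, f ∈ d ↔ f ∈ M ∧ FunOn κ f ∧ ∀ ξ ∈ κ, app f ξ ∈ t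

/-- `c` is the collapse of the ultrapower membership on `d`. -/
def IsCollapse (κ u d c : ZFSet.{u}) : Prop :=
  ∀ x ∈ d, app c x = repl (app c) (ZFSet.sep (fun y => UE κ u y x) d)

theorem IsCollapse.mem_app {d c x z : ZFSet.{u}} (hc : IsCollapse κ u d c) (hx : x ∈ d) :
    z ∈ app c x ↔ ∃ y ∈ d, UE κ u y x ∧ z = app c y := by
  rw [hc x hx, mem_repl]
  simp only [ZFSet.mem_sep, and_assoc]

theorem UEq.symm' {f g : ZFSet.{u}} (h : UEq κ u f g) : UEq κ u g f := by
  unfold UEq at *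
  simpa only [eq_comm] using h

theorem UE.congr (hU : IsUF M κ u) (hκ : κ ∈ M) (hu : u ∈ M) {f g f' g' : ZFSet} (hf' : f' ∈ M)
    (hg' : g' ∈ M) (h : UE κ u f g)
    (h1 : UEq κ u f f') (h2 : UEq κ u g g') : UE κ u f' g' := by
  have : Fact (f' ∈ M) := ⟨hf'⟩
  have : Fact (g' ∈ M) := ⟨hg'⟩
  refine Ae.mono hU hκ (S := fun ξ => app f' ξ ∈ app g' ξ) inferInstance
    (Ae.and hU h (Ae.and hU h1 h2)) ?_
  rintro ξ _ ⟨h, h1, h2⟩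
  exact h1 ▸ h2 ▸ h

/-- A function into `t` can be changed on a null set to be a function into `t'`. -/
theorem exists_modification (hU : IsUF M κ u) (hκ : κ ∈ M) {h g t' : ZFSet}
    (hh : h ∈ M) (ht' : t' ∈ M) (h0 : ∅ ∈ t') (htr : t'.IsTransitive) (hg : ∀ ξ ∈ κ, app g ξ ∈ t')
    (hE : UE κ u h g) :
    ∃ h' ∈ M, FunOn κ h' ∧ (∀ ξ ∈ κ, app h' ξ ∈ t') ∧ UEq κ u h h' := by
  have : Fact (κ ∈ M) := ⟨hκ⟩
  have : Fact (h ∈ M) := ⟨hh⟩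
  have : Fact (t' ∈ M) := ⟨ht'⟩
  have key : ∀ ξ, app h ξ ∈ t' → ZFSet.sep (fun z => app h ξ ∈ t') (app h ξ) = app h ξ :=
    fun ξ hξ =>
    ZFSet.ext fun z => ZFSet.mem_sep.trans ⟨fun h => h.1, fun h => ⟨h, hξ⟩⟩
  have hm : lam (fun ξ => ZFSet.sep (fun z => app h ξ ∈ t') (app h ξ)) κ ∈ M :=
    DfnT.mem inferInstance
  refine ⟨_, hm, funOn_lam _ _, fun ξ hξ => ?_, ?_⟩
  · rw [app_lam hξ]
    by_cases hc : app h ξ ∈ t'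
    · rw [key ξ hc]
      exact hc
    · rw [show ZFSet.sep (fun z => app h ξ ∈ t') (app h ξ) = ∅ from
        (ZFSet.eq_empty _).2 fun z hz => hc (ZFSet.mem_sep.1 hz).2]
      exact h0
  · have : Fact (lam (fun ξ => ZFSet.sep (fun z => app h ξ ∈ t') (app h ξ)) κ ∈ M) := ⟨hm⟩
    refine Ae.mono hU hκ (S := fun ξ => app h ξ =
      app (lam (fun ξ => ZFSet.sep (fun z => app h ξ ∈ t') (app h ξ)) κ) ξ) inferInstance hE
      fun ξ hξ hξ' => ?_
    rw [app_lam hξ, key ξ (htr.mem_trans hξ' (hg ξ hξ))]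

theorem collapse_independent (hU : IsUF M κ u) (hκ : κ ∈ M) (hu : u ∈ M) {t t' d d' c c' : ZFSet}
    (ht : t ∈ M) (ht' : t' ∈ M) (h0 : ∅ ∈ t) (h0' : ∅ ∈ t') (htr : t.IsTransitive)
    (htr' : t'.IsTransitive) (hd : IsFunSet M κ t d) (hd' : IsFunSet M κ t' d')
    (hc : IsCollapse κ u d c) (hc' : IsCollapse κ u d' c') :
    ∀ x f, f ∈ d → app c f = x → ∀ g ∈ d', UEq κ u f g → x = app c' g := by
  intro x
  induction x using ZFSet.inductionOn with
  | _ x ih =>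
  rintro f hf rfl g hg hfg
  have hfM := ((hd f).1 hf).1
  have hgM := ((hd' g).1 hg).1
  ext z
  rw [hc'.mem_app hg]
  constructor
  · intro hz
    obtain ⟨h, hh, hE, rfl⟩ := (hc.mem_app hf).1 hz
    have hhM := ((hd h).1 hh).1
    have hE' : UE κ u h g := hE.congr hU hκ hu hhM hgM (ae_of_forall hU fun _ _ => rfl) hfg
    obtain ⟨h', hh'M, hh'f, hh't, heq⟩ :=
      exists_modification hU hκ hhM ht' h0' htr' ((hd' g).1 hg).2.2 hE'
    have hh' : h' ∈ d' := (hd' h').2 ⟨hh'M, hh'f, hh't⟩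
    exact ⟨h', hh', hE.congr hU hκ hu hh'M hgM heq hfg, ih _ hz h hh rfl h' hh' heq⟩
  · rintro ⟨h, hh, hE, rfl⟩
    have hhM := ((hd' h).1 hh).1
    have hE' : UE κ u h f := hE.congr hU hκ hu hhM hfM (ae_of_forall hU fun _ _ => rfl) hfg.symm'
    obtain ⟨h', hh'M, hh'f, hh't, heq⟩ :=
      exists_modification hU hκ hhM ht h0 htr ((hd f).1 hf).2.2 hE'
    have hh' : h' ∈ d := (hd h').2 ⟨hh'M, hh'f, hh't⟩
    have hz : app c h' ∈ app c f :=
      (hc.mem_app hf).2 ⟨h', hh', hE'.congr hU hκ hu hh'M hfM heq (ae_of_forall hU fun _ _ => rfl),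
        rfl⟩
    rwa [← ih _ hz h' hh' rfl h hh heq.symm']

/-- Almost everywhere choice of a member of `f ξ` outside of `g ξ`. -/
theorem exists_witness (hU : IsUF M κ u) (hκ : κ ∈ M) {f g t : ZFSet} (hf : f ∈ M) (hg : g ∈ M)
    (h0 : ∅ ∈ t) (htr : t.IsTransitive) (hft : ∀ ξ ∈ κ, app f ξ ∈ t)
    (h : Ae κ u fun ξ => ∃ z ∈ app f ξ, z ∉ app g ξ) :
    ∃ h ∈ M, FunOn κ h ∧ (∀ ξ ∈ κ, app h ξ ∈ t) ∧ UE κ u h f ∧ ¬ UE κ u h g := by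
  have : Fact (κ ∈ M) := ⟨hκ⟩
  have : Fact (f ∈ M) := ⟨hf⟩
  have : Fact (g ∈ M) := ⟨hg⟩
  obtain ⟨k, hk, hkf, hkR⟩ := choice_model (M := M) (R := fun ξ z => (z ∈ app f ξ ∧ z ∉ app g ξ) ∨
    (z = ∅ ∧ ¬ ∃ z ∈ app f ξ, z ∉ app g ξ)) inferInstance hκ (by
      intro ξ hξ
      have : Fact (ξ ∈ M) := ⟨hM.trans hκ hξ⟩
      by_cases hz : ∃ z ∈ app f ξ, z ∉ app g ξ
      · obtain ⟨z, hz, hz'⟩ := hz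
        exact ⟨z, hM.trans (DfnT.mem inferInstance : app f ξ ∈ M) hz, Or.inl ⟨hz, hz'⟩⟩
      · exact ⟨∅, TransModel.empty_mem, Or.inr ⟨rfl, hz⟩⟩)
  have : Fact (k ∈ M) := ⟨hk⟩
  have hkae : ∀ ξ ∈ κ, (∃ z ∈ app f ξ, z ∉ app g ξ) → app k ξ ∈ app f ξ ∧ app k ξ ∉ app g ξ := by
    intro ξ hξ hz
    rcases hkR ξ hξ with h | h
    · exact h
    · exact (h.2 hz).elim
  refine ⟨k, hk, hkf, fun ξ hξ => ?_, ?_, fun hE => ?_⟩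
  · rcases hkR ξ hξ with h | h
    · exact htr.mem_trans h.1 (hft ξ hξ)
    · rw [h.1]
      exact h0
  · exact Ae.mono hU hκ (S := fun ξ => app k ξ ∈ app f ξ) inferInstance h
      fun ξ hξ h => (hkae ξ hξ h).1
  · obtain ⟨ξ, hξ, h1, h2⟩ := (Ae.and hU h hE).exists hU
    exact (hkae ξ hξ h1).2 h2

theorem collapse_injective (hU : IsUF M κ u) (hκ : κ ∈ M) (hu : u ∈ M) {t d c : ZFSet}
    (h0 : ∅ ∈ t) (htr : t.IsTransitive)
    (hd : IsFunSet M κ t d) (hc : IsCollapse κ u d c) :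
    ∀ x f, f ∈ d → app c f = x → ∀ g ∈ d, app c g = x → UEq κ u f g := by
  intro x
  induction x using ZFSet.inductionOn with
  | _ x ih =>
  intro f hf hfx g hg hgx
  have hfM := ((hd f).1 hf).1
  have hgM := ((hd g).1 hg).1
  have : Fact (f ∈ M) := ⟨hfM⟩
  have : Fact (g ∈ M) := ⟨hgM⟩
  have key : ∀ f ∈ d, ∀ g ∈ d, app c f = x → app c g = x →
      ¬ Ae κ u fun ξ => ∃ z ∈ app f ξ, z ∉ app g ξ := by
    rintro f hf g hg hfx hgx hae
    have hfM := ((hd f).1 hf).1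
    have hgM := ((hd g).1 hg).1
    obtain ⟨h, hhM, hhf, hht, h1, h2⟩ :=
      exists_witness hU hκ hfM hgM h0 htr ((hd f).1 hf).2.2 hae
    have hh : h ∈ d := (hd h).2 ⟨hhM, hhf, hht⟩
    have hx : app c h ∈ x := by
      rw [← hfx]
      exact (hc.mem_app hf).2 ⟨h, hh, h1, rfl⟩
    obtain ⟨h', hh', hE, heq⟩ := (hc.mem_app hg).1 (hgx.symm ▸ hx)
    have := ih _ hx h hh rfl h' hh' heq.symm
    exact h2 (hE.congr hU hκ hu hhM hgM this.symm' (ae_of_forall hU fun _ _ => rfl))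
  by_contra hne
  have h1 := ae_not hU hκ (R := fun ξ => app f ξ = app g ξ) inferInstance hne
  have h2 := ae_not hU hκ (R := fun ξ => ∃ z ∈ app f ξ, z ∉ app g ξ) inferInstance
    (key f hf g hg hfx hgx)
  have h3 := ae_not hU hκ (R := fun ξ => ∃ z ∈ app g ξ, z ∉ app f ξ) inferInstance
    (key g hg f hf hgx hfx)
  obtain ⟨ξ, hξ, h1, h2, h3⟩ := (Ae.and hU h1 (Ae.and hU h2 h3)).exists hU
  push Not at h2 h3
  exact h1 (ZFSet.ext fun z => ⟨h2 z, h3 z⟩)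

theorem ultPt_iff (hκ : κ ∈ M) {f : ZFSet} : UltPt (memsOf M) κ f ↔ f ∈ M ∧ FunOn κ f :=
  and_congr_right fun _ => isFuncOnG_iff univ_trans trivial trivial

theorem ult_sep {f g : ZFSet} {R : ZFSet → ZFSet → Prop} (hf : FunOn κ f) (hg : FunOn κ g) :
    (∃ s ∈ memsOf u, ∀ ξ : ZFSet, (ξ ∈ s ↔ (ξ ∈ κ ∧ ∃ a b : ZFSet, ZApp f ξ a ∧ ZApp g ξ b ∧
      R a b))) ↔
      Ae κ u fun ξ => R (app f ξ) (app g ξ) := by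
  have key : ∀ ξ, (ξ ∈ κ ∧ ∃ a b : ZFSet, ZApp f ξ a ∧ ZApp g ξ b ∧ R a b) ↔
      ξ ∈ ZFSet.sep (fun ξ => R (app f ξ) (app g ξ)) κ := by
    intro ξ
    rw [ZFSet.mem_sep]
    refine and_congr_right fun hξ => ?_
    simp only [ZApp, appG_iff_app univ_trans (Set.mem_univ _) hf (Set.mem_univ _) (Set.mem_univ _),
      appG_iff_app univ_trans (Set.mem_univ _) hg (Set.mem_univ _) (Set.mem_univ _)]
    constructor
    · rintro ⟨a, b, ⟨_, rfl⟩, ⟨_, rfl⟩, h⟩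
      exact h
    · intro h
      exact ⟨_, _, ⟨hξ, rfl⟩, ⟨hξ, rfl⟩, h⟩
  constructor
  · rintro ⟨s, hs, h⟩
    rwa [Ae, ← ZFSet.ext fun ξ => (h ξ).trans (key ξ)]
  · intro h
    exact ⟨_, h, fun ξ => (key ξ).symm⟩

theorem ultMem_iff (hκ : κ ∈ M) {f g : ZFSet} (hf : UltPt (memsOf M) κ f)
    (hg : UltPt (memsOf M) κ g) :
    UltMem (memsOf M) κ (memsOf u) f g ↔ UE κ u f g :=
  (and_iff_right hf).trans ((and_iff_right hg).trans
    (ult_sep (R := fun a b => a ∈ b) ((ultPt_iff hκ).1 hf).2 ((ultPt_iff hκ).1 hg).2))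

theorem ultEq_iff (hκ : κ ∈ M) {f g : ZFSet} (hf : UltPt (memsOf M) κ f)
    (hg : UltPt (memsOf M) κ g) :
    UltEq (memsOf M) κ (memsOf u) f g ↔ UEq κ u f g :=
  (and_iff_right hf).trans ((and_iff_right hg).trans
    (ult_sep (R := fun a b => a = b) ((ultPt_iff hκ).1 hf).2 ((ultPt_iff hκ).1 hg).2))

/-- If the model has all the function sets, then the ultrapower collapses into the model. -/
theorem collapsesIntoM_of_funSets (hU : IsUF M κ u) (hκ : κ ∈ M) (hu : u ∈ M) (hκo : κ.IsOrdinal)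
    {w : ZFSet} (hw : IsOmega w) (hwκ : w ∈ κ) (hfun : ∀ t ∈ M, ∃ d ∈ M, IsFunSet M κ t d) :
    WellFounded (UltMem (memsOf M) κ (memsOf u)) ∧ CollapsesIntoM κ M (memsOf u) := by
  have : Fact (κ ∈ M) := ⟨hκ⟩
  have : Fact (u ∈ M) := ⟨hu⟩
  have hloc : ∀ a ∈ M, ∃ t d c, a ⊆ t ∧ t ∈ M ∧ ∅ ∈ t ∧ t.IsTransitive ∧ d ∈ M ∧ c ∈ M ∧
      IsFunSet M κ t d ∧ IsCollapse κ u d c := by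
    intro a ha
    obtain ⟨t, ht, htr, hsub⟩ := exists_transitive_superset
      (insert_mem TransModel.empty_mem ha : insert ∅ a ∈ M)
    obtain ⟨d, hd, hdf⟩ := hfun t ht
    obtain ⟨c, hc, _, hcc⟩ := collapse_model (r := fun f g => UE κ u f g) hd inferInstance
      fun s hs _ hne => internal_wf hU hκ hu hκo hw hwκ hs hne
    exact ⟨t, d, c, fun z hz => hsub (ZFSet.mem_insert_iff.2 (Or.inr hz)), ht, hsub (by simp), htr,
      hd, hc, hdf, hcc⟩
  have hrange : ∀ f ∈ M, repl (app f) κ ∈ M := by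
    intro f hf
    have : Fact (f ∈ M) := ⟨hf⟩
    exact (DfnT.mem inferInstance : repl (fun x => app f x) κ ∈ M)
  choose! t d c hat ht h0 htr hdM hcM hd hc using hloc
  let T : ZFSet → ZFSet := fun f => repl (app f) κ
  have hself : ∀ f, UltPt (memsOf M) κ f → f ∈ d (T f) := fun f hf => by
    rw [ultPt_iff hκ] at hf
    exact (hd _ (hrange f hf.1) f).2 ⟨hf.1, hf.2, fun ξ hξ => hat _ (hrange f hf.1)
      (mem_repl.2 ⟨ξ, hξ, rfl⟩)⟩
  let coll : ZFSet → ZFSet := fun f => app (c (T f)) f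
  have hcoll : ∀ f, UltPt (memsOf M) κ f → ∀ a ∈ M, f ∈ d a → coll f = app (c a) f := by
    intro f hf a ha hfa
    have hr := hrange f hf.1
    exact collapse_independent hU hκ hu (ht _ hr) (ht _ ha) (h0 _ hr) (h0 _ ha) (htr _ hr)
      (htr _ ha)
      (hd _ hr) (hd _ ha) (hc _ hr) (hc _ ha) _ f (hself f hf) rfl f hfa
        (ae_of_forall hU fun _ _ => rfl)
  have hboth : ∀ f g, UltPt (memsOf M) κ f → UltPt (memsOf M) κ g → ∃ a ∈ M, f ∈ d a ∧ g ∈ d a := by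
    intro f g hf hg
    have hr := union_mem (hrange f hf.1) (hrange g hg.1)
    rw [ultPt_iff hκ] at hf hg
    exact ⟨_, hr, (hd _ hr f).2 ⟨hf.1, hf.2, fun ξ hξ => hat _ hr
      (ZFSet.mem_union.2 (Or.inl (mem_repl.2 ⟨ξ, hξ, rfl⟩)))⟩,
      (hd _ hr g).2 ⟨hg.1, hg.2, fun ξ hξ => hat _ hr
      (ZFSet.mem_union.2 (Or.inr (mem_repl.2 ⟨ξ, hξ, rfl⟩)))⟩⟩
  have hmem : ∀ f g, UltPt (memsOf M) κ f → UltPt (memsOf M) κ g →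
      (coll f ∈ coll g ↔ UltMem (memsOf M) κ (memsOf u) f g) := by
    intro f g hf hg
    obtain ⟨a, ha, hfa, hga⟩ := hboth f g hf hg
    rw [hcoll f hf a ha hfa, hcoll g hg a ha hga, ultMem_iff hκ hf hg, (hc a ha).mem_app hga]
    constructor
    · rintro ⟨h, hh, hE, heq⟩
      have := collapse_injective hU hκ hu (h0 _ ha) (htr _ ha) (hd _ ha) (hc _ ha) _ f hfa rfl h hh
        heq.symm
      exact hE.congr hU hκ hu hf.1 hg.1 this.symm' (ae_of_forall hU fun _ _ => rfl)
    · intro h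
      exact ⟨f, hfa, h, rfl⟩
  refine ⟨?_, coll, fun f g hf hg => ⟨?_, hmem f g hf hg⟩, fun f hf x hx => ?_, fun f hf => ?_⟩
  · refine Subrelation.wf (r := InvImage (· ∈ ·) coll) ?_ (InvImage.wf coll ZFSet.mem_wf)
    intro f g hfg
    exact (hmem f g hfg.1 hfg.2.1).2 hfg
  · obtain ⟨a, ha, hfa, hga⟩ := hboth f g hf hg
    rw [hcoll f hf a ha hfa, hcoll g hg a ha hga, ultEq_iff hκ hf hg]
    constructor
    · intro h
      exact collapse_injective hU hκ hu (h0 _ ha) (htr _ ha) (hd _ ha) (hc _ ha) _ f hfa rfl g hga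
        h.symm
    · intro h
      exact collapse_independent hU hκ hu (ht _ ha) (ht _ ha) (h0 _ ha) (h0 _ ha) (htr _ ha)
        (htr _ ha)
        (hd _ ha) (hd _ ha) (hc _ ha) (hc _ ha) _ f hfa rfl g hga h
  · have hr := hrange f hf.1
    obtain ⟨h, hh, hE, rfl⟩ := ((hc _ hr).mem_app (hself f hf)).1 hx
    have hpt : UltPt (memsOf M) κ h :=
      (ultPt_iff hκ).2 ⟨((hd _ hr h).1 hh).1, ((hd _ hr h).1 hh).2.1⟩
    exact ⟨h, hpt, (ultMem_iff hκ hpt hf).2 hE, (hcoll h hpt _ hr hh).symm⟩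
  · have hr := hrange f hf.1
    have : Fact (c (T f) ∈ M) := ⟨hcM _ hr⟩
    have : Fact (f ∈ M) := ⟨hf.1⟩
    exact (DfnT.mem inferInstance : app (c (T f)) f ∈ M)

end

section card

open Cardinal

theorem card_le_of_injOn {a b : ZFSet.{u}} {F : ZFSet → ZFSet} (h : ∀ x ∈ a, F x ∈ b)
    (hinj : ∀ x ∈ a, ∀ y ∈ a, F x = F y → x = y) : a.card ≤ b.card := by
  rw [← Cardinal.lift_le.{u + 1}, ← ZFSet.cardinalMk_coe_sort, ← ZFSet.cardinalMk_coe_sort]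
  exact Cardinal.mk_le_of_injective (f := fun x : a => (⟨F x, h x x.2⟩ : b))
    fun x y hxy => Subtype.ext (hinj x x.2 y y.2 (congrArg Subtype.val hxy))

theorem card_repl_le {a : ZFSet.{u}} {F : ZFSet → ZFSet} : (repl F a).card ≤ a.card := by
  rw [← Cardinal.lift_le.{u + 1}, ← ZFSet.cardinalMk_coe_sort, ← ZFSet.cardinalMk_coe_sort]
  refine Cardinal.mk_le_of_surjective (f := fun x : a =>
    (⟨F x, mem_repl.2 ⟨x, x.2, rfl⟩⟩ : ↥(repl F a)))
    fun y => ?_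
  obtain ⟨x, hx, hy⟩ := mem_repl.1 y.2
  exact ⟨⟨x, hx⟩, Subtype.ext hy.symm⟩

theorem card_prod_le {a b : ZFSet.{u}} : (ZFSet.prod a b).card ≤ a.card * b.card := by
  rw [← Cardinal.lift_le.{u + 1}, Cardinal.lift_mul, ← ZFSet.cardinalMk_coe_sort,
    ← ZFSet.cardinalMk_coe_sort, ← ZFSet.cardinalMk_coe_sort, Cardinal.mul_def]
  refine Cardinal.mk_le_of_surjective (f := fun x : a × b =>
    (⟨ZFSet.pair x.1 x.2, ZFSet.pair_mem_prod.2 ⟨x.1.2, x.2.2⟩⟩ : ↥(ZFSet.prod a b))) fun y => ?_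
  obtain ⟨x, hx, z, hz, hy⟩ := ZFSet.mem_prod.1 y.2
  exact ⟨(⟨x, hx⟩, ⟨z, hz⟩), Subtype.ext hy.symm⟩

theorem BijFun.card_eq {a b f : ZFSet.{u}} (h : BijFun a b f) : a.card = b.card := by
  refine le_antisymm (card_le_of_injOn h.2.1 h.2.2.1) ?_
  refine (ZFSet.card_mono fun y hy => ?_).trans (card_repl_le (F := app f))
  obtain ⟨x, hx, rfl⟩ := h.2.2.2 y hy
  exact mem_repl.2 ⟨x, hx, rfl⟩

theorem exists_bijFun_of_card_eq {a b : ZFSet.{u}} (h : a.card = b.card) : ∃ f, BijFun a b f := by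
  have h' : #a = #b := by
    rw [ZFSet.cardinalMk_coe_sort, ZFSet.cardinalMk_coe_sort, h]
  obtain ⟨e⟩ := Cardinal.eq.1 h'
  classical
  let F : ZFSet → ZFSet := fun x => if hx : x ∈ a then e ⟨x, hx⟩ else ∅
  have hF : ∀ x (hx : x ∈ a), app (lam F a) x = e ⟨x, hx⟩ := fun x hx => by
    rw [app_lam hx]
    exact dif_pos hx
  refine ⟨lam F a, funOn_lam _ _, fun x hx => ?_, fun x hx x' hx' hxx => ?_, fun y hy => ?_⟩
  · rw [hF x hx]
    exact (e ⟨x, hx⟩).2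
  · rw [hF x hx, hF x' hx'] at hxx
    exact congrArg Subtype.val (e.injective (Subtype.ext hxx))
  · refine ⟨e.symm ⟨y, hy⟩, (e.symm ⟨y, hy⟩).2, ?_⟩
    rw [hF _ (e.symm ⟨y, hy⟩).2]
    simp

/-- `κ` is an infinite initial ordinal. -/
structure IsInfCard (κ : ZFSet.{u}) : Prop where
  ord : κ.IsOrdinal
  lt : ∀ ξ ∈ κ, ξ.card < κ.card
  inf : ℵ₀ ≤ κ.card

theorem IsOmega.aleph0_le {w : ZFSet.{u}} (hw : IsOmega w) : ℵ₀ ≤ w.card := by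
  have key : ∀ n : ℕ, (n : Ordinal.{u}).toZFSet ∈ w := by
    intro n
    induction n with
    | zero => simpa using hw.zero
    | succ n ih =>
      rw [Nat.cast_succ, Ordinal.toZFSet_add_one]
      exact hw.succ _ ih
  rw [Cardinal.aleph0_le]
  intro n
  have := ZFSet.card_mono (hw.ord.isTransitive.subset_of_mem (key n))
  simpa using this

theorem IsInfCard.mem_of_card_lt {κ o : ZFSet.{u}} (hκ : IsInfCard κ) (ho : o.IsOrdinal)
    (h : o.card < κ.card) : o ∈ κ := by
  rcases ho.mem_or_subset hκ.ord with h' | h'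
  · exact h'
  · exact (not_lt_of_ge (ZFSet.card_mono h') h).elim

theorem IsInfCard.succ_mem {κ ξ : ZFSet.{u}} (hκ : IsInfCard κ) (h : ξ ∈ κ) : insert ξ ξ ∈ κ := by
  refine hκ.mem_of_card_lt (ZFSet.isOrdinal_succ (hκ.ord.mem h)) ?_
  exact ZFSet.card_insert_le.trans_lt (Cardinal.add_lt_of_lt hκ.inf (hκ.lt ξ h)
    (Cardinal.one_lt_aleph0.trans_le hκ.inf))

end card

section pairing

/-- Gödel's ordering of pairs of ordinals. -/
def GLt (a b c d : ZFSet.{u}) : Prop :=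
  a ∪ b ∈ c ∪ d ∨ (a ∪ b = c ∪ d ∧ (a ∈ c ∨ (a = c ∧ b ∈ d)))

/-- Gödel's ordering on `κ × κ`. -/
def GRel (κ p q : ZFSet.{u}) : Prop :=
  ∃ a ∈ κ, ∃ b ∈ κ, ∃ c ∈ κ, ∃ d ∈ κ, p = ZFSet.pair a b ∧ q = ZFSet.pair c d ∧ GLt a b c d

theorem union_mem_of_ordinal {κ a b : ZFSet.{u}} (hκ : κ.IsOrdinal) (ha : a ∈ κ) (hb : b ∈ κ) :
    a ∪ b ∈ κ := by
  rcases (hκ.mem ha).subset_total (hκ.mem hb) with h | h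
  · rwa [show a ∪ b = b from ZFSet.ext fun z => by
      rw [ZFSet.mem_union]; exact ⟨fun hz => hz.elim (fun hz => h hz) id, Or.inr⟩]
  · rwa [show a ∪ b = a from ZFSet.ext fun z => by
      rw [ZFSet.mem_union]; exact ⟨fun hz => hz.elim id (fun hz => h hz), Or.inl⟩]

theorem gRel_pair {κ a b c d : ZFSet.{u}} :
    GRel κ (ZFSet.pair a b) (ZFSet.pair c d) ↔ (a ∈ κ ∧ b ∈ κ ∧ c ∈ κ ∧ d ∈ κ) ∧ GLt a b c d := by
  constructor
  · rintro ⟨a', ha, b', hb, c', hc, d', hd, h1, h2, h⟩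
    obtain ⟨rfl, rfl⟩ := ZFSet.pair_inj.1 h1
    obtain ⟨rfl, rfl⟩ := ZFSet.pair_inj.1 h2
    exact ⟨⟨ha, hb, hc, hd⟩, h⟩
  · rintro ⟨⟨ha, hb, hc, hd⟩, h⟩
    exact ⟨a, ha, b, hb, c, hc, d, hd, rfl, rfl, h⟩

theorem GLt.trans {κ a b c d e f : ZFSet.{u}} (hκ : κ.IsOrdinal) (he : e ∈ κ)
    (hf : f ∈ κ) (h : GLt a b c d) (h' : GLt c d e f) : GLt a b e f := by
  have hu := hκ.mem (union_mem_of_ordinal hκ he hf)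
  rcases h with h | ⟨h1, h2⟩
  · rcases h' with h' | ⟨h1', h2'⟩
    · exact Or.inl (hu.mem_trans h h')
    · exact Or.inl (h1' ▸ h)
  · rcases h' with h' | ⟨h1', h2'⟩
    · exact Or.inl (h1 ▸ h')
    · refine Or.inr ⟨h1.trans h1', ?_⟩
      rcases h2 with h2 | ⟨rfl, h2⟩
      · rcases h2' with h2' | ⟨rfl, h2'⟩
        · exact Or.inl ((hκ.mem he).mem_trans h2 h2')
        · exact Or.inl h2
      · rcases h2' with h2' | ⟨rfl, h2'⟩
        · exact Or.inl h2'
        · exact Or.inr ⟨rfl, (hκ.mem hf).mem_trans h2 h2'⟩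

theorem GLt.trichotomy {κ a b c d : ZFSet.{u}} (hκ : κ.IsOrdinal) (ha : a ∈ κ) (hb : b ∈ κ)
    (hc : c ∈ κ) (hd : d ∈ κ) : GLt a b c d ∨ (a = c ∧ b = d) ∨ GLt c d a b := by
  rcases (hκ.mem (union_mem_of_ordinal hκ ha hb)).mem_trichotomous
    (hκ.mem (union_mem_of_ordinal hκ hc hd)) with h | h | h
  · exact Or.inl (Or.inl h)
  · rcases (hκ.mem ha).mem_trichotomous (hκ.mem hc) with h1 | rfl | h1
    · exact Or.inl (Or.inr ⟨h, Or.inl h1⟩)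
    · rcases (hκ.mem hb).mem_trichotomous (hκ.mem hd) with h2 | rfl | h2
      · exact Or.inl (Or.inr ⟨h, Or.inr ⟨rfl, h2⟩⟩)
      · exact Or.inr (Or.inl ⟨rfl, rfl⟩)
      · exact Or.inr (Or.inr (Or.inr ⟨h.symm, Or.inr ⟨rfl, h2⟩⟩))
    · exact Or.inr (Or.inr (Or.inr ⟨h.symm, Or.inl h1⟩))
  · exact Or.inr (Or.inr (Or.inl h))

theorem gRel_min {κ : ZFSet.{u}} {s : ZFSet} (hs : s ⊆ ZFSet.prod κ κ) (hne : s ≠ ∅) :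
    ∃ m ∈ s, ∀ y ∈ s, ¬ GRel κ y m := by
  obtain ⟨x, hx⟩ := exists_mem_of_ne hne
  obtain ⟨a0, _, b0, _, rfl⟩ := ZFSet.mem_prod.1 (hs hx)
  obtain ⟨m, ⟨a1, b1, h1, rfl⟩, hm⟩ := exists_mem_min
    (fun m => ∃ a b, ZFSet.pair a b ∈ s ∧ m = a ∪ b) ⟨a0, b0, hx, rfl⟩
  obtain ⟨a, ⟨b2, h2, e2⟩, ha⟩ := exists_mem_min
    (fun a => ∃ b, ZFSet.pair a b ∈ s ∧ a ∪ b = a1 ∪ b1) ⟨b1, h1, rfl⟩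
  obtain ⟨b, ⟨h3, e3⟩, hb⟩ := exists_mem_min
    (fun b => ZFSet.pair a b ∈ s ∧ a ∪ b = a1 ∪ b1) ⟨h2, e2⟩
  refine ⟨_, h3, ?_⟩
  rintro y hy ⟨a', _, b', _, c, _, d, _, rfl, e, h⟩
  obtain ⟨rfl, rfl⟩ := ZFSet.pair_inj.1 e
  rcases h with h | ⟨h, h' | ⟨rfl, h'⟩⟩
  · exact hm _ (e3 ▸ h) ⟨a', b', hy, rfl⟩
  · exact ha _ h' ⟨b', hy, h.trans e3⟩
  · exact hb _ h' ⟨hy, h.trans e3⟩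

theorem exists_pairing {M κ : ZFSet.{u}} [hM : TransModel M] (hκM : κ ∈ M) (hκ : IsInfCard κ) :
    ∃ p ∈ M, (∀ ξ ∈ κ, ∀ η ∈ κ, app p (ZFSet.pair ξ η) ∈ κ) ∧
      ∀ ξ ∈ κ, ∀ η ∈ κ, ∀ ξ' ∈ κ, ∀ η' ∈ κ,
        app p (ZFSet.pair ξ η) = app p (ZFSet.pair ξ' η') → ξ = ξ' ∧ η = η' := by
  have : Fact (κ ∈ M) := ⟨hκM⟩
  obtain ⟨c, hc, hcf, hcrec⟩ := collapse_model (M := M) (a := ZFSet.prod κ κ) (r := GRel κ)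
    (DfnT.mem inferInstance)
    (inferInstanceAs (Dfn M fun w => ∃ a ∈ κ, ∃ b ∈ κ, ∃ c ∈ κ, ∃ d ∈ κ, w 0 = ZFSet.pair a b ∧
      w 1 = ZFSet.pair c d ∧ (a ∪ b ∈ c ∪ d ∨ (a ∪ b = c ∪ d ∧ (a ∈ c ∨ (a = c ∧ b ∈ d))))))
    fun s _ hs hne => gRel_min hs hne
  have hmem : ∀ a ∈ κ, ∀ b ∈ κ, ∀ z, z ∈ app c (ZFSet.pair a b) ↔
      ∃ a' ∈ κ, ∃ b' ∈ κ, GLt a' b' a b ∧ z = app c (ZFSet.pair a' b') := by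
    intro a ha b hb z
    rw [hcrec _ (ZFSet.pair_mem_prod.2 ⟨ha, hb⟩), mem_repl]
    constructor
    · rintro ⟨x, hx, rfl⟩
      obtain ⟨hx, hr⟩ := ZFSet.mem_sep.1 hx
      obtain ⟨a', ha', b', hb', rfl⟩ := ZFSet.mem_prod.1 hx
      exact ⟨a', ha', b', hb', (gRel_pair.1 hr).2, rfl⟩
    · rintro ⟨a', ha', b', hb', h, rfl⟩
      exact ⟨_, ZFSet.mem_sep.2 ⟨ZFSet.pair_mem_prod.2 ⟨ha', hb'⟩,
        gRel_pair.2 ⟨⟨ha', hb', ha, hb⟩, h⟩⟩, rfl⟩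
  have htrans : ∀ a ∈ κ, ∀ b ∈ κ, (app c (ZFSet.pair a b)).IsTransitive := by
    intro a ha b hb y hy z hz
    obtain ⟨a', ha', b', hb', h, rfl⟩ := (hmem a ha b hb y).1 hy
    obtain ⟨a'', ha'', b'', hb'', h', rfl⟩ := (hmem a' ha' b' hb' z).1 hz
    exact (hmem a ha b hb _).2 ⟨a'', ha'', b'', hb'', h'.trans hκ.ord ha hb h, rfl⟩
  refine ⟨c, hc, fun a ha b hb => ?_, fun a ha b hb a' ha' b' hb' heq => ?_⟩
  · refine hκ.mem_of_card_lt (ZFSet.isOrdinal_iff_forall_mem_isTransitive.2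
      ⟨htrans a ha b hb, fun z hz => ?_⟩) ?_
    · obtain ⟨a', ha', b', hb', h, rfl⟩ := (hmem a ha b hb z).1 hz
      exact htrans a' ha' b' hb'
    · have hm := hκ.succ_mem (union_mem_of_ordinal hκ.ord ha hb)
      have hmo := hκ.ord.mem hm
      have hsub : app c (ZFSet.pair a b) ⊆ repl (app c) (ZFSet.prod (insert (a ∪ b) (a ∪ b))
          (insert (a ∪ b) (a ∪ b))) := by
        intro z hz
        obtain ⟨a', ha', b', hb', h, rfl⟩ := (hmem a ha b hb z).1 hz
        have hab : a' ∪ b' ∈ insert (a ∪ b) (a ∪ b) := by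
          rw [ZFSet.mem_insert_iff]
          rcases h with h | h
          · exact Or.inr h
          · exact Or.inl h.1
        refine mem_repl.2 ⟨_, ZFSet.pair_mem_prod.2 ⟨?_, ?_⟩, rfl⟩
        · exact (hκ.ord.mem ha').mem_of_subset_of_mem hmo
            (fun z hz => ZFSet.mem_union.2 (Or.inl hz)) hab
        · exact (hκ.ord.mem hb').mem_of_subset_of_mem hmo
            (fun z hz => ZFSet.mem_union.2 (Or.inr hz)) hab
      refine ((ZFSet.card_mono hsub).trans (card_repl_le.trans card_prod_le)).trans_lt ?_
      exact Cardinal.mul_lt_of_lt hκ.inf (hκ.lt _ hm) (hκ.lt _ hm)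
  · rcases GLt.trichotomy hκ.ord ha hb ha' hb' with h | h | h
    · exact (ZFSet.mem_irrefl _ (heq ▸ (hmem a' ha' b' hb' _).2 ⟨a, ha, b, hb, h, rfl⟩)).elim
    · exact h
    · exact (ZFSet.mem_irrefl _ (heq ▸ (hmem a ha b hb _).2 ⟨a', ha', b', hb', h, rfl⟩)).elim

end pairing

/-- `i` is an injection of `t` into the power set of `κ` in `M`. -/
def IsCode (M κ t i : ZFSet.{u}) : Prop :=
  i ∈ M ∧ (∀ x ∈ t, app i x ⊆ κ) ∧ ∀ x ∈ t, ∀ y ∈ t, app i x = app i y → x = y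

theorem exists_funSet {M κ P t i : ZFSet.{u}} [hM : TransModel M] (hκM : κ ∈ M) (hκ : IsInfCard κ)
    (hP : P ∈ M) (hPs : ∀ x, x ∈ P ↔ x ∈ M ∧ x ⊆ κ) (ht : t ∈ M) (hi : IsCode M κ t i) :
    ∃ d ∈ M, IsFunSet M κ t d := by
  obtain ⟨p, hp, hpκ, hpi⟩ := exists_pairing hκM hκ
  obtain ⟨hiM, hiκ, hii⟩ := hi
  have : Fact (κ ∈ M) := ⟨hκM⟩
  have : Fact (P ∈ M) := ⟨hP⟩
  have : Fact (t ∈ M) := ⟨ht⟩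
  have : Fact (i ∈ M) := ⟨hiM⟩
  have : Fact (p ∈ M) := ⟨hp⟩
  refine ⟨ZFSet.sep (fun f => FunOn κ f ∧ ∀ ξ ∈ κ, app f ξ ∈ t)
    (repl (fun A => ZFSet.sep (fun q => ∃ ξ ∈ κ, ∃ x ∈ t, q = ZFSet.pair ξ x ∧
      ∀ η ∈ κ, (η ∈ app i x ↔ app p (ZFSet.pair ξ η) ∈ A)) (ZFSet.prod κ t)) P),
    DfnT.mem inferInstance, fun f => ?_⟩
  rw [ZFSet.mem_sep, mem_repl]
  constructor
  · rintro ⟨⟨A, hA, rfl⟩, h1, h2⟩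
    have : Fact (A ∈ M) := ⟨hM.trans hP hA⟩
    exact ⟨DfnT.mem inferInstance, h1, h2⟩
  · rintro ⟨hf, h1, h2⟩
    have : Fact (f ∈ M) := ⟨hf⟩
    refine ⟨⟨ZFSet.sep (fun z => ∃ ξ ∈ κ, ∃ η ∈ κ, z = app p (ZFSet.pair ξ η) ∧
      η ∈ app i (app f ξ)) κ,
      (hPs _).2 ⟨DfnT.mem inferInstance, ZFSet.sep_subset⟩, ?_⟩, h1, h2⟩
    have key : ∀ ξ ∈ κ, ∀ η ∈ κ, app p (ZFSet.pair ξ η) ∈ ZFSet.sep (fun z => ∃ ξ ∈ κ, ∃ η ∈ κ,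
        z = app p (ZFSet.pair ξ η) ∧ η ∈ app i (app f ξ)) κ ↔ η ∈ app i (app f ξ) := by
      intro ξ hξ η hη
      rw [ZFSet.mem_sep]
      constructor
      · rintro ⟨_, ξ', hξ', η', hη', e, h⟩
        obtain ⟨rfl, rfl⟩ := hpi _ hξ _ hη _ hξ' _ hη' e
        exact h
      · exact fun h => ⟨hpκ _ hξ _ hη, ξ, hξ, η, hη, rfl, h⟩
    ext q
    rw [ZFSet.mem_sep]
    constructor
    · intro hq
      rw [show f = lam (app f) κ from h1, mem_lam] at hq
      obtain ⟨ξ, hξ, rfl⟩ := hq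
      exact ⟨ZFSet.pair_mem_prod.2 ⟨hξ, h2 ξ hξ⟩, ξ, hξ, _, h2 ξ hξ, rfl,
        fun η hη => (key ξ hξ η hη).symm⟩
    · rintro ⟨_, ξ, hξ, x, hx, rfl, h⟩
      refine h1.pair_mem.2 ⟨hξ, hii _ hx _ (h2 ξ hξ) (ZFSet.ext fun η => ?_)⟩
      constructor
      · intro hη
        have hηκ := hiκ x hx hη
        exact (key ξ hξ η hηκ).1 ((h η hηκ).1 hη)
      · intro hη
        have hηκ := hiκ _ (h2 ξ hξ) hη
        exact (h η hηκ).2 ((key ξ hξ η hηκ).2 hη)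

/-- If every set in the model has a code then the ultrapower collapses into the model. -/
theorem collapsesIntoM_of_codes {M κ u P : ZFSet.{u}} [hM : TransModel M] (hU : IsUF M κ u)
    (hκM : κ ∈ M) (hu : u ∈ M) (hκ : IsInfCard κ) {w : ZFSet} (hw : IsOmega w) (hwκ : w ∈ κ)
    (hP : P ∈ M) (hPs : ∀ x, x ∈ P ↔ x ∈ M ∧ x ⊆ κ) (hcode : ∀ t ∈ M, ∃ i, IsCode M κ t i) :
    WellFounded (UltMem (memsOf M) κ (memsOf u)) ∧ CollapsesIntoM κ M (memsOf u) :=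
  collapsesIntoM_of_funSets hU hκM hu hκ.ord hw hwκ fun t ht => by
    obtain ⟨i, hi⟩ := hcode t ht
    exact exists_funSet hκM hκ hP hPs ht hi

theorem zIsBijFun_iff {d r f : ZFSet.{u}} : ZIsBijFun d r f ↔ BijFun d r f :=
  isBijFunG_iff univ_trans trivial (fun _ _ => trivial) trivial

theorem isInfCard_and_isOmega_of_zIsInacc {κ : ZFSet.{u}} (h : ZIsInacc κ) :
    IsInfCard κ ∧ ∃ w ∈ κ, IsOmega w := by
  obtain ⟨⟨hord, hc⟩, ⟨w, _, ⟨h1, ⟨e, _, hew, he⟩, h3, h4⟩, hwκ⟩, _⟩ := h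
  rw [isOrdG_iff univ_trans trivial] at hord h1
  have hemp : ∀ x : ZFSet.{u}, IsEmptyG zmem zeq Set.univ x → x = ∅ := fun x hx =>
    (ZFSet.eq_empty x).2 fun y hy => hx y trivial hy
  have hsucc : ∀ x s : ZFSet.{u}, SuccOfG zmem zeq Set.univ x s → s = insert x x := fun x s hs => by
    ext z
    rw [ZFSet.mem_insert_iff]
    exact (hs z trivial).trans or_comm
  have hw : IsOmega w := by
    refine ⟨h1, hemp e he ▸ hew, fun n hn => ?_, fun n hn => ?_⟩
    · obtain ⟨s, _, hs, hs'⟩ := h3 n trivial hn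
      exact hsucc n s hs' ▸ hs
    · rcases h4 n trivial hn with h | ⟨p, _, hp, hp'⟩
      · exact Or.inl (hemp n h)
      · exact Or.inr ⟨p, hp, hsucc p n hp'⟩
  refine ⟨⟨hord, fun ξ hξ => ?_, ?_⟩, w, hwκ, hw⟩
  · refine lt_of_le_of_ne (ZFSet.card_mono (hord.isTransitive.subset_of_mem hξ)) fun heq => ?_
    obtain ⟨f, hf⟩ := exists_bijFun_of_card_eq heq
    exact hc ξ trivial hξ f trivial (zIsBijFun_iff.2 hf)
  · exact hw.aleph0_le.trans (ZFSet.card_mono (hord.isTransitive.subset_of_mem hwκ))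

/-- `h` is the cumulative hierarchy below `κ`, with union `v`. -/
structure IsStage (κ h v : ZFSet.{u}) : Prop where
  fn : FunOn κ h
  mem_app : ∀ ξ ∈ κ, ∀ z, z ∈ app h ξ ↔ ∃ η ∈ ξ, z ⊆ app h η
  mem_stage : ∀ z, z ∈ v ↔ ∃ ξ ∈ κ, z ∈ app h ξ

theorem exists_isStage {κ v : ZFSet.{u}} (hκ : κ.IsOrdinal) (hv : ZIsVStage κ v) :
    ∃ h, IsStage κ h v := by
  obtain ⟨h, _, hf, h1, h2⟩ := hv
  rw [isFuncOnG_iff univ_trans trivial trivial] at hf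
  have happ : ∀ x y, AppG zmem zeq Set.univ h x y ↔ x ∈ κ ∧ y = app h x := fun x y =>
    appG_iff_app univ_trans trivial hf trivial trivial
  refine ⟨h, hf, fun ξ hξ z => ?_, fun z => ?_⟩
  · rw [show z ∈ app h ξ ↔ _ from
      h1 ξ trivial hξ _ trivial ((happ _ _).2 ⟨hξ, rfl⟩) z trivial]
    constructor
    · rintro ⟨η, _, hη, w, _, hw, hz⟩
      obtain ⟨_, rfl⟩ := (happ _ _).1 hw
      exact ⟨η, hη, fun y hy => hz y trivial hy⟩
    · rintro ⟨η, hη, hz⟩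
      exact ⟨η, trivial, hη, _, trivial, (happ _ _).2 ⟨hκ.isTransitive.mem_trans hη hξ, rfl⟩,
        fun y _ hy => hz hy⟩
  · rw [show z ∈ v ↔ _ from h2 z trivial]
    constructor
    · rintro ⟨ξ, _, hξ, w, _, hw, hz⟩
      obtain ⟨_, rfl⟩ := (happ _ _).1 hw
      exact ⟨ξ, hξ, hz⟩
    · rintro ⟨ξ, hξ, hz⟩
      exact ⟨ξ, trivial, hξ, _, trivial, (happ _ _).2 ⟨hξ, rfl⟩, hz⟩

theorem IsStage.mono {κ h v : ZFSet.{u}} (hs : IsStage κ h v) (hκ : κ.IsOrdinal) {ξ η : ZFSet}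
    (hξ : ξ ∈ κ) (hη : η ∈ ξ) : app h η ⊆ app h ξ := by
  intro z hz
  obtain ⟨ζ, hζ, h'⟩ := (hs.mem_app η (hκ.isTransitive.mem_trans hη hξ) z).1 hz
  exact (hs.mem_app ξ hξ z).2 ⟨ζ, (hκ.mem hξ).isTransitive.mem_trans hζ hη, h'⟩

theorem IsStage.isTransitive_app {κ h v : ZFSet.{u}} (hs : IsStage κ h v) (hκ : κ.IsOrdinal)
    {ξ : ZFSet}
    (hξ : ξ ∈ κ) : (app h ξ).IsTransitive := by
  intro y hy z hz
  obtain ⟨η, hη, h⟩ := (hs.mem_app ξ hξ y).1 hy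
  exact hs.mono hκ hξ hη (h hz)

theorem IsStage.isTransitive {κ h v : ZFSet.{u}} (hs : IsStage κ h v) (hκ : κ.IsOrdinal) :
    v.IsTransitive := by
  intro y hy z hz
  obtain ⟨ξ, hξ, h⟩ := (hs.mem_stage y).1 hy
  exact (hs.mem_stage z).2 ⟨ξ, hξ, hs.isTransitive_app hκ hξ y h hz⟩

theorem IsStage.ordinal_subset {κ h v : ZFSet.{u}} (hs : IsStage κ h v) (hκ : IsInfCard κ) :
    κ ⊆ v := by
  have key : ∀ ξ : ZFSet.{u}, ξ ∈ κ → ξ ⊆ app h ξ := by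
    intro ξ
    induction ξ using ZFSet.inductionOn with
    | _ ξ ih =>
      intro hξ η hη
      exact (hs.mem_app ξ hξ η).2 ⟨η, hη, ih η hη (hκ.ord.isTransitive.mem_trans hη hξ)⟩
  intro ξ hξ
  exact (hs.mem_stage ξ).2 ⟨_, hκ.succ_mem hξ, key _ (hκ.succ_mem hξ) (ZFSet.mem_insert ξ ξ)⟩

theorem transModel_of_isWeakKappaModel {κ M : ZFSet.{u}} (h : IsWeakKappaModel κ M) :
    TransModel M :=
  ⟨fun hx hy => h.2.1 _ trivial hx _ trivial hy, h.2.2.2.2⟩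

theorem IsWeakKappaModel.subset {κ M : ZFSet.{u}} (h : IsWeakKappaModel κ M) : κ ⊆ M := by
  have := transModel_of_isWeakKappaModel h
  obtain ⟨hκ, _⟩ := isInfCard_and_isOmega_of_zIsInacc h.1
  obtain ⟨v, hv, hs⟩ := h.2.2.2.1
  obtain ⟨g, hg⟩ := exists_isStage hκ.ord hs
  exact fun ξ hξ => this.trans hv (hg.ordinal_subset hκ hξ)

theorem mem_of_isMUltrafilter {κ M u : ZFSet.{u}} (h : IsWeakKappaModel κ M) (hu : u ∈ M)
    (hU : IsMUltrafilter κ M (memsOf u)) : κ ∈ M := by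
  have := transModel_of_isWeakKappaModel h
  obtain ⟨_, ⟨a, ha, hak⟩, _⟩ := hU
  have haM : a ∈ M := this.trans hu ha
  have : a = κ := by
    ext z
    constructor
    · exact fun hz => (hak z (this.trans haM hz)).1 hz
    · exact fun hz => (hak z (h.subset hz)).2 hz
  exact this ▸ haM

theorem isUF_of_isMUltrafilter {κ M u : ZFSet.{u}} (h : IsWeakKappaModel κ M) (hu : u ∈ M)
    (hU : IsMUltrafilter κ M (memsOf u)) : IsUF M κ u := by
  have := transModel_of_isWeakKappaModel h
  exact (isUFG_iff (mem_of_isMUltrafilter h hu hU) fun x hx => this.trans hu hx).1 hU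

section

variable {M : ZFSet.{u}} [hM : TransModel M]

/-- The inverse of a bijection. -/
theorem exists_inverse {a b f : ZFSet} (ha : a ∈ M) (hb : b ∈ M) (hf : f ∈ M) (h : BijFun a b f) :
    ∃ g ∈ M, BijFun b a g ∧ (∀ x ∈ a, app g (app f x) = x) ∧ ∀ y ∈ b, app f (app g y) = y := by
  have : Fact (a ∈ M) := ⟨ha⟩
  have : Fact (b ∈ M) := ⟨hb⟩
  have : Fact (f ∈ M) := ⟨hf⟩
  have hg : lam (fun y => ZFSet.sUnion (ZFSet.sep (fun x => app f x = y) a)) b ∈ M :=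
    DfnT.mem inferInstance
  generalize hgd : lam (fun y => ZFSet.sUnion (ZFSet.sep (fun x => app f x = y) a)) b = g at hg
  have h1 : ∀ x ∈ a, app g (app f x) = x := by
    intro x hx
    rw [← hgd, app_lam (h.2.1 x hx)]
    rw [show ZFSet.sep (fun x' => app f x' = app f x) a = {x} from ?_, ZFSet.sUnion_singleton]
    ext z
    rw [ZFSet.mem_sep, ZFSet.mem_singleton]
    exact ⟨fun hz => h.2.2.1 _ hz.1 _ hx hz.2, fun hz => by rw [hz]; exact ⟨hx, rfl⟩⟩
  have h2 : ∀ y ∈ b, app g y ∈ a ∧ app f (app g y) = y := by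
    intro y hy
    obtain ⟨x, hx, rfl⟩ := h.2.2.2 y hy
    rw [h1 x hx]
    exact ⟨hx, rfl⟩
  refine ⟨g, hg, ⟨hgd ▸ funOn_lam _ _, fun y hy => (h2 y hy).1, fun y hy y' hy' he => ?_,
    fun x hx => ⟨app f x, h.2.1 x hx, h1 x hx⟩⟩, h1, fun y hy => (h2 y hy).2⟩
  rw [← (h2 y hy).2, he, (h2 y' hy').2]

/-- Every set in the model is bijective with a cardinal of the model. -/
theorem exists_bijFun_cardinal {a : ZFSet} (ha : a ∈ M) :
    ∃ o ∈ M, IsCardG zmem zeq (memsOf M) o ∧ ∃ f ∈ M, BijFun o a f := by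
  obtain ⟨o, ⟨ho, hord, f, hf, hbij⟩, hmin⟩ := exists_mem_min
    (fun o => o ∈ M ∧ o.IsOrdinal ∧ ∃ f ∈ M, BijFun o a f) (exists_bijFun_ordinal ha).choose_spec
  refine ⟨o, ho, ⟨(isOrdG_iff memsOf_trans ho).2 hord, fun o' ho' ho'o g hg hgb => ?_⟩, f, hf, hbij⟩
  rw [isBijFunG_iff memsOf_trans ho' (fun y hy => hM.trans ho hy) hg] at hgb
  have : Fact (o' ∈ M) := ⟨ho'⟩
  have : Fact (f ∈ M) := ⟨hf⟩
  have : Fact (g ∈ M) := ⟨hg⟩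
  refine hmin o' ho'o ⟨ho', hord.mem ho'o, lam (fun x => app f (app g x)) o',
    DfnT.mem inferInstance, funOn_lam _ _, fun x hx => ?_, fun x hx x' hx' he => ?_, fun y hy => ?_⟩
  · rw [app_lam hx]
    exact hbij.2.1 _ (hgb.2.1 x hx)
  · rw [app_lam hx, app_lam hx'] at he
    exact hgb.2.2.1 x hx x' hx' (hbij.2.2.1 _ (hgb.2.1 x hx) _ (hgb.2.1 x' hx') he)
  · obtain ⟨z, hz, rfl⟩ := hbij.2.2.2 y hy
    obtain ⟨x, hx, rfl⟩ := hgb.2.2.2 z hz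
    exact ⟨x, hx, app_lam hx⟩

end

theorem collapsesIntoM_of_largestCardIsContinuum {κ M u : ZFSet.{u}}
    (h : IsWeakKappaModel κ M) (hu : u ∈ M)
    (hU : IsMUltrafilter κ M (memsOf u)) (hL : LargestCardIsContinuum κ M) :
    WellFounded (UltMem (memsOf M) κ (memsOf u)) ∧ CollapsesIntoM κ M (memsOf u) := by
  have hM := transModel_of_isWeakKappaModel h
  obtain ⟨hκ, w, hwκ, hw⟩ := isInfCard_and_isOmega_of_zIsInacc h.1
  obtain ⟨δ, p, f, hδ, hp, hf, hps, hc, hbij, hmax⟩ := hL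
  rw [zIsBijFun_iff] at hbij
  have hδo := (isOrdG_iff memsOf_trans hδ).1 hc.1
  refine collapsesIntoM_of_codes (isUF_of_isMUltrafilter h hu hU) (mem_of_isMUltrafilter h hu hU) hu
    hκ hw hwκ hp hps fun t ht => ?_
  obtain ⟨o, ho, hoc, g, hg, hgb⟩ := exists_bijFun_cardinal ht
  obtain ⟨k, hk, hkb, _, hgk⟩ := exists_inverse ho ht hg hgb
  have hoδ : o ⊆ δ := by
    rcases hmax o ho hoc with rfl | h'
    · exact fun _ hx => hx
    · exact hδo.isTransitive.subset_of_mem h'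
  have : Fact (f ∈ M) := ⟨hf⟩
  have : Fact (k ∈ M) := ⟨hk⟩
  have : Fact (t ∈ M) := ⟨ht⟩
  refine ⟨lam (fun x => app f (app k x)) t, DfnT.mem inferInstance, fun x hx => ?_,
    fun x hx y hy he => ?_⟩
  · rw [app_lam hx]
    exact ((hps _).1 (hbij.2.1 _ (hoδ (hkb.2.1 x hx)))).2
  · rw [app_lam hx, app_lam hy] at he
    exact hkb.2.2.1 x hx y hy (hbij.2.2.1 _ (hoδ (hkb.2.1 x hx)) _ (hoδ (hkb.2.1 y hy)) he)

section

variable {M κ : ZFSet.{u}}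

/-- `t` injects into the power set of `κ` in the model `M`. -/
def Small (M κ t : ZFSet.{u}) : Prop :=
  ∃ i, i ∈ M ∧ (∀ x ∈ t, app i x ⊆ κ) ∧ ∀ x ∈ t, ∀ y ∈ t, app i x = app i y → x = y

/-- `x` has a small transitive superset in `M`. -/
def HSmall (M κ x : ZFSet.{u}) : Prop := ∃ t, t ∈ M ∧ t.IsTransitive ∧ x ⊆ t ∧ Small M κ t

/-- The hereditarily small sets of `M`. -/
def hull (M κ : ZFSet.{u}) : ZFSet.{u} := ZFSet.sep (HSmall M κ) M

theorem mem_hull {x : ZFSet} : x ∈ hull M κ ↔ x ∈ M ∧ HSmall M κ x := ZFSet.mem_sep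

variable [hM : TransModel M] [hκM : Fact (κ ∈ M)]

instance Dfn.small {t : (ℕ → ZFSet) → ZFSet} [ht : DfnT M t] : Dfn M fun v => Small M κ (t v) :=
  Dfn.comp₁ (Q := fun t => Small M κ t) ht (inferInstanceAs (Dfn M fun v => ∃ i, i ∈ M ∧
    ((∀ x, x ∈ v 0 → app i x ⊆ κ) ∧ ∀ x, x ∈ v 0 → ∀ y, y ∈ v 0 → app i x = app i y → x = y)))

theorem Small.mono {s t : ZFSet} (ht : Small M κ t) (h : s ⊆ t) : Small M κ s := by
  obtain ⟨i, hi, h1, h2⟩ := ht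
  exact ⟨i, hi, fun x hx => h1 x (h hx), fun x hx y hy => h2 x (h hx) y (h hy)⟩

theorem Small.of_injOn {s t k : ZFSet} (ht : Small M κ t) (hs : s ∈ M) (hk : k ∈ M)
    (hm : ∀ x ∈ s, app k x ∈ t) (hinj : ∀ x ∈ s, ∀ y ∈ s, app k x = app k y → x = y) :
    Small M κ s := by
  obtain ⟨i, hi, h1, h2⟩ := ht
  have : Fact (s ∈ M) := ⟨hs⟩
  have : Fact (k ∈ M) := ⟨hk⟩
  have : Fact (i ∈ M) := ⟨hi⟩
  refine ⟨lam (fun x => app i (app k x)) s, DfnT.mem inferInstance, fun x hx => ?_,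
    fun x hx y hy he => ?_⟩
  · rw [app_lam hx]
    exact h1 _ (hm x hx)
  · rw [app_lam hx, app_lam hy] at he
    exact hinj x hx y hy (h2 _ (hm x hx) _ (hm y hy) he)

theorem Small.of_surj {s t g : ZFSet} (ht : Small M κ t) (htM : t ∈ M) (hs : s ∈ M) (hg : g ∈ M)
    (h : ∀ y ∈ s, ∃ x ∈ t, app g x = y) : Small M κ s := by
  have : Fact (t ∈ M) := ⟨htM⟩
  have : Fact (g ∈ M) := ⟨hg⟩
  obtain ⟨k, hk, _, hk'⟩ := choice_model (R := fun y x => x ∈ t ∧ app g x = y) inferInstance hs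
    fun y hy => by
      obtain ⟨x, hx, hxy⟩ := h y hy
      exact ⟨x, hM.trans htM hx, hx, hxy⟩
  refine ht.of_injOn hs hk (fun y hy => (hk' y hy).1) fun y hy y' hy' he => ?_
  rw [← (hk' y hy).2, he, (hk' y' hy').2]

theorem Small.of_subset_powerset {t : ZFSet} (ht : t ∈ M) (h : ∀ x ∈ t, x ⊆ κ) : Small M κ t := by
  have : Fact (t ∈ M) := ⟨ht⟩
  refine ⟨lam (fun x => x) t, DfnT.mem inferInstance, fun x hx => ?_, fun x hx y hy he => ?_⟩
  · rw [app_lam hx]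
    exact h x hx
  · rwa [app_lam hx, app_lam hy] at he

theorem small_pair (hκ : IsInfCard κ) {a b : ZFSet} (ha : a ∈ M) (hb : b ∈ M)
    (h0 : ∅ ∈ κ) : Small M κ {a, b} := by
  have : Fact (a ∈ M) := ⟨ha⟩
  have : Fact (b ∈ M) := ⟨hb⟩
  have hmem : ∀ x ∈ ({a, b} : ZFSet),
      app (lam (fun x => ZFSet.sep (fun z => z = ∅ ∧ x ≠ a) κ) {a, b}) x =
        ZFSet.sep (fun z => z = ∅ ∧ x ≠ a) κ := fun x hx => app_lam hx
  refine ⟨lam (fun x => ZFSet.sep (fun z => z = ∅ ∧ x ≠ a) κ) {a, b},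
    DfnT.mem (inferInstanceAs (DfnT M fun _ =>
      lam (fun x => ZFSet.sep (fun z => z = ∅ ∧ ¬ x = a) κ) {a, b})), fun x hx => ?_, fun x hx y hy he => ?_⟩
  · rw [hmem x hx]
    exact ZFSet.sep_subset
  · rw [hmem x hx, hmem y hy] at he
    have := congrArg (fun s => ∅ ∈ s) he
    simp only [ZFSet.mem_sep, h0, true_and, ne_eq, eq_iff_iff, not_iff_not] at this
    rw [ZFSet.mem_pair] at hx hy
    rcases hx with rfl | rfl
    · exact (this.1 rfl).symm
    · rcases hy with rfl | rfl
      · exact this.2 rfl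
      · rfl

theorem Small.sUnion (hκ : IsInfCard κ) (h0 : ∅ ∈ κ) {s : ZFSet} (hs : s ∈ M)
    (hsm : Small M κ s) (h : ∀ x ∈ s, Small M κ x) : Small M κ (ZFSet.sUnion s) := by
  obtain ⟨p, hp, hpκ, hpi⟩ := exists_pairing hκM.out hκ
  have h1 : insert ∅ ∅ ∈ κ := hκ.succ_mem h0
  have h01 : (∅ : ZFSet.{u}) ≠ insert ∅ ∅ := fun h => by
    have := ZFSet.mem_insert (∅ : ZFSet.{u}) ∅
    rw [← h] at this
    exact ZFSet.notMem_empty _ this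
  obtain ⟨i, hi, hi1, hi2⟩ := hsm
  obtain ⟨j, hj, _, hj'⟩ := choice_model (R := fun x i => (∀ y, y ∈ x → app i y ⊆ κ) ∧
    ∀ y, y ∈ x → ∀ z, z ∈ x → app i y = app i z → y = z) inferInstance hs h
  have : Fact (s ∈ M) := ⟨hs⟩
  obtain ⟨k, hk, _, hk'⟩ := choice_model (R := fun y x => x ∈ s ∧ y ∈ x) inferInstance
    (sUnion_mem hs) fun y hy => by
      obtain ⟨x, hx, hy⟩ := ZFSet.mem_sUnion.1 hy
      exact ⟨x, hM.trans hs hx, hx, hy⟩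
  have : Fact (p ∈ M) := ⟨hp⟩
  have : Fact (i ∈ M) := ⟨hi⟩
  have : Fact (j ∈ M) := ⟨hj⟩
  have : Fact (k ∈ M) := ⟨hk⟩
  have hF : lam (fun y => ZFSet.sep (fun z =>
      (∃ ξ ∈ κ, z = app p (ZFSet.pair ∅ ξ) ∧ ξ ∈ app i (app k y)) ∨
      ∃ ξ ∈ κ, z = app p (ZFSet.pair (insert ∅ ∅) ξ) ∧ ξ ∈ app (app j (app k y)) y) κ)
      (ZFSet.sUnion s) ∈ M := DfnT.mem inferInstance
  refine ⟨_, hF, fun y hy => ?_, fun y hy y' hy' he => ?_⟩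
  · rw [app_lam hy]
    exact ZFSet.sep_subset
  · rw [app_lam hy, app_lam hy'] at he
    have e1 : ∀ y, ∀ ξ ∈ κ, (app p (ZFSet.pair ∅ ξ) ∈ ZFSet.sep (fun z =>
        (∃ ξ ∈ κ, z = app p (ZFSet.pair ∅ ξ) ∧ ξ ∈ app i (app k y)) ∨
        ∃ ξ ∈ κ, z = app p (ZFSet.pair (insert ∅ ∅) ξ) ∧ ξ ∈ app (app j (app k y)) y) κ ↔
        ξ ∈ app i (app k y)) := by
      intro y ξ hξ
      rw [ZFSet.mem_sep]
      constructor
      · rintro ⟨_, ⟨η, hη, e, h⟩ | ⟨η, hη, e, h⟩⟩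
        · rwa [(hpi _ h0 _ hξ _ h0 _ hη e).2]
        · exact (h01 (hpi _ h0 _ hξ _ h1 _ hη e).1).elim
      · exact fun h => ⟨hpκ _ h0 _ hξ, Or.inl ⟨ξ, hξ, rfl, h⟩⟩
    have e2 : ∀ y, ∀ ξ ∈ κ, (app p (ZFSet.pair (insert ∅ ∅) ξ) ∈ ZFSet.sep (fun z =>
        (∃ ξ ∈ κ, z = app p (ZFSet.pair ∅ ξ) ∧ ξ ∈ app i (app k y)) ∨
        ∃ ξ ∈ κ, z = app p (ZFSet.pair (insert ∅ ∅) ξ) ∧ ξ ∈ app (app j (app k y)) y) κ ↔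
        ξ ∈ app (app j (app k y)) y) := by
      intro y ξ hξ
      rw [ZFSet.mem_sep]
      constructor
      · rintro ⟨_, ⟨η, hη, e, h⟩ | ⟨η, hη, e, h⟩⟩
        · exact (h01 (hpi _ h1 _ hξ _ h0 _ hη e).1.symm).elim
        · rwa [(hpi _ h1 _ hξ _ h1 _ hη e).2]
      · exact fun h => ⟨hpκ _ h1 _ hξ, Or.inr ⟨ξ, hξ, rfl, h⟩⟩
    obtain ⟨a1, a2⟩ := hk' y hy
    obtain ⟨b1, b2⟩ := hk' y' hy'
    have hkk : app k y = app k y' := by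
      refine hi2 _ a1 _ b1 (ZFSet.ext fun ξ => ⟨fun hξ => ?_, fun hξ => ?_⟩)
      · have hξκ := hi1 _ a1 hξ
        exact (e1 y' ξ hξκ).1 (he ▸ (e1 y ξ hξκ).2 hξ)
      · have hξκ := hi1 _ b1 hξ
        exact (e1 y ξ hξκ).1 (he ▸ (e1 y' ξ hξκ).2 hξ)
    obtain ⟨c1, c2⟩ := hj' _ b1
    rw [hkk] at a2
    refine c2 _ a2 _ b2 (ZFSet.ext fun ξ => ⟨fun hξ => ?_, fun hξ => ?_⟩)
    · have hξκ := c1 _ a2 hξ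
      exact (e2 y' ξ hξκ).1 (he ▸ (e2 y ξ hξκ).2 (by rwa [hkk]))
    · have hξκ := c1 _ b2 hξ
      have := (e2 y ξ hξκ).1 (he ▸ (e2 y' ξ hξκ).2 hξ)
      rwa [hkk] at this

theorem Small.union (hκ : IsInfCard κ) (h0 : ∅ ∈ κ) {s t : ZFSet} (hsM : s ∈ M) (htM : t ∈ M)
    (hs : Small M κ s) (ht : Small M κ t) : Small M κ (s ∪ t) := by
  rw [show s ∪ t = ZFSet.sUnion {s, t} by ext z; simp]
  refine Small.sUnion hκ h0 (pair_set_mem hsM htM) (small_pair hκ hsM htM h0) fun x hx => ?_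
  rcases ZFSet.mem_pair.1 hx with rfl | rfl <;> assumption

instance Dfn.hSmall {t : (ℕ → ZFSet) → ZFSet} [ht : DfnT M t] : Dfn M fun v => HSmall M κ (t v) :=
  Dfn.comp₁ (Q := fun t => HSmall M κ t) ht (inferInstanceAs (Dfn M fun v => ∃ t, t ∈ M ∧
    (t.IsTransitive ∧ v 0 ⊆ t ∧ Small M κ t)))

theorem small_of_mem_hull {x : ZFSet} (h : x ∈ hull M κ) : Small M κ x := by
  obtain ⟨_, t, _, _, h1, h2⟩ := mem_hull.1 h
  exact h2.mono h1

theorem hull_trans {x y : ZFSet} (h : x ∈ hull M κ) (hy : y ∈ x) : y ∈ hull M κ := by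
  obtain ⟨hx, t, ht, h1, h2, h3⟩ := mem_hull.1 h
  exact mem_hull.2 ⟨hM.trans hx hy, t, ht, h1, h1.subset_of_mem (h2 hy), h3⟩

theorem mem_hull_of_small (hκ : IsInfCard κ) (h0 : ∅ ∈ κ) {x : ZFSet} (hx : x ∈ M)
    (h : ∀ y ∈ x, y ∈ hull M κ) (hs : Small M κ x) : x ∈ hull M κ := by
  obtain ⟨T, hT, _, hT'⟩ := choice_model (R := fun y t => t.IsTransitive ∧ y ⊆ t ∧ Small M κ t)
    inferInstance hx fun y hy => (mem_hull.1 (h y hy)).2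
  have : Fact (x ∈ M) := ⟨hx⟩
  have : Fact (T ∈ M) := ⟨hT⟩
  have hr : repl (fun y => app T y) x ∈ M := DfnT.mem inferInstance
  refine mem_hull.2 ⟨hx, x ∪ ZFSet.sUnion (repl (fun y => app T y) x),
    union_mem hx (sUnion_mem hr), ?_, fun y hy => ZFSet.mem_union.2 (Or.inl hy), ?_⟩
  · intro y hy z hz
    refine ZFSet.mem_union.2 (Or.inr (ZFSet.mem_sUnion.2 ?_))
    rcases ZFSet.mem_union.1 hy with hy | hy
    · exact ⟨_, mem_repl.2 ⟨y, hy, rfl⟩, (hT' y hy).2.1 hz⟩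
    · obtain ⟨t, ht, hyt⟩ := ZFSet.mem_sUnion.1 hy
      obtain ⟨y', hy', rfl⟩ := mem_repl.1 ht
      exact ⟨_, ht, (hT' y' hy').1.mem_trans hz hyt⟩
  · refine hs.union hκ h0 hx (sUnion_mem hr) (Small.sUnion hκ h0 hr ?_ ?_)
    · exact hs.of_surj hx hr hT fun y hy => by
        obtain ⟨x, hx, rfl⟩ := mem_repl.1 hy
        exact ⟨x, hx, rfl⟩
    · intro y hy
      obtain ⟨x, hx, rfl⟩ := mem_repl.1 hy
      exact (hT' x hx).2.2

theorem mem_hull_of_subset (hκ : IsInfCard κ) (h0 : ∅ ∈ κ) {x y : ZFSet} (hy : y ∈ hull M κ)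
    (hx : x ∈ M) (h : x ⊆ y) : x ∈ hull M κ :=
  mem_hull_of_small hκ h0 hx (fun _ hz => hull_trans hy (h hz)) ((small_of_mem_hull hy).mono h)

/-- Satisfaction in the hull is definable in the model. -/
theorem dfn_interp_hull (φ : SetFormula) (hφ : φ.PredFree) :
    Dfn M fun v => Interp zmem zeq ∅ (memsOf (hull M κ)) φ v := by
  have hquant : ∀ (i : ℕ) (φ : SetFormula), (Dfn M fun v =>
    Interp zmem zeq ∅ (memsOf (hull M κ)) φ v) →
      Dfn M fun w => Interp zmem zeq ∅ (memsOf (hull M κ)) φ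
        (Function.update (fun k => w (k + 1)) i (w 0)) := by
    intro i φ h
    have hσ : Function.Injective fun k => if k = i then 0 else k + 1 := by
      intro a b hab
      simp only at hab
      split_ifs at hab <;> omega
    refine (h.rename hσ).congr fun v _ => ?_
    rw [show (fun k => v (if k = i then 0 else k + 1)) =
      Function.update (fun k => v (k + 1)) i (v 0) from ?_]
    funext k
    by_cases hk : k = i
    · subst hk; simp
    · simp [hk]
  induction φ with
  | mem i j => exact (inferInstance : Dfn M fun v => v i ∈ v j)
  | eq i j => exact (inferInstance : Dfn M fun v => v i = v j)
  | pred => exact hφ.elim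
  | not φ ih =>
    have := ih hφ
    exact Dfn.not
  | and φ ψ ih₁ ih₂ =>
    have := ih₁ hφ.1
    have := ih₂ hφ.2
    exact Dfn.and
  | or φ ψ ih₁ ih₂ =>
    have := ih₁ hφ.1
    have := ih₂ hφ.2
    exact Dfn.or
  | ball i j φ ih =>
    have := hquant i φ (ih hφ)
    refine Dfn.congr (R := fun v => ∀ x, x ∈ M → (HSmall M κ x → x ∈ v j →
      Interp zmem zeq ∅ (memsOf (hull M κ)) φ (Function.update v i x))) inferInstance fun v hv => ?_
    exact ⟨fun h x hx hj => h x (mem_hull.1 hx).1 (mem_hull.1 hx).2 hj,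
      fun h x hx hs => h x (mem_hull.2 ⟨hx, hs⟩)⟩
  | bex i j φ ih =>
    have := hquant i φ (ih hφ)
    refine Dfn.congr (R := fun v => ∃ x, x ∈ M ∧ (HSmall M κ x ∧ x ∈ v j ∧
      Interp zmem zeq ∅ (memsOf (hull M κ)) φ (Function.update v i x))) inferInstance fun v hv => ?_
    exact ⟨fun ⟨x, hx, hs, h⟩ => ⟨x, mem_hull.2 ⟨hx, hs⟩, h⟩,
      fun ⟨x, hx, h⟩ => ⟨x, (mem_hull.1 hx).1, (mem_hull.1 hx).2, h⟩⟩
  | all i φ ih =>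
    have := hquant i φ (ih hφ)
    refine Dfn.congr (R := fun v => ∀ x, x ∈ M → (HSmall M κ x →
      Interp zmem zeq ∅ (memsOf (hull M κ)) φ (Function.update v i x))) inferInstance fun v hv => ?_
    exact ⟨fun h x hx => h x (mem_hull.1 hx).1 (mem_hull.1 hx).2,
      fun h x hx hs => h x (mem_hull.2 ⟨hx, hs⟩)⟩
  | ex i φ ih =>
    have := hquant i φ (ih hφ)
    refine Dfn.congr (R := fun v => ∃ x, x ∈ M ∧ (HSmall M κ x ∧
      Interp zmem zeq ∅ (memsOf (hull M κ)) φ (Function.update v i x))) inferInstance fun v hv => ?_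
    exact ⟨fun ⟨x, hx, hs, h⟩ => ⟨x, mem_hull.2 ⟨hx, hs⟩, h⟩,
      fun ⟨x, hx, h⟩ => ⟨x, (mem_hull.1 hx).1, (mem_hull.1 hx).2, h⟩⟩

end

section

variable {M κ : ZFSet.{u}} [hM : TransModel M] [hκM : Fact (κ ∈ M)]

/-- Substituting parameters for all variables but the first two preserves definability. -/
theorem Dfn.update₂ {R : (ℕ → ZFSet) → Prop} (hR : Dfn M R) {v : ℕ → ZFSet} (hv : ∀ k, v k ∈ M) :
    Dfn M fun w => R (Function.update (Function.update v 0 (w 0)) 1 (w 1)) := by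
  obtain ⟨φ, h1, p, h2, h3⟩ := hR.out
  have hinj : Function.Injective fun n : ℕ => if n = 0 ∨ n = 2 then n else 2 * n + 1 := by
    intro a b hab
    simp only at hab
    split_ifs at hab <;> omega
  refine ⟨φ.rename (fun n : ℕ => if n = 0 ∨ n = 2 then n else 2 * n + 1), h1.rename _, mix v p,
    mix_mem hv h2, fun w hw => ?_⟩
  rw [interp_rename hinj, ← h3]
  · refine Eq.to_iff (congrArg _ (funext fun n => ?_))
    simp only [Function.comp_apply]
    split_ifs with hn
    · rcases hn with rfl | rfl <;> simp [mix]
    · have e : mix w (mix v p) (2 * n + 1) = mix v p n := by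
        simp only [mix]
        rw [if_neg (by omega), show (2 * n + 1) / 2 = n by omega]
      rw [e]
      unfold mix
      split_ifs with h
      · rw [Function.update_of_ne (by omega), Function.update_of_ne (by omega)]
      · rfl
  · intro k
    rcases k with _ | _ | k <;> simp [hw, hv]

/-- Substituting parameters for all variables but the first preserves definability. -/
theorem Dfn.update₁ {R : (ℕ → ZFSet) → Prop} (hR : Dfn M R) {v : ℕ → ZFSet} (hv : ∀ k, v k ∈ M) :
    Dfn M fun w => R (Function.update v 0 (w 0)) := by
  have : Fact (v 1 ∈ M) := ⟨hv 1⟩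
  refine (Dfn.comp₂ (Q := fun x y => R (Function.update (Function.update v 0 x) 1 y))
    (s := fun w => w 0) (t := fun _ => v 1) inferInstance inferInstance (hR.update₂ hv)).congr
    fun w _ => Eq.to_iff (congrArg R (funext fun n => ?_))
  rcases n with _ | _ | n <;> simp

theorem pair_set_mem_hull (hκ : IsInfCard κ) (h0 : ∅ ∈ κ) {a b : ZFSet} (ha : a ∈ hull M κ)
    (hb : b ∈ hull M κ) : ({a, b} : ZFSet) ∈ hull M κ := by
  refine mem_hull_of_small hκ h0 (pair_set_mem (mem_hull.1 ha).1 (mem_hull.1 hb).1) (fun y hy => ?_)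
    (small_pair hκ (mem_hull.1 ha).1 (mem_hull.1 hb).1 h0)
  rcases ZFSet.mem_pair.1 hy with rfl | rfl <;> assumption

theorem pair_mem_hull (hκ : IsInfCard κ) (h0 : ∅ ∈ κ) {a b : ZFSet} (ha : a ∈ hull M κ)
    (hb : b ∈ hull M κ) : ZFSet.pair a b ∈ hull M κ := by
  refine pair_set_mem_hull hκ h0 ?_ (pair_set_mem_hull hκ h0 ha hb)
  rw [← ZFSet.pair_eq_singleton]
  exact pair_set_mem_hull hκ h0 ha ha

theorem repl_mem_hull (hκ : IsInfCard κ) (h0 : ∅ ∈ κ) {f d : ZFSet} (hf : f ∈ M)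
    (hd : d ∈ hull M κ) (h : ∀ x ∈ d, app f x ∈ hull M κ) : repl (app f) d ∈ hull M κ := by
  have hdM := (mem_hull.1 hd).1
  have : Fact (f ∈ M) := ⟨hf⟩
  have : Fact (d ∈ M) := ⟨hdM⟩
  have hr : repl (fun x => app f x) d ∈ M := DfnT.mem inferInstance
  refine mem_hull_of_small hκ h0 hr (fun y hy => ?_)
    ((small_of_mem_hull hd).of_surj hdM hr hf fun y hy => ?_)
  · obtain ⟨x, hx, rfl⟩ := mem_repl.1 hy
    exact h x hx
  · obtain ⟨x, hx, rfl⟩ := mem_repl.1 hy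
    exact ⟨x, hx, rfl⟩

theorem funOn_mem_hull (hκ : IsInfCard κ) (h0 : ∅ ∈ κ) {f d : ZFSet} (hf : f ∈ M)
    (hfn : FunOn d f) (hd : d ∈ hull M κ) (h : ∀ x ∈ d, app f x ∈ hull M κ) : f ∈ hull M κ := by
  have hdM := (mem_hull.1 hd).1
  have : Fact (f ∈ M) := ⟨hf⟩
  have : Fact (d ∈ M) := ⟨hdM⟩
  have hg : lam (fun x => ZFSet.pair x (app f x)) d ∈ M := DfnT.mem inferInstance
  have := repl_mem_hull hκ h0 hg hd fun x hx => by
    rw [app_lam hx]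
    exact pair_mem_hull hκ h0 (hull_trans hd hx) (h x hx)
  convert this using 1
  ext p
  rw [show f = lam (app f) d from hfn, mem_lam, mem_repl, ← show f = lam (app f) d from hfn]
  refine exists_congr fun x => and_congr_right fun hx => ?_
  rw [app_lam hx]

theorem transModel_hull (hκ : IsInfCard κ) {w : ZFSet} (hw : IsOmega w) (hwκ : w ∈ κ)
    (hκh : κ ∈ hull M κ) : TransModel (hull M κ) := by
  have h0 : ∅ ∈ κ := hκ.ord.isTransitive.mem_trans hw.zero hwκ
  have hT : ∀ x ∈ memsOf (hull M κ), ∀ y ∈ x, y ∈ memsOf (hull M κ) := fun x hx y hy =>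
    hull_trans hx hy
  have hmod : ∀ {x}, x ∈ memsOf (hull M κ) → x ∈ M := fun hx => (mem_hull.1 hx).1
  refine ⟨fun hx hy => hull_trans hx hy, ⟨?_, ?_, ?_, ?_, ?_, ?_⟩, ?_, ?_⟩
  · exact fun a ha b hb h => ZFSet.ext fun z => ⟨fun hz => (h z (hT a ha z hz)).1 hz,
      fun hz => (h z (hT b hb z hz)).2 hz⟩
  · exact fun a ha b hb => ⟨{a, b}, pair_set_mem_hull hκ h0 ha hb, fun z _ => ZFSet.mem_pair⟩
  · refine fun a ha => ⟨ZFSet.sUnion a, mem_hull_of_small hκ h0 (sUnion_mem (hmod ha)) ?_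
      (Small.sUnion hκ h0 (hmod ha) (small_of_mem_hull ha) fun x hx =>
        small_of_mem_hull (hull_trans ha hx)), fun z _ => ?_⟩
    · intro y hy
      obtain ⟨x, hx, hy⟩ := ZFSet.mem_sUnion.1 hy
      exact hull_trans (hull_trans ha hx) hy
    · refine ZFSet.mem_sUnion.trans ⟨fun ⟨y, hy, hz⟩ => ⟨y, hT a ha y hy, hy, hz⟩,
        fun ⟨y, _, hy, hz⟩ => ⟨y, hy, hz⟩⟩
  · have hwh := hull_trans hκh hwκ
    refine ⟨w, hwh, ⟨∅, hull_trans hwh hw.zero, hw.zero, fun z _ => ZFSet.notMem_empty z⟩,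
      fun x hx hxw => ⟨insert x x, hull_trans hwh (hw.succ x hxw), hw.succ x hxw, fun z _ => ?_⟩⟩
    exact ZFSet.mem_insert_iff.trans or_comm
  · rintro a ha ⟨x, _, hx⟩
    obtain ⟨m, hm, hmin⟩ := exists_mem_min (fun m => m ∈ a) hx
    exact ⟨m, hT a ha m hm, hm, fun z _ hz hzm => hmin z hzm hz⟩
  · intro a ha
    obtain ⟨o, ho, hord, f, hf, hbij⟩ := exists_bijFun_ordinal (hmod ha)
    have hoh : o ∈ hull M κ := by
      have hs : Small M κ o := (small_of_mem_hull ha).of_injOn ho hf hbij.2.1 hbij.2.2.1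
      exact mem_hull.2 ⟨ho, o, ho, hord.isTransitive, fun _ hx => hx, hs⟩
    have hfh : f ∈ hull M κ := funOn_mem_hull hκ h0 hf hbij.1 hoh fun x hx =>
      hull_trans ha (hbij.2.1 x hx)
    exact ⟨o, hoh, (isOrdG_iff hT hoh).2 hord, f, hfh, (isBijFunG_iff hT hoh (hT a ha) hfh).2 hbij⟩
  · intro φ hφ v hv a ha h
    have hR : Dfn M fun w => HSmall M κ (w 1) ∧ Interp zmem zeq ∅ (memsOf (hull M κ)) φ
        (Function.update (Function.update v 0 (w 0)) 1 (w 1)) := by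
      have := (dfn_interp_hull (M := M) (κ := κ) φ hφ).update₂ fun k => hmod (hv k)
      infer_instance
    obtain ⟨f, hf, _, hf'⟩ := choice_model (R := fun x y => HSmall M κ y ∧
      Interp zmem zeq ∅ (memsOf (hull M κ)) φ (Function.update (Function.update v 0 x) 1 y))
      hR (hmod ha) fun x hx => by
        obtain ⟨y, hy, hxy⟩ := h x (hT a ha x hx) hx
        exact ⟨y, hmod hy, (mem_hull.1 hy).2, hxy⟩
    have hfa : ∀ x ∈ a, app f x ∈ hull M κ := fun x hx => by
      have : Fact (f ∈ M) := ⟨hf⟩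
      have : Fact (x ∈ M) := ⟨hM.trans (hmod ha) hx⟩
      exact mem_hull.2 ⟨DfnT.mem inferInstance, (hf' x hx).1⟩
    exact ⟨_, repl_mem_hull hκ h0 hf ha hfa, fun x _ hx => ⟨_, hfa x hx, mem_repl.2 ⟨x, hx, rfl⟩,
      (hf' x hx).2⟩⟩
  · intro φ hφ v hv a ha
    have hd := (dfn_interp_hull (M := M) (κ := κ) φ hφ).update₁ fun k => hmod (hv k)
    exact ⟨_, mem_hull_of_subset hκ h0 ha (sep_mem (R := fun x =>
      Interp zmem zeq ∅ (memsOf (hull M κ)) φ (Function.update v 0 x)) hd (hmod ha))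
      ZFSet.sep_subset, fun x _ => ZFSet.mem_sep⟩

theorem isUF_hull {u : ZFSet} (hU : IsUF M κ u) : IsUF (hull M κ) κ u :=
  ⟨hU.sub, hU.top, fun A hA B hB => hU.up A hA B (mem_hull.1 hB).1, hU.inter, hU.ne,
    fun A hA => hU.ult A (mem_hull.1 hA).1, hU.tail, fun F hF => hU.diag F (mem_hull.1 hF).1⟩

theorem isCode_hull (hκ : IsInfCard κ) (h0 : ∅ ∈ κ) (hP : ∀ x ∈ M, x ⊆ κ → x ∈ hull M κ) {t : ZFSet}
    (ht : t ∈ hull M κ) : ∃ i, IsCode (hull M κ) κ t i := by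
  obtain ⟨i, hi, h1, h2⟩ := small_of_mem_hull ht
  have htM := (mem_hull.1 ht).1
  have : Fact (t ∈ M) := ⟨htM⟩
  have : Fact (i ∈ M) := ⟨hi⟩
  have hl : lam (fun x => app i x) t ∈ M := DfnT.mem inferInstance
  refine ⟨lam (fun x => app i x) t, funOn_mem_hull hκ h0 hl (funOn_lam _ _) ht fun x hx => ?_,
    fun x hx => ?_, fun x hx y hy he => ?_⟩
  · rw [app_lam hx]
    have : Fact (x ∈ M) := ⟨hM.trans htM hx⟩
    exact hP _ (DfnT.mem inferInstance) (h1 x hx)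
  · rw [app_lam hx]
    exact h1 x hx
  · rw [app_lam hx, app_lam hy] at he
    exact h2 x hx y hy he

theorem powerset_mem_hull (hκ : κ.IsOrdinal) {P : ZFSet} (hP : P ∈ M)
    (hPs : ∀ x, x ∈ P ↔ x ∈ M ∧ x ⊆ κ) : P ∈ hull M κ := by
  refine mem_hull.2 ⟨hP, P, hP, fun x hx y hy => ?_, fun _ hx => hx,
    Small.of_subset_powerset hP fun x hx => ((hPs x).1 hx).2⟩
  have hyκ := ((hPs x).1 hx).2 hy
  exact (hPs y).2 ⟨hM.trans hκM.out hyκ, hκ.isTransitive.subset_of_mem hyκ⟩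

theorem IsUF.exists_powerset {u : ZFSet} (hU : IsUF M κ u) (hu : u ∈ M) :
    ∃ P ∈ M, ∀ x, x ∈ P ↔ x ∈ M ∧ x ⊆ κ := by
  have : Fact (u ∈ M) := ⟨hu⟩
  have hr : repl (fun A => κ \ A) u ∈ M := DfnT.mem inferInstance
  refine ⟨u ∪ repl (fun A => κ \ A) u, union_mem hu hr, fun x => ?_⟩
  rw [ZFSet.mem_union, mem_repl]
  constructor
  · rintro (h | ⟨A, hA, rfl⟩)
    · exact ⟨hM.trans hu h, hU.sub x h⟩
    · exact ⟨hM.trans hr (mem_repl.2 ⟨A, hA, rfl⟩), fun z hz => (ZFSet.mem_sdiff.1 hz).1⟩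
  · rintro ⟨hx, hxκ⟩
    rcases hU.ult x hx hxκ with h | h
    · exact Or.inl h
    · refine Or.inr ⟨_, h, ZFSet.ext fun z => ?_⟩
      rw [ZFSet.mem_sdiff, ZFSet.mem_sdiff]
      exact ⟨fun hz => ⟨hxκ hz, fun h => h.2 hz⟩, fun hz => by_contra fun hz' => hz.2 ⟨hz.1, hz'⟩⟩

theorem IsStage.mem_model {h v : ZFSet} (hs : IsStage κ h v) (hκ : κ.IsOrdinal) (hv : v ∈ M) :
    h ∈ M := by
  have : Fact (v ∈ M) := ⟨hv⟩
  obtain ⟨c, hc, hcf, hrec⟩ := recursion_model (M := M) (a := κ) (r := fun y x => y ∈ x)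
    (T := fun x g => ZFSet.sep (fun z => ∃ η ∈ x, z ⊆ app g η) v) fun s _ _ hne => by
      obtain ⟨x, hx⟩ := exists_mem_of_ne hne
      obtain ⟨m, hm, hmin⟩ := exists_mem_min (fun m => m ∈ s) hx
      exact ⟨m, hm, fun y hy hym => hmin y hym hy⟩
  have key : ∀ ξ : ZFSet.{u}, ξ ∈ κ → app c ξ = app h ξ := by
    intro ξ
    induction ξ using ZFSet.inductionOn with
    | _ ξ ih =>
      intro hξ
      rw [hrec ξ hξ]
      ext z
      rw [ZFSet.mem_sep, hs.mem_app ξ hξ]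
      have e : ∀ η ∈ ξ, app (lam (app c) (ZFSet.sep (fun y => y ∈ ξ) κ)) η = app h η := by
        intro η hη
        have hηκ := hκ.isTransitive.mem_trans hη hξ
        rw [app_lam (ZFSet.mem_sep.2 ⟨hηκ, hη⟩), ih η hη hηκ]
      constructor
      · rintro ⟨_, η, hη, hz⟩
        exact ⟨η, hη, by rwa [← e η hη]⟩
      · rintro ⟨η, hη, hz⟩
        exact ⟨(hs.mem_stage z).2 ⟨ξ, hξ, (hs.mem_app ξ hξ z).2 ⟨η, hη, hz⟩⟩, η, hη,
          by rwa [e η hη]⟩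
  rwa [show h = c from hs.fn.ext hcf fun x hx => (key x hx).symm]

theorem IsStage.card_app_lt {h v : ZFSet.{u}} (hs : IsStage κ h v) (hκ : IsInfCard κ)
    (hv : v.card ≤ κ.card) {ξ : ZFSet} (hξ : ξ ∈ κ) : (app h ξ).card < κ.card := by
  refine lt_of_lt_of_le (Cardinal.cantor _) ?_
  rw [← ZFSet.card_powerset]
  refine (ZFSet.card_mono fun z hz => ?_).trans hv
  have hξ' := hκ.succ_mem hξ
  exact (hs.mem_stage z).2 ⟨_, hξ', (hs.mem_app _ hξ' z).2 ⟨ξ, ZFSet.mem_insert ξ ξ,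
    ZFSet.mem_powerset.1 hz⟩⟩

theorem IsStage.mem_hull {h v : ZFSet} (hs : IsStage κ h v) (hκ : IsInfCard κ) (h0 : ∅ ∈ κ)
    (hv : v ∈ M) (hvc : v.card ≤ κ.card) : v ∈ hull M κ := by
  have hh := hs.mem_model hκ.ord hv
  have : Fact (h ∈ M) := ⟨hh⟩
  have hr : repl (fun ξ => app h ξ) κ ∈ M := DfnT.mem inferInstance
  have hκs : ∀ o, o ∈ M → o ⊆ κ → Small M κ o := fun o ho hoκ => Small.of_subset_powerset ho
    fun x hx => hκ.ord.isTransitive.subset_of_mem (hoκ hx)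
  have hsm : Small M κ (ZFSet.sUnion (repl (fun ξ => app h ξ) κ)) := by
    refine Small.sUnion hκ h0 hr ((hκs κ hκM.out fun _ hx => hx).of_surj hκM.out hr hh fun y hy =>
      ?_)
      fun y hy => ?_
    · obtain ⟨x, hx, rfl⟩ := mem_repl.1 hy
      exact ⟨x, hx, rfl⟩
    · have hyM := hM.trans hr hy
      obtain ⟨x, hx, rfl⟩ := mem_repl.1 hy
      obtain ⟨o, ho, hord, f, hf, hbij⟩ := exists_bijFun_ordinal hyM
      have hoκ : o ∈ κ := hκ.mem_of_card_lt hord (hbij.card_eq ▸ hs.card_app_lt hκ hvc hx)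
      exact (hκs o ho (hκ.ord.isTransitive.subset_of_mem hoκ)).of_surj ho hyM hf hbij.2.2.2
  refine BabyMeasurable.mem_hull.2 ⟨hv, v, hv, hs.isTransitive hκ.ord, fun _ hx => hx, hsm.mono ?_⟩
  intro z hz
  obtain ⟨ξ, hξ, hz⟩ := (hs.mem_stage z).1 hz
  exact ZFSet.mem_sUnion.2 ⟨_, mem_repl.2 ⟨ξ, hξ, rfl⟩, hz⟩

end

theorem exists_collapsesIntoM {κ M u A : ZFSet.{u}} (h : IsWeakKappaModel κ M) (hA : A ∈ M)
    (hAκ : A ⊆ κ) (hu : u ∈ M) (hU : IsMUltrafilter κ M (memsOf u)) :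
    ∃ M u, IsWeakKappaModel κ M ∧ A ∈ M ∧ u ∈ M ∧ IsMUltrafilter κ M (memsOf u) ∧
      WellFounded (UltMem (memsOf M) κ (memsOf u)) ∧ CollapsesIntoM κ M (memsOf u) := by
  have hM := transModel_of_isWeakKappaModel h
  obtain ⟨hκ, w, hwκ, hw⟩ := isInfCard_and_isOmega_of_zIsInacc h.1
  have hκM := mem_of_isMUltrafilter h hu hU
  have : Fact (κ ∈ M) := ⟨hκM⟩
  have h0 : ∅ ∈ κ := hκ.ord.isTransitive.mem_trans hw.zero hwκ
  have hUF := isUF_of_isMUltrafilter h hu hU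
  obtain ⟨P, hP, hPs⟩ := hUF.exists_powerset hu
  have hPh := powerset_mem_hull hκ.ord hP hPs
  have hsub : ∀ x ∈ M, x ⊆ κ → x ∈ hull M κ := fun x hx hxκ => hull_trans hPh ((hPs x).2 ⟨hx, hxκ⟩)
  have hκh := hsub κ hκM fun _ hx => hx
  have huh : u ∈ hull M κ := mem_hull_of_subset hκ h0 hPh hu fun x hx =>
    (hPs x).2 ⟨hM.trans hu hx, hUF.sub x hx⟩
  have hN := transModel_hull hκ hw hwκ hκh
  obtain ⟨v, hv, hvs⟩ := h.2.2.2.1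
  obtain ⟨g, hg⟩ := exists_isStage hκ.ord hvs
  obtain ⟨f, hf⟩ := h.2.2.1
  have hMc : κ.card = M.card := (zIsBijFun_iff.1 hf).card_eq
  have hvh : v ∈ hull M κ := hg.mem_hull hκ h0 hv
    (hMc ▸ ZFSet.card_mono fun x hx => hM.trans hv hx)
  have hc : κ.card = (hull M κ).card := le_antisymm (ZFSet.card_mono fun x hx => hull_trans hκh hx)
    (hMc ▸ ZFSet.card_mono ZFSet.sep_subset)
  obtain ⟨e, he⟩ := exists_bijFun_of_card_eq hc
  have hUh := isUF_hull hUF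
  exact ⟨hull M κ, u, ⟨h.1, fun x _ hx y _ hy => hull_trans hx hy, ⟨e, zIsBijFun_iff.2 he⟩,
    ⟨v, hvh, hvs⟩, hN.models⟩, hsub A hA hAκ, huh,
    (isUFG_iff hκh fun x hx => hull_trans huh hx).2 hUh,
    collapsesIntoM_of_codes hUh hκh huh hκ hw hwκ hPh
      (fun x => (hPs x).trans ⟨fun hx => ⟨hsub x hx.1 hx.2, hx.2⟩,
        fun hx => ⟨(mem_hull.1 hx.1).1, hx.2⟩⟩) fun t ht => isCode_hull hκ h0 hsub ht⟩

end

/-- If κ is locally measurable, then every `A ⊆ κ` is an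
element of a weak κ-model `M` containing a set `U` that `M` thinks is a normal
ultrafilter on κ such that the ultrapower of `M` by `U` is well-founded and its
transitive collapse is contained in `M`; in particular, this holds whenever the
largest cardinal of the weak κ-model `M` is `(2^κ)^M`. -/
theorem locallyMeasurable_internal_ultrapower (κ : ZFSet)
    (h : LocallyMeasurable κ) :
    (∀ A : ZFSet, A ⊆ κ → ∃ M u : ZFSet,
      IsWeakKappaModel κ M ∧ A ∈ M ∧ u ∈ M ∧ IsMUltrafilter κ M (memsOf u) ∧
      WellFounded (UltMem (memsOf M) κ (memsOf u)) ∧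
      CollapsesIntoM κ M (memsOf u)) ∧
    (∀ M u A : ZFSet, IsWeakKappaModel κ M → A ⊆ κ → A ∈ M → u ∈ M →
      IsMUltrafilter κ M (memsOf u) → LargestCardIsContinuum κ M →
      WellFounded (UltMem (memsOf M) κ (memsOf u)) ∧
        CollapsesIntoM κ M (memsOf u)) := by
  refine ⟨fun A hA => ?_, fun M u A hM _ _ hu hU hL =>
    collapsesIntoM_of_largestCardIsContinuum hM hu hU hL⟩
  obtain ⟨M, u, hM, hAM, hu, hU⟩ := h.2 A hA
  exact exists_collapsesIntoM hM hAM hA hu hU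

end BabyMeasurable
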